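/- arXiv:2604.25829 — 2 statements merged into one kernel-verified Lean document; each statement's English description precedes it below -/
import Mathlib

section
/- Every 3-connected planar graph on at least 13 vertices contains an induced copy of P_5. -/
open SimpleGraph

/-- `G` contains a subdivision of `H`, i.e. `H` is a topological minor of `G`:
there are branch vertices given by an injection `f` and, for each edge of `H`,
a path in `G` between the corresponding branch vertices, such that these paths
are internally disjoint from each other and from the branch vertices. -/
def ContainsSubdivision {W V : Type*} (H : SimpleGraph W) (G : SimpleGraph V) : Prop :=
  ∃ (f : W ↪ V) (p : ∀ ⦃a b : W⦄, H.Adj a b → G.Walk (f a) (f b)),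
    (∀ ⦃a b : W⦄ (h : H.Adj a b), (p h).IsPath) ∧
    (∀ ⦃a b : W⦄ (h : H.Adj a b) (w : W), f w ∈ (p h).support → w = a ∨ w = b) ∧
    (∀ ⦃a b c d : W⦄ (h₁ : H.Adj a b) (h₂ : H.Adj c d), s(a, b) ≠ s(c, d) →
      ∀ x, x ∈ (p h₁).support → x ∈ (p h₂).support →
        (x = f a ∨ x = f b) ∧ (x = f c ∨ x = f d))

/-- A graph is planar iff it contains no subdivision of `K₅` or of `K₃,₃`
(Kuratowski's characterization). -/
def IsPlanar {V : Type*} (G : SimpleGraph V) : Prop :=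
  ¬ ContainsSubdivision (completeGraph (Fin 5)) G ∧
  ¬ ContainsSubdivision (completeBipartiteGraph (Fin 3) (Fin 3)) G

/-- `G` contains an induced copy of `F`. -/
def ContainsInduced {W V : Type*} (F : SimpleGraph W) (G : SimpleGraph V) : Prop :=
  ∃ s : Set V, Nonempty (F ≃g G.induce s)

/-- A graph is 3-connected if it has at least 4 vertices and deleting any set of at most
two vertices leaves it connected. -/
def ThreeConnected {V : Type*} [Fintype V] (G : SimpleGraph V) : Prop :=
  4 ≤ Fintype.card V ∧ ∀ s : Set V, s.ncard ≤ 2 → (G.induce sᶜ).Connected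

/-- `G` has an induced path on five vertices `a b c d e`. -/
def HasInducedP5 {V : Type*} (G : SimpleGraph V) : Prop :=
  ∃ a b c d e, G.Adj a b ∧ G.Adj b c ∧ G.Adj c d ∧ G.Adj d e ∧
    ¬ G.Adj a c ∧ ¬ G.Adj a d ∧ ¬ G.Adj a e ∧ ¬ G.Adj b d ∧ ¬ G.Adj b e ∧ ¬ G.Adj c e

/-- `S` is nonempty and induces a connected subgraph: a nonempty subset of `S` that is closed
under adjacency within `S` is all of `S`. -/
def ConnectedOn {V : Type*} (G : SimpleGraph V) (S : Set V) : Prop :=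
  S.Nonempty ∧ ∀ C ⊆ S, C.Nonempty → (∀ a ∈ C, ∀ b ∈ S, G.Adj a b → b ∈ C) → S ⊆ C

/-- `G` has a `K₃,₃` minor, given by its branch sets. -/
def HasK33Minor {V : Type*} (G : SimpleGraph V) : Prop :=
  ∃ S : Fin 3 ⊕ Fin 3 → Set V, (∀ i, ConnectedOn G (S i)) ∧ Pairwise (Function.onFun Disjoint S) ∧
    ∀ i j, ∃ a ∈ S (.inl i), ∃ b ∈ S (.inr j), G.Adj a b

/-- No two vertices separate `G`. -/
def NoTwoCut {V : Type*} (G : SimpleGraph V) : Prop :=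
  ∀ (s t : V) (C : Set V), C.Nonempty → s ∉ C → t ∉ C →
    (∀ a ∈ C, ∀ b, G.Adj a b → b ∈ C ∨ b = s ∨ b = t) → ∀ v, v ∈ C ∨ v = s ∨ v = t

/-- `H` arises from `G` by contracting the edge `xy`, and `φ` is the contraction map. -/
structure IsContraction {V W : Type*} (G : SimpleGraph V) (H : SimpleGraph W) (φ : V → W)
    (x y : V) : Prop where
  adj : G.Adj x y
  map_eq : φ x = φ y
  eq_or : ∀ u v, φ u = φ v → u = v ∨ (u = x ∧ v = y) ∨ (u = y ∧ v = x)
  surj : Function.Surjective φ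
  adj_iff : ∀ u v, H.Adj (φ u) (φ v) ↔ φ u ≠ φ v ∧ ∃ u' v', φ u' = φ u ∧ φ v' = φ v ∧ G.Adj u' v'

namespace IsContraction

variable {V W : Type*} {G : SimpleGraph V} {H : SimpleGraph W} {φ : V → W} {x y : V}

theorem symm (h : IsContraction G H φ x y) : IsContraction G H φ y x :=
  ⟨h.adj.symm, h.map_eq.symm, fun u v e => by have := h.eq_or u v e; tauto, h.surj, h.adj_iff⟩

theorem adj_iff_of_ne (h : IsContraction G H φ x y) {u v : V} (hux : u ≠ x) (huy : u ≠ y)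
    (hvx : v ≠ x) (hvy : v ≠ y) : H.Adj (φ u) (φ v) ↔ G.Adj u v := by
  have := h.eq_or
  rw [h.adj_iff]
  constructor
  · rintro ⟨-, u', v', hu, hv, huv⟩
    grind
  · intro huv
    exact ⟨by grind [huv.ne], u, v, rfl, rfl, huv⟩

theorem adj_iff_of_mem (h : IsContraction G H φ x y) {v : V} (hvx : v ≠ x) (hvy : v ≠ y) :
    H.Adj (φ x) (φ v) ↔ G.Adj x v ∨ G.Adj y v := by
  have := h.eq_or
  rw [h.adj_iff]
  constructor
  · rintro ⟨-, u', v', hu, hv, huv⟩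
    grind
  · have hne : φ x ≠ φ v := by grind
    rintro (huv | huv)
    · exact ⟨hne, x, v, rfl, rfl, huv⟩
    · exact ⟨hne, y, v, h.map_eq.symm, rfl, huv⟩

theorem hasInducedP5 (h : IsContraction G H φ x y) (hH : HasInducedP5 H) : HasInducedP5 G := by
  have hs : ∀ a : W, ∃ v, v ≠ y ∧ φ v = a := by
    intro a
    obtain ⟨v, rfl⟩ := h.surj a
    by_cases hv : v = y
    · exact ⟨x, h.adj.ne, hv ▸ h.map_eq⟩
    · exact ⟨v, hv, rfl⟩
  choose s hsy hsφ using hs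
  have h1 : ∀ a b, s a ≠ x → s b ≠ x → (H.Adj a b ↔ G.Adj (s a) (s b)) := fun a b ha hb => by
    rw [← h.adj_iff_of_ne ha (hsy a) hb (hsy b), hsφ, hsφ]
  have h2 : ∀ a b, s a = x → s b ≠ x → (H.Adj a b ↔ G.Adj x (s b) ∨ G.Adj y (s b)) :=
    fun a b ha hb => by rw [← h.adj_iff_of_mem hb (hsy b), ← ha, hsφ, hsφ]
  have h3 : ∀ a b, s a = x → s b = x → a = b := fun a b ha hb => by
    rw [← hsφ a, ← hsφ b, ha, hb]
  obtain ⟨a, b, c, d, e, ab, bc, cd, de, ac, ad, ae, bd, be, ce⟩ := hH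
  have hxy := h.adj
  have key : ∀ p q, p ≠ q → s p = x → s q ≠ x := fun p q hpq hp hq => hpq (h3 _ _ hp hq)
  have nab := ab.ne
  have nbc := bc.ne
  have ncd := cd.ne
  have nde := de.ne
  have nac : a ≠ c := by rintro rfl; exact ad cd
  have nad : a ≠ d := by rintro rfl; exact ae de
  have nae : a ≠ e := by rintro rfl; exact ad de.symm
  have nbd : b ≠ d := by rintro rfl; exact be de
  have nbe : b ≠ e := by rintro rfl; exact ae ab
  have nce : c ≠ e := by rintro rfl; exact be bc
  by_contra hG
  have hP : ∀ a b c d e, G.Adj a b → G.Adj b c → G.Adj c d → G.Adj d e → ¬ G.Adj a c →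
      ¬ G.Adj a d → ¬ G.Adj a e → ¬ G.Adj b d → ¬ G.Adj b e → G.Adj c e :=
    fun a b c d e p1 p2 p3 p4 p5 p6 p7 p8 p9 => by
      by_contra p10
      exact hG ⟨a, b, c, d, e, p1, p2, p3, p4, p5, p6, p7, p8, p9, p10⟩
  have hGs : ∀ u v, G.Adj u v ↔ G.Adj v u := fun u v => G.adj_comm u v
  have hHs : ∀ u v, H.Adj u v ↔ H.Adj v u := fun u v => H.adj_comm u v
  by_cases xa : s a = x
  · have xb := key a b nab xa
    have xc := key a c nac xa
    have xd := key a d nad xa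
    have xe := key a e nae xa
    rw [h1 _ _ xb xc] at bc; rw [h1 _ _ xc xd] at cd; rw [h1 _ _ xd xe] at de
    rw [h1 _ _ xb xd] at bd; rw [h1 _ _ xb xe] at be; rw [h1 _ _ xc xe] at ce
    rw [h2 _ _ xa xb] at ab; rw [h2 _ _ xa xc] at ac; rw [h2 _ _ xa xd] at ad
    rw [h2 _ _ xa xe] at ae
    have q1 := hP x (s b) (s c) (s d) (s e)
    have q2 := hP y (s b) (s c) (s d) (s e)
    clear h1 h2 h3 key hHs hG hP
    grind
  by_cases xb : s b = x
  · have xc := key b c nbc xb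
    have xd := key b d nbd xb
    have xe := key b e nbe xb
    rw [h1 _ _ xc xd] at cd; rw [h1 _ _ xd xe] at de; rw [h1 _ _ xa xc] at ac
    rw [h1 _ _ xa xd] at ad; rw [h1 _ _ xa xe] at ae; rw [h1 _ _ xc xe] at ce
    rw [hHs, h2 _ _ xb xa] at ab; rw [h2 _ _ xb xc] at bc; rw [h2 _ _ xb xd] at bd
    rw [h2 _ _ xb xe] at be
    have q1 := hP (s a) x (s c) (s d) (s e)
    have q2 := hP (s a) y (s c) (s d) (s e)
    have q3 := hP (s a) x y (s c) (s d)
    have q4 := hP (s a) y x (s c) (s d)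
    clear h1 h2 h3 key hHs hG hP
    grind
  by_cases xc : s c = x
  · have xd := key c d ncd xc
    have xe := key c e nce xc
    rw [h1 _ _ xa xb] at ab; rw [h1 _ _ xd xe] at de; rw [h1 _ _ xa xd] at ad
    rw [h1 _ _ xa xe] at ae; rw [h1 _ _ xb xd] at bd; rw [h1 _ _ xb xe] at be
    rw [hHs, h2 _ _ xc xa] at ac; rw [hHs, h2 _ _ xc xb] at bc; rw [h2 _ _ xc xd] at cd
    rw [h2 _ _ xc xe] at ce
    have q1 := hP (s a) (s b) x (s d) (s e)
    have q2 := hP (s a) (s b) y (s d) (s e)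
    have q3 := hP (s a) (s b) x y (s d)
    have q4 := hP (s a) (s b) y x (s d)
    clear h1 h2 h3 key hHs hG hP
    grind
  by_cases xd : s d = x
  · have xe := key d e nde xd
    rw [h1 _ _ xa xb] at ab; rw [h1 _ _ xb xc] at bc; rw [h1 _ _ xa xc] at ac
    rw [h1 _ _ xa xe] at ae; rw [h1 _ _ xb xe] at be; rw [h1 _ _ xc xe] at ce
    rw [hHs, h2 _ _ xd xa] at ad; rw [hHs, h2 _ _ xd xb] at bd; rw [hHs, h2 _ _ xd xc] at cd
    rw [h2 _ _ xd xe] at de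
    have q1 := hP (s a) (s b) (s c) x (s e)
    have q2 := hP (s a) (s b) (s c) y (s e)
    have q3 := hP (s a) (s b) (s c) x y
    have q4 := hP (s a) (s b) (s c) y x
    clear h1 h2 h3 key hHs hG hP
    grind
  by_cases xe : s e = x
  · rw [h1 _ _ xa xb] at ab; rw [h1 _ _ xb xc] at bc; rw [h1 _ _ xc xd] at cd
    rw [h1 _ _ xa xc] at ac; rw [h1 _ _ xa xd] at ad; rw [h1 _ _ xb xd] at bd
    rw [hHs, h2 _ _ xe xa] at ae; rw [hHs, h2 _ _ xe xb] at be; rw [hHs, h2 _ _ xe xc] at ce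
    rw [hHs, h2 _ _ xe xd] at de
    have q1 := hP (s a) (s b) (s c) (s d) x
    have q2 := hP (s a) (s b) (s c) (s d) y
    clear h1 h2 h3 key hHs hG hP
    grind
  · simp only [h1, xa, xb, xc, xd, xe, ne_eq, not_false_eq_true] at ab bc cd de ac ad ae bd be ce
    exact hG ⟨s a, s b, s c, s d, s e, ab, bc, cd, de, ac, ad, ae, bd, be, ce⟩

theorem connectedOn_preimage (h : IsContraction G H φ x y) {T : Set W} (hT : ConnectedOn H T) :
    ConnectedOn G (φ ⁻¹' T) := by
  have hxy : ∀ C ⊆ φ ⁻¹' T, (∀ a ∈ C, ∀ b ∈ φ ⁻¹' T, G.Adj a b → b ∈ C) →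
      ∀ u v, φ u = φ v → u ∈ C → v ∈ C := by
    intro C hC hcl u v huv hu
    have hv : v ∈ φ ⁻¹' T := by
      have := hC hu
      rwa [Set.mem_preimage, huv] at this
    rcases h.eq_or u v huv with rfl | ⟨rfl, rfl⟩ | ⟨rfl, rfl⟩
    · exact hu
    · exact hcl _ hu _ hv h.adj
    · exact hcl _ hu _ hv h.adj.symm
  refine ⟨?_, fun C hC hne hcl => ?_⟩
  · obtain ⟨a, ha⟩ := hT.1
    obtain ⟨v, rfl⟩ := h.surj a
    exact ⟨v, ha⟩
  · have hsat := hxy C hC hcl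
    have himg : φ '' C ⊆ T := Set.image_subset_iff.2 hC
    have := hT.2 (φ '' C) himg (hne.image φ) (by
      rintro _ ⟨u, hu, rfl⟩ b hb hub
      obtain ⟨v, rfl⟩ := h.surj b
      obtain ⟨-, u', v', huu, hvv, huv⟩ := (h.adj_iff u v).1 hub
      have hu' := hsat u u' huu.symm hu
      exact ⟨v', hcl u' hu' v' (by rwa [Set.mem_preimage, hvv]) huv, hvv⟩)
    intro v hv
    obtain ⟨u, hu, huv⟩ := this hv
    exact hsat u v huv hu

theorem hasK33Minor (h : IsContraction G H φ x y) (hH : HasK33Minor H) : HasK33Minor G := by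
  obtain ⟨S, hc, hd, ha⟩ := hH
  refine ⟨fun i => φ ⁻¹' S i, fun i => h.connectedOn_preimage (hc i),
    fun i j hij => (hd hij).preimage φ, fun i j => ?_⟩
  obtain ⟨a, ha, b, hb, hab⟩ := ha i j
  obtain ⟨u, rfl⟩ := h.surj a
  obtain ⟨v, rfl⟩ := h.surj b
  obtain ⟨-, u', v', hu, hv, huv⟩ := (h.adj_iff u v).1 hab
  exact ⟨u', by simpa [hu] using ha, v', by simpa [hv] using hb, huv⟩

end IsContraction

theorem exists_isContraction {V : Type*} (G : SimpleGraph V) {x y : V} (hxy : G.Adj x y) :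
    ∃ (H : SimpleGraph {v // v ≠ y}) (φ : V → {v // v ≠ y}), IsContraction G H φ x y := by
  classical
  let φ : V → {v // v ≠ y} := fun v => if h : v = y then ⟨x, hxy.ne⟩ else ⟨v, h⟩
  have hφ : ∀ v, (φ v : V) = if v = y then x else v := by
    intro v
    by_cases h : v = y <;> simp [φ, h]
  refine ⟨⟨fun a b => a ≠ b ∧ ∃ u v, φ u = a ∧ φ v = b ∧ G.Adj u v, ⟨?_⟩, ⟨?_⟩⟩, φ, hxy, ?_, ?_, ?_,
    fun u v => Iff.rfl⟩
  · rintro a b ⟨hab, u, v, hu, hv, huv⟩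
    exact ⟨hab.symm, v, u, hv, hu, huv.symm⟩
  · rintro a ⟨ha, -⟩
    exact ha rfl
  · apply Subtype.ext
    grind
  · intro u v huv
    have := congrArg Subtype.val huv
    grind
  · rintro ⟨v, hv⟩
    exact ⟨v, Subtype.ext (by grind)⟩

/-- `C` is one side of a separation of `G` whose separator is `{x, y, z}`. -/
def IsSide {V : Type*} (G : SimpleGraph V) (x y z : V) (C : Set V) : Prop :=
  C.Nonempty ∧ (x ∉ C ∧ y ∉ C ∧ z ∉ C) ∧
    (∀ a ∈ C, ∀ b, G.Adj a b → b ∈ C ∨ b = x ∨ b = y ∨ b = z) ∧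
    ∃ v, v ∉ C ∧ v ≠ x ∧ v ≠ y ∧ v ≠ z

/-- In a 3-connected graph some edge lies in no separating triple. -/
theorem NoTwoCut.exists_adj_forall_not_isSide {V : Type*} [Finite V] {G : SimpleGraph V}
    (hG : NoTwoCut G) {x₀ y₀ : V} (h₀ : G.Adj x₀ y₀) :
    ∃ x y, G.Adj x y ∧ ∀ z C, ¬ IsSide G x y z C := by
  by_contra! hcon
  have hex : ∃ n, ∃ x y z C, G.Adj x y ∧ IsSide G x y z C ∧ C.ncard = n := by
    obtain ⟨z, C, hC⟩ := hcon x₀ y₀ h₀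
    exact ⟨_, x₀, y₀, z, C, h₀, hC, rfl⟩
  classical
  obtain ⟨x, y, z, C, hxy, ⟨hne, ⟨hxC, hyC, hzC⟩, hcl, p, hpC, hpx, hpy, hpz⟩, hn⟩ :=
    Nat.find_spec hex
  have hmin : ∀ x' y' z' D, G.Adj x' y' → IsSide G x' y' z' D → D ⊂ C → False := by
    intro x' y' z' D hadj hD hDC
    exact Nat.find_min hex (hn ▸ Set.ncard_lt_ncard hDC) ⟨x', y', z', D, hadj, hD, rfl⟩
  obtain ⟨v, hvC, hzv⟩ : ∃ v ∈ C, G.Adj z v := by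
    by_contra! hno
    have := hG x y C hne hxC hyC (fun a ha b hab => by
      have := hcl a ha b hab
      have := hno a ha
      grind [G.adj_comm]) p
    grind
  have key : ∀ w D, IsSide G z v w D → x ∉ D → y ∉ D → False := by
    rintro w D ⟨hDne, ⟨hzD, hvD, hwD⟩, hDcl, q, hqD, hqz, hqv, hqw⟩ hxD hyD
    obtain ⟨d, hdD, hvd⟩ : ∃ d ∈ D, G.Adj v d := by
      by_contra! hno
      have := hG z w D hDne hzD hwD (fun a ha b hab => by
        have := hDcl a ha b hab
        have := hno a ha
        grind [G.adj_comm]) q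
      grind
    have hdC : d ∈ C := by
      have := hcl v hvC d hvd
      grind
    refine hmin z v w (D ∩ C) hzv ⟨⟨d, hdD, hdC⟩, ?_, ?_, q, ?_, hqz, hqv, hqw⟩ ?_
    · exact ⟨fun h => hzD h.1, fun h => hvD h.1, fun h => hwD h.1⟩
    · rintro a ⟨haD, haC⟩ b hab
      have h1 := hcl a haC b hab
      have h2 := hDcl a haD b hab
      grind
    · exact fun h => hqD h.1
    · exact ⟨Set.inter_subset_right, fun h => hvD (h hvC).1⟩
  obtain ⟨w, D, hD⟩ := hcon z v hzv
  by_cases h : x ∈ D ∨ y ∈ D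
  · obtain ⟨hDne, ⟨hzD, hvD, hwD⟩, hDcl, q, hqD, hqz, hqv, hqw⟩ := hD
    refine key w {u | u ∉ D ∧ u ≠ z ∧ u ≠ v ∧ u ≠ w} ⟨⟨q, hqD, hqz, hqv, hqw⟩, by simp, ?_, ?_⟩ ?_ ?_
    · rintro a ⟨haD, haz, hav, haw⟩ b hab
      by_cases hb : b ∈ D
      · have := hDcl b hb a hab.symm
        grind
      · simp only [Set.mem_ofPred_eq]
        tauto
    · obtain ⟨d, hd⟩ := hDne
      exact ⟨d, by simp [hd], by grind, by grind, by grind⟩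
    · rintro ⟨hxD, hxz, hxv, hxw⟩
      have := hDcl y (by tauto) x hxy.symm
      grind
    · rintro ⟨hyD, hyz, hyv, hyw⟩
      have := hDcl x (by tauto) y hxy
      grind
  · push Not at h
    exact key w D hD h.1 h.2

theorem IsContraction.noTwoCut {V W : Type*} {G : SimpleGraph V} {H : SimpleGraph W} {φ : V → W}
    {x y : V} (h : IsContraction G H φ x y) (hG : NoTwoCut G)
    (hxy : ∀ z C, ¬ IsSide G x y z C) : NoTwoCut H := by
  intro s t C hne hs ht hcl v
  by_contra! hv
  obtain ⟨s, rfl⟩ := h.surj s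
  obtain ⟨t, rfl⟩ := h.surj t
  obtain ⟨v, rfl⟩ := h.surj v
  obtain ⟨c, hc⟩ := hne
  obtain ⟨c, rfl⟩ := h.surj c
  have hcl' : ∀ a, φ a ∈ C → ∀ b, G.Adj a b → φ b ∈ C ∨ φ b = φ s ∨ φ b = φ t := by
    intro a ha b hab
    by_cases hφ : φ a = φ b
    · exact .inl (hφ ▸ ha)
    · exact hcl _ ha _ ((h.adj_iff a b).2 ⟨hφ, a, b, rfl, rfl, hab⟩)
  have e := h.eq_or
  have exy := h.map_eq
  by_cases hsx : φ s = φ x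
  · exact hxy t (φ ⁻¹' C) ⟨⟨c, hc⟩, ⟨by grind, by grind, by grind⟩, fun a ha b hab => by
      have := hcl' a ha b hab
      grind, v, by grind, by grind, by grind, by grind⟩
  by_cases htx : φ t = φ x
  · exact hxy s (φ ⁻¹' C) ⟨⟨c, hc⟩, ⟨by grind, by grind, by grind⟩, fun a ha b hab => by
      have := hcl' a ha b hab
      grind, v, by grind, by grind, by grind, by grind⟩
  · have := hG s t (φ ⁻¹' C) ⟨c, hc⟩ hs ht (fun a ha b hab => by
      have := hcl' a ha b hab
      grind) v
    grind

theorem ConnectedOn.exists_walk {V : Type*} {G : SimpleGraph V} {S : Set V} (hS : ConnectedOn G S)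
    {a b : V} (ha : a ∈ S) (hb : b ∈ S) : ∃ p : G.Walk a b, ∀ z ∈ p.support, z ∈ S := by
  have := hS.2 {v | ∃ p : G.Walk a v, ∀ z ∈ p.support, z ∈ S} (fun v ⟨p, hp⟩ => hp v p.end_mem_support)
    ⟨a, .nil, by simpa using ha⟩ (by
      rintro u ⟨p, hp⟩ v hv huv
      refine ⟨p.concat huv, fun z hz => ?_⟩
      simp only [Walk.support_concat, List.mem_append, List.mem_singleton] at hz
      rcases hz with hz | rfl
      exacts [hp z hz, hv])
  exact this hb

theorem SimpleGraph.Walk.exists_first_mem {V : Type*} {G : SimpleGraph V} {c e : V}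
    (q : G.Walk c e) (X : Set V) (he : e ∈ X) : ∃ m ∈ X, ∃ r : G.Walk c m,
      r.support ⊆ q.support ∧ ∀ z ∈ r.support, z ∈ X → z = m := by
  induction q with
  | nil => exact ⟨_, he, .nil, by simp, by simp⟩
  | @cons u v w h p ih =>
    by_cases hu : u ∈ X
    · exact ⟨u, hu, .nil, by simp, by simp⟩
    · obtain ⟨m, hm, r, hr, hrX⟩ := ih he
      refine ⟨m, hm, .cons h r, ?_, ?_⟩
      · simp only [Walk.support_cons]
        exact List.cons_subset_cons _ hr
      · intro z hz hzX
        rw [Walk.support_cons, List.mem_cons] at hz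
        rcases hz with rfl | hz
        exacts [absurd hzX hu, hrX z hz hzX]

/-- Three vertices of a connected set are joined by a (possibly degenerate) tripod. -/
theorem ConnectedOn.exists_tripod {V : Type*} {G : SimpleGraph V} {S : Set V}
    (hS : ConnectedOn G S) (t : Fin 3 → V) (ht : ∀ i, t i ∈ S) :
    ∃ m, ∃ p : ∀ i, G.Walk m (t i), (∀ i, ∀ z ∈ (p i).support, z ∈ S) ∧
      ∀ i j, i ≠ j → ∀ z ∈ (p i).support, z ∈ (p j).support → z = m := by
  classical
  obtain ⟨P', hP'⟩ := hS.exists_walk (ht 0) (ht 1)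
  obtain ⟨Q, hQ⟩ := hS.exists_walk (ht 2) (ht 0)
  set P := P'.bypass with hPdef
  have hP : ∀ z ∈ P.support, z ∈ S := fun z hz => hP' z (P'.support_bypass_subset_support hz)
  have hpath : P.IsPath := P'.bypass_isPath
  obtain ⟨m, hm, r, hr, hrP⟩ := Q.exists_first_mem {z | z ∈ P.support} P.start_mem_support
  replace hm : m ∈ P.support := hm
  have htake : ∀ z, z ∈ (P.takeUntil m hm).support → z ∈ P.support :=
    fun z hz => P.support_takeUntil_subset_support hm hz
  have hdrop : ∀ z, z ∈ (P.dropUntil m hm).support → z ∈ P.support :=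
    fun z hz => P.support_dropUntil_subset_support hm hz
  have hmeet : ∀ z, z ∈ (P.takeUntil m hm).support → z ∈ (P.dropUntil m hm).support → z = m := by
    intro z hz hz'
    rw [← P.take_spec hm, Walk.isPath_def, Walk.support_append, List.nodup_append] at hpath
    rw [Walk.mem_support_iff] at hz'
    rcases hz' with rfl | hz'
    · rfl
    · exact absurd rfl (hpath.2.2 z hz z hz')
  refine ⟨m, fun | 0 => (P.takeUntil m hm).reverse | 1 => P.dropUntil m hm | 2 => r.reverse, ?_, ?_⟩
  · intro i
    fin_cases i
    · intro z hz
      exact hP z (htake z (by simpa using hz))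
    · intro z hz
      exact hP z (hdrop z (by simpa using hz))
    · intro z hz
      exact hQ z (hr (by simpa using hz))
  · have h01 : ∀ z, z ∈ (P.takeUntil m hm).reverse.support → z ∈ (P.dropUntil m hm).support → z = m :=
      fun z h1 h2 => hmeet z (by simpa using h1) h2
    have h02 : ∀ z, z ∈ (P.takeUntil m hm).reverse.support → z ∈ r.reverse.support → z = m :=
      fun z h1 h2 => hrP z (by simpa using h2) (htake z (by simpa using h1))
    have h12 : ∀ z, z ∈ (P.dropUntil m hm).support → z ∈ r.reverse.support → z = m :=
      fun z h1 h2 => hrP z (by simpa using h2) (hdrop z h1)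
    intro i j hij z hi hj
    fin_cases i <;> fin_cases j
    exacts [absurd rfl hij, h01 z hi hj, h02 z hi hj, h01 z hj hi, absurd rfl hij, h12 z hi hj,
      h02 z hj hi, h12 z hj hi, absurd rfl hij]

theorem HasK33Minor.containsSubdivision {V : Type*} {G : SimpleGraph V} (hG : HasK33Minor G) :
    ContainsSubdivision (completeBipartiteGraph (Fin 3) (Fin 3)) G := by
  classical
  obtain ⟨S, hc, hd, hadj⟩ := hG
  choose α hα β hβ hαβ using hadj
  let t : Fin 3 ⊕ Fin 3 → Fin 3 → V := Sum.elim (fun i j => α i j) (fun j i => β i j)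
  have htS : ∀ k i, t k i ∈ S k := by
    rintro (k | k) i
    exacts [hα k i, hβ i k]
  choose m p hpS hpm using fun k => (hc k).exists_tripod (t k) (htS k)
  let idx : Fin 3 ⊕ Fin 3 → Fin 3 := Sum.elim id id
  have hmS : ∀ k, m k ∈ S k := fun k => hpS k 0 _ (p k 0).start_mem_support
  have hS : ∀ k l z, z ∈ S k → z ∈ S l → k = l := fun k l z hk hl => by
    by_contra hkl
    exact Set.disjoint_left.1 (hd hkl) hk hl
  have hP : ∀ a b, (completeBipartiteGraph (Fin 3) (Fin 3)).Adj a b →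
      ∃ P : G.Walk (m a) (m b), P.IsPath ∧ ∀ z ∈ P.support,
        z ∈ (p a (idx b)).support ∨ z ∈ (p b (idx a)).support := by
    have hadj : ∀ a b, (completeBipartiteGraph (Fin 3) (Fin 3)).Adj a b →
        G.Adj (t a (idx b)) (t b (idx a)) := by
      rintro (a | a) (b | b) h
      · simp at h
      · exact hαβ a b
      · exact (hαβ b a).symm
      · simp at h
    intro a b hab
    refine ⟨((p a (idx b)).append (.cons (hadj a b hab) (p b (idx a)).reverse)).bypass,
      Walk.bypass_isPath _, fun z hz => ?_⟩
    have := Walk.support_bypass_subset_support _ hz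
    rw [Walk.mem_support_append_iff, Walk.support_cons, List.mem_cons, Walk.support_reverse,
      List.mem_reverse] at this
    rcases this with h | rfl | h
    exacts [.inl h, .inl (Walk.end_mem_support _), .inr h]
  choose P hpath hsupp using hP
  have hside : ∀ a b c, (completeBipartiteGraph (Fin 3) (Fin 3)).Adj a b →
      (completeBipartiteGraph (Fin 3) (Fin 3)).Adj a c → b ≠ c → idx b ≠ idx c := by
    rintro (a | a) (b | b) (c | c) hab hac hbc h <;> simp at hab hac <;>
      exact hbc (congrArg _ h)
  have hmeet : ∀ a b c d z, (completeBipartiteGraph (Fin 3) (Fin 3)).Adj a b →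
      (completeBipartiteGraph (Fin 3) (Fin 3)).Adj c d → s(a, b) ≠ s(c, d) →
      z ∈ (p a (idx b)).support → z ∈ (p c (idx d)).support → a = c ∧ z = m a := by
    intro a b c d z hab hcd hne h1 h2
    obtain rfl := hS a c z (hpS _ _ z h1) (hpS _ _ z h2)
    have hbd : b ≠ d := by rintro rfl; exact hne rfl
    exact ⟨rfl, hpm a _ _ (hside a b d hab hcd hbd) z h1 h2⟩
  refine ⟨⟨m, fun k l hkl => hS k l (m k) (hmS k) (hkl ▸ hmS l)⟩, fun a b h => P a b h,
    fun a b h => hpath a b h, ?_, ?_⟩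
  · intro a b h w hw
    rcases hsupp a b h _ hw with h1 | h1
    · exact .inl (hS _ _ _ (hmS w) (hpS _ _ _ h1))
    · exact .inr (hS _ _ _ (hmS w) (hpS _ _ _ h1))
  · intro a b c d hab hcd hne z hz1 hz2
    have hne' : s(a, b) ≠ s(d, c) := by rwa [Sym2.eq_swap (a := d)]
    have hne'' : s(b, a) ≠ s(c, d) := by rwa [Sym2.eq_swap (a := b)]
    have hne''' : s(b, a) ≠ s(d, c) := by rwa [Sym2.eq_swap (a := b), Sym2.eq_swap (a := d)]
    change (z = m a ∨ z = m b) ∧ (z = m c ∨ z = m d)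
    rcases hsupp a b hab z hz1 with h1 | h1 <;> rcases hsupp c d hcd z hz2 with h2 | h2
    · obtain ⟨rfl, h⟩ := hmeet a b c d z hab hcd hne h1 h2
      exact ⟨.inl h, .inl h⟩
    · obtain ⟨rfl, h⟩ := hmeet a b d c z hab hcd.symm hne' h1 h2
      exact ⟨.inl h, .inr h⟩
    · obtain ⟨rfl, h⟩ := hmeet b a c d z hab.symm hcd hne'' h1 h2
      exact ⟨.inr h, .inl h⟩
    · obtain ⟨rfl, h⟩ := hmeet b a d c z hab.symm hcd.symm hne''' h1 h2
      exact ⟨.inr h, .inr h⟩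

theorem HasInducedP5.containsInduced {V : Type*} {G : SimpleGraph V} (hG : HasInducedP5 G) :
    ContainsInduced (pathGraph 5) G := by
  obtain ⟨a, b, c, d, e, ab, bc, cd, de, ac, ad, ae, bd, be, ce⟩ := hG
  let f : Fin 5 → V := ![a, b, c, d, e]
  have hf : ∀ i j, G.Adj (f i) (f j) ↔ (pathGraph 5).Adj i j := by
    intro i j
    rw [pathGraph_adj]
    fin_cases i <;> fin_cases j <;> simp [f, ab, bc, cd, de, ac, ad, ae, bd, be, ce, G.adj_comm b a,
      G.adj_comm c b, G.adj_comm d c, G.adj_comm e d, G.adj_comm c a, G.adj_comm d a,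
      G.adj_comm e a, G.adj_comm d b, G.adj_comm e b, G.adj_comm e c]
  have hinj : Function.Injective f := by
    intro i j hij
    have h : ∀ k, (pathGraph 5).Adj i k ↔ (pathGraph 5).Adj j k := fun k => by
      rw [← hf, ← hf, hij]
    revert h
    simp only [pathGraph_adj]
    clear hij
    revert i j
    decide
  refine ⟨Set.range f, ⟨⟨Equiv.ofInjective f hinj, ?_⟩⟩⟩
  intro i j
  simpa using hf i j

theorem ThreeConnected.noTwoCut {V : Type*} [Fintype V] {G : SimpleGraph V}
    (hG : ThreeConnected G) : NoTwoCut G := by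
  intro s t C hne hs ht hcl v
  by_contra! hv
  have hconn := hG.2 {s, t} (by simpa using Set.ncard_insert_le s {t})
  obtain ⟨c, hc⟩ := hne
  have hcs : c ∈ ({s, t} : Set V)ᶜ := by
    rintro (rfl | rfl)
    exacts [hs hc, ht hc]
  have hvs : v ∈ ({s, t} : Set V)ᶜ := by
    rintro (rfl | rfl)
    exacts [hv.2.1 rfl, hv.2.2 rfl]
  obtain ⟨p⟩ := hconn.preconnected ⟨c, hcs⟩ ⟨v, hvs⟩
  have : ∀ u w : ↥({s, t} : Set V)ᶜ, (G.induce ({s, t} : Set V)ᶜ).Walk u w → (u : V) ∈ C → (w : V) ∈ C := by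
    intro u w q
    induction q with
    | nil => exact id
    | @cons u u' w h q ih =>
      intro hu
      refine ih ?_
      rcases hcl u hu u' h with h | h | h
      · exact h
      · exact absurd (.inl h) u'.2
      · exact absurd (.inr h) u'.2
  exact hv.1 (this _ _ p hc)

theorem NoTwoCut.exists_adj_ne {V : Type*} [Fintype V] {G : SimpleGraph V} (hG : NoTwoCut G)
    (hV : 4 ≤ Fintype.card V) {x y z : V} (hxy : y ≠ x) (hxz : z ≠ x) :
    ∃ u, G.Adj x u ∧ u ≠ y ∧ u ≠ z := by
  classical
  by_contra! hno
  have h := hG y z {x} ⟨x, rfl⟩ hxy hxz (by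
    rintro a rfl b hab
    have := hno b hab
    tauto)
  have : Fintype.card V ≤ ({x, y, z} : Finset V).card :=
    Finset.card_le_card fun v _ => by simpa using h v
  have := Finset.card_le_three (a := x) (b := y) (c := z)
  omega

/-- The `i`-th decimal digit of `m`. -/
def digit (m i : ℕ) : ℕ := Nat.mod (Nat.div m (Nat.pow 10 i)) 10

/-- Adjacency of `i` and `j` in the graph with code `r`, whose binary digit in position `16 * i + j`
tells whether `i` and `j` are adjacent. All operations are evaluated natively by the kernel. -/
def adjBit (r i j : ℕ) : Bool :=
  Nat.beq (Nat.land (Nat.shiftRight r (Nat.add (Nat.mul 16 i) j)) 1) 1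

/-- The code of the graph with the single edge `ij`. -/
def edgeCode (i j : ℕ) : ℕ :=
  Nat.lor (Nat.pow 2 (Nat.add (Nat.mul 16 i) j)) (Nat.pow 2 (Nat.add (Nat.mul 16 j) i))

/-- Each entry of the list is adjacent to a later entry, except for the last one. -/
def linked (r : ℕ) : List ℕ → Bool
  | [] => false
  | [_] => true
  | a :: b :: l => (b :: l).any (adjBit r a) && linked r (b :: l)

/-- Some vertex of `s` is adjacent to some vertex of `t`. -/
def touching (r : ℕ) (s t : List ℕ) : Bool := s.any fun a => t.any (adjBit r a)

/-- The entries of the list are pairwise different. -/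
def distinct : List ℕ → Bool
  | [] => true
  | a :: l => !l.any (Nat.beq a) && distinct l

/-- The decimal digits of `p` are the vertices of an induced path. -/
def checkPath (n r p : ℕ) : Bool :=
  (fun a b c d e =>
    adjBit r a b && (adjBit r b c && (adjBit r c d && (adjBit r d e &&
    !(adjBit r a c || (adjBit r a d || (adjBit r a e || (adjBit r b d ||
      (adjBit r b e || (adjBit r c e || !(Nat.blt a n && (Nat.blt b n &&
        (Nat.blt c n && (Nat.blt d n && Nat.blt e n))))))))))))))
  (digit p 0) (digit p 1) (digit p 2) (digit p 3) (digit p 4)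

/-- The six lists in `P` are the branch sets of a `K₃,₃` minor. -/
def checkMinor (n r : ℕ) (P : List (List ℕ)) : Bool :=
  ((List.range 3).all fun i => (List.range 3).all fun j =>
    touching r (P.getD i []) (P.getD (Nat.add 3 j) [])) &&
  P.all (linked r) && P.flatten.all (Nat.blt · n) && distinct P.flatten

/-- The decimal digits of `p` are an isomorphism from `h` to `r`. -/
def checkIso (n r h p : ℕ) : Bool :=
  ((List.range n).all fun i => (List.range n).all fun j =>
    cond (adjBit h i j) (adjBit r (digit p i) (digit p j))
      (!adjBit r (digit p i) (digit p j))) &&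
  ((List.range n).all fun i => Nat.blt (digit p i) n) &&
  (List.range n).all fun i => (List.range n).any fun j => Nat.beq (digit p j) i

/-- Hints for the splits of one vertex of a graph: induced paths, `K₃,₃` minors, and isomorphisms
to listed graphs. -/
structure VertexCert where
  paths : List ℕ
  minors : List (List (List ℕ))
  isos : List (ℕ × ℕ)

/-- The graph `r` on `n` vertices has one of the features listed in `c`. -/
def VertexCert.check (c : VertexCert) (n : ℕ) (L : List ℕ) (r : ℕ) : Bool :=
  c.paths.any (checkPath n r) || (c.minors.any (checkMinor n r) ||
    c.isos.any fun t => match L[t.1]? with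
      | none => false
      | some h => checkIso n r h t.2)

/-- `f` holds for the codes obtained from `R` by joining each entry of the list to `w` or to `n` or
to both, except when `w` or `n` has at most one neighbour apart from the other. The sets of these
neighbours are `A` and `B`. -/
def forallSplits (n w : ℕ) (f : ℕ → Bool) : List ℕ → ℕ → ℕ → ℕ → Bool
  | [], A, B, R =>
    Nat.ble A (Nat.pow 2 (Nat.log2 A)) || (Nat.ble B (Nat.pow 2 (Nat.log2 B)) || f R)
  | x :: l, A, B, R =>
    forallSplits n w f l (Nat.lor A (Nat.pow 2 x)) B (Nat.lor R (edgeCode x w)) &&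
    (forallSplits n w f l A (Nat.lor B (Nat.pow 2 x)) (Nat.lor R (edgeCode x n)) &&
    forallSplits n w f l (Nat.lor A (Nat.pow 2 x)) (Nat.lor B (Nat.pow 2 x))
      (Nat.lor R (Nat.lor (edgeCode x w) (edgeCode x n))))

/-- `R` is the code of the graph obtained from `h` by removing all edges at `w` and adding the edge
between `w` and the new vertex `n`. -/
def checkStart (n h w R : ℕ) : Bool :=
  (List.range (n + 1)).all fun i => (List.range (n + 1)).all fun j =>
    cond (Nat.beq i w || Nat.beq i n || Nat.beq j w || Nat.beq j n)
      (adjBit R i j == adjBit (edgeCode w n) i j) (adjBit R i j == adjBit h i j)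

/-- All splits of the vertex `w` of `h` are settled by `c`. -/
def checkVertex (n : ℕ) (L : List ℕ) (h w : ℕ) (c : VertexCert) : Bool :=
  match (List.range n).filter (adjBit h w) with
  | [] => false
  | x :: l => (fun R f => checkStart n h w R &&
      (forallSplits n w f l (Nat.pow 2 x) 0 (Nat.lor R (edgeCode x w)) &&
      forallSplits n w f l (Nat.pow 2 x) (Nat.pow 2 x)
        (Nat.lor R (Nat.lor (edgeCode x w) (edgeCode x n)))))
    (l.foldl (fun R y => Nat.xor R (edgeCode y w)) (Nat.xor (Nat.xor h (edgeCode x w))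
      (edgeCode w n)))
    (c.check (n + 1) L)

/-- All splits of the graphs in `D`, which have `n` vertices, are settled by the certificates. -/
def checkLevel (n : ℕ) (D : List (ℕ × List VertexCert)) (L : List ℕ) : Bool :=
  D.all fun t => (List.range n).all fun w => match t.2[w]? with
    | none => false
    | some c => checkVertex n L t.1 w c

/-- The graphs on four vertices, with certificates. -/
def levelFour : List (ℕ × List VertexCert) :=
  [(1970372082466830, [⟨[], [], [(0, 34120), (0, 24130), (1, 32041), (0, 14230), (1, 31042), (0,
   14320), (1, 43120), (1, 21043), (1, 42130), (2, 43210)]⟩, ⟨[], [], [(0, 32140), (0, 23140), (1,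
   32140), (0, 4231), (1, 31042), (0, 4321), (1, 43021), (1, 21043), (1, 42031), (2, 43210)]⟩,
   ⟨[], [], [(0, 32140), (0, 13240), (1, 32140), (0, 3241), (1, 32041), (0, 4321), (1, 43021), (1,
   21043), (1, 41032), (2, 43210)]⟩, ⟨[], [], [(0, 23140), (0, 13240), (1, 32140), (0, 3241), (1,
   32041), (0, 4231), (1, 42031), (1, 31042), (1, 41032), (2, 43210)]⟩])]

/-- The graphs on five vertices, with certificates. -/
def levelFive : List (ℕ × List VertexCert) :=
  [(276706509211806990364, [⟨[], [[[0], [1], [5], [2], [3], [4]]], [(0, 425310), (1, 345120), (2,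
   430521), (1, 245130), (2, 420531), (1, 421053), (2, 425031), (3, 403251), (3, 543210)]⟩, ⟨[],
   [[[0], [1], [5], [2], [3], [4]]], [(0, 423510), (1, 345021), (2, 431520), (1, 245031), (2,
   421530), (1, 420153), (2, 425130), (3, 413250), (3, 453210)]⟩, ⟨[], [[[0], [1], [4], [2], [3],
   [5]]], [(0, 432510), (1, 413520), (2, 421530), (1, 403521), (2, 420531), (1, 403251), (2,
   450231), (3, 421053), (3, 541032)]⟩, ⟨[], [[[0], [1], [4], [2], [3], [5]]], [(0, 423510), (1,
   412530), (2, 431520), (1, 402531), (2, 430521), (1, 402351), (2, 450321), (3, 431052), (3,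
   451032)]⟩, ⟨[], [[[0], [1], [5], [2], [3], [4]], [[0], [1], [4], [2], [3], [5]]], [(4, 324510),
   (1, 345021), (4, 234510), (1, 354120), (1, 245031), (1, 254130), (3, 453210), (1, 412530), (2,
   431520), (1, 413520), (2, 421530), (1, 402531), (2, 430521), (1, 403521), (2, 420531), (1,
   503421), (1, 502431), (2, 530421), (2, 520431), (3, 451032), (3, 541032)]⟩]),
   (276707635146073571356, [⟨[], [[[0], [1], [5], [2], [3], [4]]], [(2, 423150), (2, 324150), (5,
   432051), (2, 234150), (5, 423051), (2, 243150), (5, 425310), (5, 324051), (5, 325410)]⟩, ⟨[],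
   [[[0], [1], [5], [2], [3], [4]]], [(2, 423051), (2, 324051), (5, 432150), (2, 234051), (5,
   423150), (2, 243051), (5, 423510), (5, 324150), (5, 324510)]⟩, ⟨[], [[[0], [1], [5], [2], [3],
   [4]], [[0], [1], [2], [3], [4], [5]]], [(1, 340152), (2, 432051), (1, 430152), (2, 435120), (2,
   342051), (2, 345120), (5, 432510), (3, 314250), (5, 423150), (3, 413250), (5, 324150), (3,
   304251), (5, 423051), (3, 403251), (5, 324051), (3, 405321), (3, 305421), (5, 543021), (5,
   534021), (6, 534210), (6, 543210)]⟩, ⟨[], [[[0], [1], [5], [2], [3], [4]], [[0], [1], [3], [2],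
   [4], [5]]], [(1, 240153), (2, 423051), (1, 420153), (2, 425130), (2, 243051), (2, 245130), (5,
   423510), (3, 214350), (5, 432150), (3, 413250), (5, 324150), (3, 204351), (5, 432051), (3,
   403251), (5, 324051), (3, 405231), (3, 205431), (5, 542031), (5, 524031), (6, 435210), (6,
   543210)]⟩, ⟨[], [[[0], [1], [5], [2], [3], [4]], [[0], [1], [4], [2], [3], [5]]], [(1, 230154),
   (2, 324051), (1, 320154), (2, 325140), (2, 234051), (2, 235140), (5, 324510), (3, 214350), (5,
   432150), (3, 314250), (5, 423150), (3, 204351), (5, 432051), (3, 304251), (5, 423051), (3,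
   305241), (3, 205341), (5, 532041), (5, 523041), (6, 435210), (6, 534210)]⟩]),
   (276707635146073636894, [⟨[], [[[0], [3], [4], [1], [2], [5]], [[0], [2], [4], [1], [3], [5]],
   [[0], [2], [3], [1], [4], [5]], [[0], [1], [4], [2], [3], [5]], [[0], [1], [3], [2], [4], [5]],
   [[0], [1], [2], [3], [4], [5]]], []⟩, ⟨[], [[[0], [2], [5], [1], [3], [4]], [[0], [3], [5],
   [1], [2], [4]], [[0], [4], [5], [1], [2], [3]], [[0], [1], [4], [2], [3], [5]], [[0], [1], [3],
   [2], [4], [5]], [[0], [1], [2], [3], [4], [5]]], []⟩, ⟨[], [[[0], [1], [5], [2], [3], [4]],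
   [[0], [3], [5], [1], [2], [4]], [[0], [4], [5], [1], [2], [3]], [[0], [2], [4], [1], [3], [5]],
   [[0], [2], [3], [1], [4], [5]], [[0], [1], [2], [3], [4], [5]]], []⟩, ⟨[], [[[0], [1], [5],
   [2], [3], [4]], [[0], [2], [5], [1], [3], [4]], [[0], [4], [5], [1], [2], [3]], [[0], [3], [4],
   [1], [2], [5]], [[0], [2], [3], [1], [4], [5]], [[0], [1], [3], [2], [4], [5]]], []⟩, ⟨[],
   [[[0], [1], [5], [2], [3], [4]], [[0], [2], [5], [1], [3], [4]], [[0], [3], [5], [1], [2],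
   [4]], [[0], [3], [4], [1], [2], [5]], [[0], [2], [4], [1], [3], [5]], [[0], [1], [4], [2], [3],
   [5]]], []⟩])]

/-- The graphs on six vertices, with certificates. -/
def levelSix : List (ℕ × List VertexCert) :=
  [(37477346054510838780526648, [⟨[21460, 60321, 60412], [[[0], [2, 1], [6], [3], [4], [5]]], [(0,
   5043621), (0, 5643021)]⟩, ⟨[30461, 23046, 40326], [[[3, 0], [1], [6], [2], [4], [5]]], [(0,
   5142630), (0, 5642130)]⟩, ⟨[40362, 63041, 40326], [[[3, 0], [1], [5], [2], [4], [6]]], [(0,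
   5231640), (0, 5631240)]⟩, ⟨[41263, 63041, 60412], [[[0], [2, 1], [5], [3], [4], [6]]], [(0,
   5320641), (0, 5620341)]⟩, ⟨[32164, 23046, 60321], [[[0], [2, 1], [5], [3], [4], [6]]], [(0,
   5410632), (0, 5610432)]⟩, ⟨[63041, 23046, 40326, 41235, 50321, 60321, 60412], [[[0], [2, 1],
   [6], [3], [4], [5]], [[0], [2, 1], [5], [3], [4], [6]], [[3, 0], [1], [6], [2], [4], [5]], [[3,
   0], [1], [5], [2], [4], [6]]], [(1, 4651032), (1, 3652041), (0, 6543021), (1, 2563140), (0,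
   5642130), (1, 1564230), (0, 5631240), (1, 564321), (0, 5620341), (1, 654321), (0, 6520341), (0,
   5610432), (0, 6510432)]⟩]), (35059697332844125314416682, [⟨[24360, 60342], [[[0], [4], [6], [2,
   1], [3], [5]]], [(1, 5346210), (2, 5304621), (3, 5340162), (3, 3564120)]⟩, ⟨[35261, 61253],
   [[[3, 0], [2], [4], [1], [5], [6]]], [(1, 4523610), (2, 4215630), (3, 4251063), (3, 2465031)]⟩,
   ⟨[30126, 62430, 3462], [[[1, 0], [4], [5], [2], [3], [6]]], [(2, 4215630), (2, 4615230)]⟩,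
   ⟨[21036, 12563, 12536], [[[1, 0], [4], [5], [2], [3], [6]]], [(2, 5304621), (2, 5604321)]⟩,
   ⟨[3642, 3462, 21036, 30126], [[[1, 0], [5], [6], [2], [3], [4]], [[1, 0], [4], [5], [2], [3],
   [6]]], [(4, 5364201), (1, 6523410), (5, 6534210), (6, 4531620), (6, 6531420), (2, 4215630), (2,
   6215430)]⟩, ⟨[12563, 12653, 21036, 30126], [[[1, 0], [4], [6], [2], [3], [5]], [[1, 0], [4],
   [5], [2], [3], [6]]], [(1, 6345210), (4, 4265310), (5, 6534210), (2, 5304621), (2, 6304521),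
   (6, 5420631), (6, 6420531)]⟩]), (37477530526736710608945202, [⟨[60132], [[[0], [2], [6], [3,
   1], [4], [5]]], [(2, 5341260), (7, 5431062), (2, 5341206), (7, 5164320), (8, 5430126), (8,
   5436120)]⟩, ⟨[61042], [[[0], [3, 2], [5], [1], [4], [6]]], [(2, 5430261), (7, 5431062), (2,
   5430216), (7, 5604321), (8, 5341026), (8, 5346021)]⟩, ⟨[1326, 10426, 10462], [[[1, 0], [2],
   [6], [3], [4], [5]]], [(9, 4352610), (9, 4356210)]⟩, ⟨[1362, 10426, 61042, 31042], [[[1, 0],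
   [2], [6], [3], [4], [5]], [[1, 0], [2], [3], [4], [5], [6]]], [(0, 5243610), (9, 4352610), (6,
   5134206), (10, 5341260), (6, 5164203), (10, 5641230), (11, 5623410), (11, 5326410)]⟩, ⟨[10462,
   1326, 60132, 40132], [[[1, 0], [2], [6], [3], [4], [5]], [[1, 0], [2], [4], [3], [5], [6]]],
   [(0, 5243610), (9, 4352610), (6, 5043216), (10, 5430261), (6, 5063214), (10, 5630241), (11,
   5624301), (11, 5426301)]⟩, ⟨[1326, 10426, 61042, 50132, 60132], [[[0], [2], [6], [3, 1], [4],
   [5]], [[4, 0], [3], [6], [1], [2], [5]], [[0], [3, 2], [5], [1], [4], [6]]], [(12, 4362510),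
   (2, 4635201), (2, 3645210), (9, 4356210), (5, 2456310), (3, 1653420), (2, 6341250), (8,
   6435120), (11, 5623410), (3, 654321), (2, 6430251), (8, 6345021), (11, 5624301), (2, 5430261),
   (3, 564321), (8, 5346021), (11, 6524301), (7, 5431062), (7, 6431052)]⟩]),
   (35059697333407079563264044, [⟨[14560, 60541], [[[0], [4], [6], [2, 1], [3], [5]]], [(0,
   5423160), (8, 5304261), (8, 5204361), (8, 5264301)]⟩, ⟨[5461, 61450], [[[2, 0], [3], [4], [1],
   [5], [6]]], [(0, 4523061), (8, 4315260), (8, 4215360), (8, 4265310)]⟩, ⟨[], [[[2, 0], [1], [5],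
   [3], [4], [6]], [[0], [2, 1], [4], [3], [5], [6]]], [(4, 3546102), (6, 5342601), (6, 4352610),
   (10, 5423610), (1, 3540162), (0, 5436120), (0, 4532061), (3, 3451260), (5, 4356120), (11,
   5641320), (8, 4215360), (3, 3540261), (8, 5204361), (5, 5346021), (11, 4650321), (5, 5342061),
   (3, 3540621), (8, 5604321), (11, 4520631), (11, 2543106), (11, 6543102)]⟩, ⟨[], [[[2, 0], [4],
   [6], [1], [3], [5]], [[2, 0], [3], [4], [1], [5], [6]]], [(4, 2546103), (6, 5243601), (6,
   4253610), (10, 5432610), (1, 2540163), (0, 5426130), (0, 4523061), (3, 2451360), (5, 4256130),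
   (11, 5461320), (8, 4315260), (3, 2540361), (8, 5304261), (5, 5246031), (11, 4560321), (5,
   5243061), (3, 2540631), (8, 5604231), (11, 4530621), (11, 3542106), (11, 6542103)]⟩, ⟨[14650],
   [[[2, 0], [3], [4], [1], [5], [6]], [[2, 0], [3], [6], [1], [4], [5]]], [(6, 5243601), (10,
   5432610), (6, 5342601), (10, 5423610), (3, 2451360), (3, 3651240), (11, 5461320), (8, 4315260),
   (3, 3451260), (3, 2651340), (11, 5641320), (8, 6315240), (8, 4215360), (8, 6215340)]⟩,
   ⟨[14650], [[[0], [4], [6], [2, 1], [3], [5]], [[0], [4], [5], [2, 1], [3], [6]]], [(6,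
   4253610), (10, 5432610), (6, 4352610), (10, 5423610), (3, 2540361), (3, 3640251), (11,
   4560321), (8, 5304261), (3, 3540261), (3, 2640351), (11, 4650321), (8, 6304251), (8, 5204361),
   (8, 6204351)]⟩]), (8462683657398369930969144, [⟨[60321, 60412, 21460], [[[0], [2, 1], [6], [3],
   [4], [5]]], [(12, 4306521), (12, 4360521)]⟩, ⟨[61230, 30561, 30516], [[[3, 0], [1], [6], [2],
   [4], [5]]], [(12, 5216430), (12, 5261430)]⟩, ⟨[62140, 40562, 40526], [[[4, 0], [2], [6], [1],
   [3], [5]]], [(12, 5216430), (12, 5612430)]⟩, ⟨[63051, 51463, 51436], [[[0], [4, 1], [2], [3],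
   [5], [6]]], [(12, 4306521), (12, 4603521)]⟩, ⟨[64052, 52364, 52346], [[[0], [1], [3, 2], [4],
   [5], [6]]], [(12, 4306521), (12, 6304521)]⟩, ⟨[34165, 43265, 34156, 43256], [[[0], [1], [3, 2],
   [4], [5], [6]]], [(12, 5216430)]⟩]), (37477567419943391641993272, [⟨[60321], [[[0], [2, 1],
   [6], [3], [4], [5]]], [(9, 4532160), (13, 5432061), (9, 5432160), (13, 5346210), (13, 4532061),
   (13, 4356210)]⟩, ⟨[61230], [[[3, 0], [1], [6], [2], [4], [5]]], [(9, 4523061), (13, 5423160),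
   (9, 5423061), (13, 5423610), (13, 4523160), (13, 4523610)]⟩, ⟨[12630], [[[3, 0], [1], [6], [2],
   [4], [5]], [[3, 0], [1], [2], [4], [5], [6]]], [(10, 4352061), (14, 5432610), (10, 5342061),
   (14, 4532610), (8, 4531206), (13, 5423160), (8, 5431206), (13, 4523160), (8, 5431602), (8,
   4531602), (13, 5463120), (13, 4563120), (15, 4536210), (15, 5436210)]⟩, ⟨[12630], [[[0], [2,
   1], [6], [3], [4], [5]], [[0], [2, 1], [3], [4], [5], [6]]], [(10, 4253160), (14, 5432610),
   (10, 5243160), (14, 4532610), (8, 4520316), (13, 5432061), (8, 5420316), (13, 4532061), (8,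
   5420613), (8, 4520613), (13, 5462031), (13, 4562031), (15, 4526301), (15, 5426301)]⟩, ⟨[61230,
   40321, 60321], [[[0], [2, 1], [6], [3], [4], [5]], [[0], [2, 1], [4], [3], [5], [6]], [[3, 0],
   [1], [6], [2], [4], [5]], [[3, 0], [1], [4], [2], [5], [6]]], [(6, 5324106), (10, 5342061),
   (10, 5243160), (14, 4532610), (2, 5342016), (2, 5263104), (7, 5346210), (8, 3542601), (9,
   5632140), (13, 5364210), (9, 5423061), (8, 2563410), (13, 5423610), (8, 5431206), (11,
   5216430), (15, 5436210), (13, 4523160), (8, 5420316), (13, 4532061), (11, 5306421), (15,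
   5426301), (11, 5304621), (8, 5620314), (13, 6532041), (15, 5624301), (16, 5463210), (16,
   6543210)]⟩, ⟨[61230, 50321, 60321], [[[0], [2, 1], [6], [3], [4], [5]], [[0], [2, 1], [5], [3],
   [4], [6]], [[3, 0], [1], [6], [2], [4], [5]], [[3, 0], [1], [5], [2], [4], [6]]], [(6,
   4325106), (10, 4352061), (10, 4253160), (14, 5432610), (2, 4352016), (2, 4263105), (7,
   4356210), (8, 3452601), (9, 4632150), (13, 4365210), (9, 4523061), (8, 2463510), (13, 4523610),
   (8, 4531206), (11, 4216530), (15, 4536210), (13, 5423160), (8, 4520316), (13, 5432061), (11,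
   4306521), (15, 4526301), (11, 4305621), (8, 4620315), (13, 6432051), (15, 4625301), (16,
   5463210), (16, 6453210)]⟩]), (18134164009735986123374652, [⟨[], [[[2, 0], [4], [5], [1], [3],
   [6]], [[0], [2, 1], [3], [4], [5], [6]]], [(5, 1425360), (11, 5214306), (5, 1524360), (11,
   5134620), (11, 4215306), (11, 4135620), (16, 5426310), (11, 3412506), (15, 5304216), (11,
   3512406), (15, 4305216), (11, 2413506), (15, 5204316), (11, 2513406), (15, 4205316), (11,
   2153640), (11, 2143650), (15, 5264310), (15, 4265310), (16, 3246510), (16, 3256410)]⟩, ⟨[],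
   [[[2, 0], [3], [6], [1], [4], [5]], [[2, 0], [1], [3], [4], [5], [6]]], [(5, 425361), (11,
   5204316), (5, 524361), (11, 5034621), (11, 4205316), (11, 4035621), (16, 5423610), (11,
   3402516), (15, 5314206), (11, 3502416), (15, 4315206), (11, 2403516), (15, 5214306), (11,
   2503416), (15, 4215306), (11, 2053641), (11, 2043651), (15, 5264301), (15, 4265301), (16,
   3245610), (16, 3254610)]⟩, ⟨[], [[[2, 0], [4], [5], [1], [3], [6]], [[3, 0], [1], [2], [4],
   [5], [6]]], [(5, 3405162), (11, 5304216), (5, 3504162), (11, 5314602), (11, 4305216), (11,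
   4315602), (16, 5432610), (11, 1430526), (15, 5214306), (11, 1530426), (15, 4215306), (11,
   431526), (15, 5204316), (11, 531426), (15, 4205316), (11, 351642), (11, 341652), (15, 5604312),
   (15, 4605312), (16, 1046532), (16, 1056432)]⟩, ⟨[], [[[2, 0], [1], [6], [3], [4], [5]], [[2,
   0], [1], [3], [4], [5], [6]]], [(5, 2405163), (11, 5204316), (5, 2504163), (11, 5214603), (11,
   4205316), (11, 4215603), (16, 5423610), (11, 1420536), (15, 5314206), (11, 1520436), (15,
   4315206), (11, 421536), (15, 5304216), (11, 521436), (15, 4305216), (11, 251643), (11, 241653),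
   (15, 5604213), (15, 4605213), (16, 1045632), (16, 1054632)]⟩, ⟨[], [[[4, 0], [2], [3], [1],
   [5], [6]], [[0], [1], [4, 2], [3], [5], [6]]], [(5, 5203164), (11, 3502416), (5, 5302164), (11,
   3512604), (11, 2503416), (11, 2513604), (16, 3254610), (11, 1520436), (15, 4315206), (11,
   1530426), (15, 4215306), (11, 521436), (15, 4305216), (11, 531426), (15, 4205316), (11,
   531624), (11, 521634), (15, 6305214), (15, 6205314), (16, 1054632), (16, 1056432)]⟩, ⟨[], [[[4,
   0], [1], [6], [2], [3], [5]], [[4, 0], [1], [5], [2], [3], [6]]], [(5, 4203165), (11, 3402516),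
   (5, 4302165), (11, 3412605), (11, 2403516), (11, 2413605), (16, 3245610), (11, 1420536), (15,
   5314206), (11, 1430526), (15, 5214306), (11, 421536), (15, 5304216), (11, 431526), (15,
   5204316), (11, 431625), (11, 421635), (15, 6304215), (15, 6204315), (16, 1045632), (16,
   1046532)]⟩])]

/-- The graphs on seven vertices, with certificates. -/
def levelSeven : List (ℕ × List VertexCert) :=
  [(4674572811380150326035978190930, [⟨[1354, 23670, 13247, 71324, 70652], [[[0], [5], [7], [2, 3,
   1], [4], [6]]], []⟩, ⟨[71042, 71324, 45371, 70652, 10652], [[[2, 4, 0], [3], [6], [1], [5],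
   [7]]], []⟩, ⟨[31047, 40137, 72560, 40132, 6572], [[[3, 1, 0], [4], [5], [2], [6], [7]]], []⟩,
   ⟨[40137, 71042, 31042, 71045, 31045], [[[1, 0], [4, 2], [5], [3], [6], [7]]], []⟩, ⟨[31047,
   70132, 40132, 70135, 40135], [[[1, 0], [3, 2], [5], [4], [6], [7]]], []⟩, ⟨[10425, 10457,
   31045, 31047, 25761], [[[3, 1, 0], [4], [5], [2], [6], [7]], [[3, 1, 0], [4], [7], [2], [5],
   [6]]], []⟩, ⟨[1752, 10652, 10752, 24761, 23760, 71324, 25761, 60423, 13247, 73240, 60135,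
   24671], [[[0], [5, 3, 2], [7], [1], [4], [6]], [[0], [5, 3, 2], [6], [1], [4], [7]], [[1, 0],
   [5], [7], [3, 2], [4], [6]]], []⟩]), (4753797347135401156552489762858, [⟨[73641, 1265, 46370,
   71263, 21735], [[[0], [6], [7], [4, 2, 1], [3], [5]]], []⟩, ⟨[36271, 30124, 71056, 71263,
   70364], [[[5, 3, 0], [2], [4], [1], [6], [7]]], []⟩, ⟨[10567, 3672, 5472, 72450, 71056], [[[3,
   1, 0], [4], [6], [2], [5], [7]]], []⟩, ⟨[24573, 30146, 21037, 70542, 73641], [[[2, 1, 0], [5],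
   [6], [3], [4], [7]]], []⟩, ⟨[30147, 3674, 3647, 21753, 21453], [[[3, 1, 0], [4], [6], [2], [5],
   [7]], [[3, 1, 0], [6], [7], [2], [4], [5]]], []⟩, ⟨[21057, 12675, 12657, 30742, 30542], [[[2,
   1, 0], [5], [6], [3], [4], [7]], [[2, 1, 0], [6], [7], [3], [4], [5]]], []⟩, ⟨[1267, 30127,
   30126, 10567, 12635, 41037, 42630], [[[2, 1, 0], [3], [4], [5], [6], [7]]], []⟩]),
   (4912257298922942494632198078490, [⟨[70165, 70362, 25370], [[[0], [5], [7], [2, 6, 1], [3],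
   [4]]], [(0, 63514072), (0, 36157420)]⟩, ⟨[71042, 70352, 45371], [[[2, 4, 0], [3], [6], [1],
   [5], [7]]], [(0, 63514072), (0, 36750421)]⟩, ⟨[30427, 1672, 1657, 72530, 13542], [[[3, 1, 0],
   [2], [7], [4], [5], [6]]], []⟩, ⟨[73042, 10752, 10352], [[[2, 4, 0], [3], [6], [1], [5], [7]],
   [[2, 4, 0], [6], [7], [1], [3], [5]]], [(0, 63514072), (0, 67514032)]⟩, ⟨[13574, 13547, 10452,
   10752, 1657], [[[3, 1, 0], [2], [7], [4], [5], [6]], [[3, 1, 0], [2], [4], [5], [6], [7]]],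
   []⟩, ⟨[10425, 10457, 1675, 1657, 13742], [[[3, 1, 0], [2], [7], [4], [5], [6]], [[3, 1, 0],
   [2], [5], [4], [6], [7]]], []⟩, ⟨[1625, 1652, 3762, 1725, 1672, 1752, 10427, 13742, 31624,
   3672, 73042, 72530, 31742, 61352, 61042, 30427], [[[1, 0], [2], [7], [5, 3], [4], [6]], [[1,
   0], [2], [6], [5, 3], [4], [7]]], []⟩]), (4516114068499982421465984925780, [⟨[15470, 15670,
   70215, 70451, 70651], [[[0], [5], [7], [3, 2, 1], [4], [6]]], []⟩, ⟨[6371, 12065, 71246, 71360,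
   71540], [[[4, 2, 0], [3], [5], [1], [6], [7]]], []⟩, ⟨[72065, 72156, 20651, 71364, 40213],
   [[[1, 7, 0], [3], [4], [2], [5], [6]], [[1, 2, 0], [3], [4], [5], [6], [7]]], [(1, 26745130),
   (1, 76245130)]⟩, ⟨[31540, 73540, 13760, 12067, 71246, 31246], [[[4, 2, 0], [3], [5], [1], [6],
   [7]], [[4, 2, 0], [5], [7], [1], [3], [6]]], []⟩, ⟨[40631, 13647, 4751, 12067, 70215, 21564],
   [[[0], [5], [7], [3, 2, 1], [4], [6]], [[0], [4], [5], [3, 2, 1], [6], [7]]], []⟩, ⟨[2157,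
   2357, 2375, 20657, 20675], [[[4, 2, 0], [5], [7], [1], [3], [6]]], []⟩, ⟨[12067, 12467, 12476,
   70215, 21576], [[[0], [4], [5], [3, 2, 1], [6], [7]]], []⟩]), (4278429581086301699259485978638,
   [⟨[70154, 24371, 56270, 72653, 64370], [[[0], [6], [7], [1], [4, 2], [5, 3]]], []⟩, ⟨[2457,
   10346, 71643, 70245, 10245], [[[3, 2, 0], [5], [6], [1], [4], [7]]], []⟩, ⟨[10347, 72451,
   72653, 20154, 35672], [[[3, 1, 0], [4], [6], [2], [5], [7]]], []⟩, ⟨[16473, 30265, 1647, 70164,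
   70265], [[[2, 1, 0], [4], [5], [3], [6], [7]]], []⟩, ⟨[10247, 10347, 10374, 1647, 1674, 1547,
   24351], [[[2, 1, 0], [3], [6], [4], [5], [7]]], []⟩, ⟨[20157, 2457, 2475, 20357, 20375, 26173,
   35162], [[[2, 1, 0], [3], [6], [4], [5], [7]]], []⟩, ⟨[30167, 71034, 3476, 3567, 3576, 20357,
   30276], [[[2, 1, 0], [4], [5], [3], [6], [7]]], []⟩]), (4753792511487459834135254466610,
   [⟨[1264, 36570, 70126, 70462, 70523], [[[0], [6], [7], [3, 2, 1], [4], [5]]], []⟩, ⟨[71056,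
   54371, 71345, 71254, 45271], [[[5, 4, 0], [2], [3], [1], [6], [7]]], []⟩, ⟨[40127, 4672, 72640,
   72340, 4372], [[[1, 0], [4, 3], [6], [2], [5], [7]]], []⟩, ⟨[50137, 73250, 5273, 73650, 5673],
   [[[4, 1, 0], [2], [6], [3], [5], [7]]], []⟩, ⟨[21047, 40126, 70126, 12547, 12574], [[[3, 1, 0],
   [5], [6], [2], [4], [7]]], []⟩, ⟨[31057, 13675, 70136, 13457, 13475], [[[2, 1, 0], [4], [6],
   [3], [5], [7]]], []⟩, ⟨[1267, 40127, 10476, 1367, 1376, 50137, 10576], [[[2, 1, 0], [3], [5],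
   [4], [6], [7]]], []⟩]), (4912246418590558081567200641080, [⟨[13247, 70461, 16470, 70562,
   26570], [[[0], [6], [7], [2, 3, 1], [4], [5]]], []⟩, ⟨[71324, 4671, 13245, 73245, 71640], [[[2,
   3, 0], [5], [6], [1], [4], [7]]], []⟩, ⟨[50327, 73154, 15472, 72650, 5672], [[[1, 3, 0], [4],
   [6], [2], [5], [7]]], []⟩, ⟨[54273, 73245, 32451, 73154, 4271], [[[5, 4, 0], [1], [2], [3],
   [6], [7]]], []⟩, ⟨[13047, 13247, 13274, 15072, 24051, 16270, 4261], [[[1, 3, 0], [2], [5], [4],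
   [6], [7]]], []⟩, ⟨[23057, 23157, 23175, 24071, 24051, 26170, 5162], [[[1, 3, 0], [4], [6], [2],
   [5], [7]]], []⟩, ⟨[4261, 5162, 5672, 4271, 13047, 23056, 63245, 5172, 73154, 23057, 73245,
   4761], [[[2, 3, 0], [5], [6], [1], [4], [7]], [[1, 3, 0], [4], [6], [2], [5], [7]], [[2, 3, 0],
   [5], [7], [1], [4], [6]]], []⟩]), (4991476999030252846915890446448, [⟨[70431, 70523, 12540],
   [[[0], [3, 2, 1], [7], [4], [5], [6]]], [(2, 65403271), (2, 65473201)]⟩, ⟨[71250, 71345,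
   54371], [[[2, 5, 0], [3], [6], [1], [4], [7]]], [(2, 63215470), (2, 63275410)]⟩, ⟨[4372, 72340,
   13750], [[[2, 5, 0], [3], [6], [1], [4], [7]], [[3, 4, 0], [6], [7], [1], [2], [5]]], [(2,
   63215470), (2, 63715420)]⟩, ⟨[5273, 73250, 12740], [[[2, 5, 0], [3], [6], [1], [4], [7]], [[2,
   5, 0], [6], [7], [1], [3], [4]]], [(2, 63215470), (2, 67215430)]⟩, ⟨[12574, 12547, 13750],
   [[[0], [3, 2, 1], [7], [4], [5], [6]], [[0], [3, 2, 1], [4], [5], [6], [7]]], [(2, 65403271),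
   (2, 65703241)]⟩, ⟨[50431, 13457, 12740], [[[0], [3, 2, 1], [7], [4], [5], [6]], [[0], [3, 2,
   1], [5], [4], [6], [7]]], [(2, 65403271), (2, 67403251)]⟩, ⟨[13750, 50631, 40612, 21740, 50613,
   40621, 31750, 50731, 12740, 50713, 40712, 40721, 73250, 72340, 12546, 60431, 13457, 70523],
   [[[0], [1], [7], [5, 2], [4, 3], [6]], [[0], [1], [6], [5, 2], [4, 3], [7]], [[4, 0], [2, 1],
   [7], [3], [5], [6]], [[2, 5, 0], [3], [7], [1], [4], [6]]], [(3, 54673210), (0, 57624310), (0,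
   47635210), (2, 75463201), (0, 63475210), (4, 67534210), (0, 62574310), (4, 67425310), (2,
   63275410), (5, 67105342), (5, 76105342)]⟩]), (4912256090015570186927904653356, [⟨[16370, 73241,
   70364], [[[0], [6], [7], [2, 4, 1], [3], [5]]], [(4, 63524071), (4, 36257410)]⟩, ⟨[23571, 2671,
   71423, 20517, 71620], [[[3, 2, 0], [1], [7], [4], [5], [6]]], []⟩, ⟨[72051, 72351, 15372],
   [[[0], [6, 4, 1], [3], [2], [5], [7]]], [(4, 63524071), (4, 63574021)]⟩, ⟨[14273, 73241, 3764,
   72051], [[[0], [6], [7], [2, 4, 1], [3], [5]], [[0], [3], [6], [2, 4, 1], [5], [7]]], [(4,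
   63524071), (4, 67524031)]⟩, ⟨[3674, 3647, 2741, 72051, 20517, 20514], [[[3, 2, 0], [1], [7],
   [4], [5], [6]], [[3, 2, 0], [1], [4], [5], [6], [7]]], []⟩, ⟨[20571, 23751, 23571, 71420, 3741,
   71620, 30741, 30541, 73241, 51423, 50241, 71423, 70241, 70261, 50261], [[[2, 0], [1], [7], [6,
   3], [4], [5]], [[2, 0], [1], [5], [6, 3], [4], [7]]], [(5, 56317240), (5, 76315240)]⟩, ⟨[41630,
   3741, 41730, 2761, 3761, 20517, 20516, 73241, 72051, 71423, 61423], [[[2, 0], [1], [7], [5, 3],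
   [4], [6]], [[1, 5, 0], [2], [6], [3], [4], [7]], [[3, 2, 0], [1], [6], [4], [5], [7]]], []⟩]),
   (4833031554371002635779503620178, [⟨[70153, 71432, 25470], [[[0], [3], [7], [2, 5, 1], [4],
   [6]]], [(2, 46531027), (2, 45637120)]⟩, ⟨[23471, 71062, 71462], [[[2, 6, 0], [4], [5], [1],
   [3], [7]]], [(2, 46531027), (2, 46537021)]⟩, ⟨[4572, 14672, 72341, 1537, 10627], [[[4, 1, 0],
   [2], [7], [3], [5], [6]]], []⟩, ⟨[1573, 1537, 10673, 10637, 23741], [[[4, 1, 0], [2], [7], [3],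
   [5], [6]], [[4, 1, 0], [2], [3], [5], [6], [7]]], []⟩, ⟨[10432, 1732, 10732, 4752, 14762,
   23741, 26471, 1537, 10637, 71062, 70153, 40152], [[[0], [5, 3, 2], [7], [1], [4], [6]], [[0],
   [5, 3, 2], [4], [1], [6], [7]], [[1, 0], [3, 2], [7], [4], [5], [6]]], [(2, 46531027), (2,
   76531024)]⟩, ⟨[1523, 1532, 4752, 1723, 1573, 1732, 10627, 4572, 72341, 71432, 51432, 10637,
   71062, 51062], [[[1, 0], [2], [7], [4, 3], [5], [6]], [[1, 0], [2], [5], [4, 3], [6], [7]]],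
   []⟩, ⟨[10623, 10632, 14762, 10723, 1527, 10732, 14672, 10672, 72341, 70432, 60432, 1537, 70153,
   60152], [[[1, 0], [2], [7], [4, 3], [5], [6]], [[1, 0], [2], [6], [4, 3], [5], [7]]], []⟩]),
   (4833031554297210874444421529688, [⟨[3142, 15670, 70352, 73142, 70651], [[[0], [5], [7], [2, 4,
   1], [3], [6]]], []⟩, ⟨[71362, 6571, 13042, 73042, 71560], [[[2, 4, 0], [3], [5], [1], [6],
   [7]]], []⟩, ⟨[3572, 13672, 30427, 72530, 72631], [[[1, 3, 0], [2], [7], [4], [5], [6]]], []⟩,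
   ⟨[73042, 73142, 24173, 25170, 3152, 26071, 13062], [[[1, 4, 0], [5], [6], [2], [3], [7]]], []⟩,
   ⟨[13042, 3172, 13072, 30472, 71362, 40352, 70352, 72530, 72631, 14062], [[[3, 0], [2], [7], [5,
   1], [4], [6]], [[0], [2, 7, 1], [5], [3], [4], [6]], [[0], [2, 4, 1], [5], [3], [6], [7]]],
   []⟩, ⟨[15260, 3152, 3572, 6271, 15760, 53042, 73042, 3172, 72631, 71362, 51362, 30427], [[[2,
   4, 0], [3], [5], [1], [6], [7]], [[1, 4, 0], [5], [6], [2], [3], [7]], [[2, 4, 0], [3], [7],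
   [1], [5], [6]]], []⟩, ⟨[15260, 13062, 13672, 15270, 15760, 63142, 73142, 13072, 72530, 70352,
   60352, 30427], [[[0], [5], [7], [2, 4, 1], [3], [6]], [[1, 4, 0], [5], [6], [2], [3], [7]],
   [[0], [5], [6], [2, 4, 1], [3], [7]]], []⟩]), (4357657743600567444262273744966, [⟨[70154,
   34670, 54270, 71542, 70643], [[[0], [5], [7], [3, 1], [4, 2], [6]]], []⟩, ⟨[71024, 71542,
   10245, 70643, 10643], [[[3, 2, 0], [5], [6], [1], [4], [7]], [[2, 0], [4, 3], [5], [1], [6],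
   [7]]], [(5, 65742130), (5, 65142730)]⟩, ⟨[51027, 70154, 20154, 70653, 20653], [[[3, 1, 0], [4],
   [6], [2], [5], [7]], [[1, 0], [5, 3], [4], [2], [6], [7]]], [(5, 64751230), (5, 64251730)]⟩,
   ⟨[6473, 73460, 6573, 73560, 10247], [[[2, 1, 0], [4], [5], [3], [6], [7]]], []⟩, ⟨[10247, 1547,
   1574, 1347, 1374], [[[3, 1, 0], [2], [5], [4], [6], [7]]], []⟩, ⟨[20157, 2457, 2475, 2357,
   2375], [[[1, 0], [3, 2], [4], [5], [6], [7]]], []⟩, ⟨[34760, 35760, 70134, 70235, 60235, 60134,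
   2357, 1347], [[[0], [4], [7], [5, 3, 1], [2], [6]], [[0], [5, 4], [6], [3, 1], [2], [7]], [[3,
   2, 0], [5], [7], [1], [4], [6]]], [(1, 21765430), (5, 75642130), (5, 64751230), (1, 21675430),
   (5, 65742130), (5, 74651230)]⟩]), (4516114068629112444697358696518, [⟨[70153, 21763, 34270],
   [[[0], [4], [7], [3, 5, 1], [2], [6]]], [(3, 65421073), (3, 21765430)]⟩, ⟨[72063, 20753,
   10243], [[[3, 6, 0], [2], [5], [1], [4], [7]]], [(3, 65421073), (3, 27065431)]⟩, ⟨[72063,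
   70153, 10243], [[[3, 6, 0], [1], [4], [2], [5], [7]]], [(3, 65421073), (3, 71065432)]⟩, ⟨[1573,
   20653, 12467, 1547, 10647], [[[2, 1, 0], [3], [7], [4], [5], [6]]], []⟩, ⟨[10674, 10647, 1574,
   1547, 2453, 2753], [[[2, 1, 0], [3], [7], [4], [5], [6]]], []⟩, ⟨[20675, 20657, 2475, 2457,
   21563, 21763], [[[2, 1, 0], [3], [7], [4], [5], [6]]], []⟩, ⟨[12476, 12467, 21576, 21567,
   10643, 10743], [[[2, 1, 0], [3], [7], [4], [5], [6]]], []⟩]), (4991486670529051084176567304296,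
   [⟨[12530, 70341, 70541], [[[0], [4, 2, 1], [7], [3], [5], [6]]], [(6, 65432071), (6,
   56347210)]⟩, ⟨[71250, 71430, 5471], [[[2, 5, 0], [4], [6], [1], [3], [7]]], [(6, 64523170), (6,
   64523710)]⟩, ⟨[21430, 72430, 12753], [[[2, 5, 0], [4], [6], [1], [3], [7]], [[4, 3, 0], [6],
   [7], [1], [2], [5]]], [(7, 46523710), (6, 64523170), (6, 64573120)]⟩, ⟨[12573, 12537, 3741],
   [[[0], [4, 2, 1], [7], [3], [5], [6]], [[0], [4, 2, 1], [3], [5], [6], [7]]], [(7, 56432701),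
   (6, 65432071), (6, 65472031)]⟩, ⟨[21430, 12730, 21730, 14750, 3741, 12537, 71250, 41250], [[[6,
   3, 0], [2], [4], [1], [5], [7]], [[1, 6, 0], [4], [5], [2], [3], [7]], [[2, 5, 0], [6], [7],
   [1], [3], [4]]], [(7, 56432701), (7, 46523710), (6, 64523170), (6, 67523140)]⟩, ⟨[30521, 12730,
   30721, 14750, 12753, 72430, 70341, 50342], [[[0], [4], [7], [6, 2, 1], [3], [5]], [[1, 6, 0],
   [4], [5], [2], [3], [7]], [[0], [4, 2, 1], [5], [3], [6], [7]]], [(7, 56432701), (7, 46523710),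
   (6, 65432071), (6, 67432051)]⟩, ⟨[12730, 30621, 21730, 30612, 30721, 30712, 72430, 60521,
   12537, 60541, 71450, 71430, 71250, 60341, 70541, 70341, 70521], [[[0], [1], [7], [5, 2], [4,
   3], [6]], [[3, 0], [1], [6], [5, 2], [4], [7]], [[5, 0], [4], [6], [2, 1], [3], [7]], [[0], [4,
   2, 1], [6], [3], [5], [7]]], [(0, 54326710), (2, 54726310), (2, 45637201), (6, 54673210), (4,
   34576210), (6, 57346210), (4, 52643710), (6, 64523710), (8, 56374210), (9, 67543210), (9,
   76543210)]⟩]), (4991484252658966518107724054640, [⟨[23570, 70431, 70532], [[[0], [2, 3, 1],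
   [7], [4], [5], [6]]], [(7, 65430217), (7, 65437210)]⟩, ⟨[24571, 71340, 71542], [[[2, 4, 0],
   [1], [7], [3], [5], [6]]], [(7, 65341207), (7, 65347201)]⟩, ⟨[15472, 72350, 72451], [[[1, 5,
   0], [2], [7], [3], [4], [6]]], [(7, 64352107), (7, 64357102)]⟩, ⟨[23150, 13240, 5372, 4271,
   13740, 5172, 72451, 71542, 31542], [[[2, 6, 0], [3], [5], [1], [4], [7]], [[1, 6, 0], [3], [4],
   [2], [5], [7]], [[2, 4, 0], [1], [3], [5], [6], [7]]], [(10, 65437210), (7, 64352107), (7,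
   65341207), (7, 65741203)]⟩, ⟨[24051, 13240, 15472, 13270, 13740, 15072, 72350, 70532, 40532],
   [[[0], [3], [7], [2, 6, 1], [4], [5]], [[1, 6, 0], [3], [4], [2], [5], [7]], [[0], [2, 3, 1],
   [4], [5], [6], [7]]], [(10, 65437210), (7, 64352107), (7, 65430217), (7, 65730214)]⟩, ⟨[24051,
   23150, 24571, 23170, 23750, 24071, 71340, 70431, 50431], [[[0], [3], [7], [2, 6, 1], [4], [5]],
   [[2, 6, 0], [3], [5], [1], [4], [7]], [[0], [2, 3, 1], [5], [4], [6], [7]]], [(10, 65437210),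
   (7, 65341207), (7, 65430217), (7, 67430215)]⟩, ⟨[24061, 15062, 4271, 13260, 23160, 5172, 13270,
   23170, 15072, 24071, 72350, 72451, 71340, 71542, 60431, 60532, 70431, 70532], [[[0], [3, 1],
   [7], [4, 2], [5], [6]], [[4, 0], [3, 1], [6], [2], [5], [7]], [[5, 0], [3, 2], [6], [1], [4],
   [7]], [[0], [1], [6], [4, 3, 2], [5], [7]]], [(7, 64357102), (7, 65347201), (7, 75436210)]⟩]),
   (4357658952544833802969453166704, [⟨[70421, 32670, 23570, 70532, 70613], [[[0], [3, 2, 1], [7],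
   [4], [5], [6]]], []⟩, ⟨[71240, 71340, 4371], [[[4, 0], [1], [7], [2], [3], [6, 5]]], [(8,
   65432170), (8, 46573210)]⟩, ⟨[72150, 72350, 5372], [[[6, 4, 0], [1], [3], [2], [5], [7]]], [(8,
   65432170), (8, 56473120)]⟩, ⟨[73160, 73260, 6273], [[[5, 4, 0], [1], [2], [3], [6], [7]]], [(8,
   65432170), (8, 65472130)]⟩, ⟨[13740, 12740, 70512, 70613, 40613, 40512, 73160, 72150], [[[0],
   [2, 1], [7], [5, 3], [4], [6]], [[0], [3, 2, 1], [4], [5], [6], [7]], [[1, 6, 0], [3], [7],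
   [2], [4], [5]]], [(5, 65104372), (9, 65437210), (5, 65107342), (9, 65734210), (9, 56427310),
   (9, 56724310)]⟩, ⟨[23750, 21750, 70421, 70623, 50623, 50421, 73260, 71240], [[[0], [2, 1], [7],
   [4, 3], [5], [6]], [[0], [3, 2, 1], [5], [4], [6], [7]], [[2, 6, 0], [3], [7], [1], [4], [5]]],
   [(5, 64205371), (9, 65437210), (5, 64207351), (9, 67435210), (9, 46517320), (9, 46715320)]⟩,
   ⟨[32760, 31760, 70431, 70532, 60532, 60431, 72350, 71340], [[[0], [3, 1], [7], [4, 2], [5],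
   [6]], [[0], [3, 2, 1], [6], [4], [5], [7]], [[2, 6, 0], [1], [4], [3], [5], [7]]], [(5,
   54306271), (9, 56427310), (5, 54307261), (9, 57426310), (9, 46517320), (9, 47516320)]⟩]),
   (2456110516468858611629445873784, [⟨[70321, 41237, 41230], [[[0], [3, 2, 1], [4], [5], [6],
   [7]], [[1, 4, 0], [2], [7], [3], [5], [6]]], [(9, 54367210), (9, 64357210)]⟩, ⟨[71230, 40327,
   30471], [[[2, 3, 0], [1], [4], [5], [6], [7]], [[1, 4, 0], [3], [7], [2], [5], [6]]], [(9,
   45623710), (9, 46523710)]⟩, ⟨[72140, 40327, 40372], [[[1, 4, 0], [2], [3], [5], [6], [7]], [[1,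
   4, 0], [3], [7], [2], [5], [6]]], [(9, 35614720), (9, 36514720)]⟩, ⟨[73041, 41237, 41273],
   [[[1, 4, 0], [2], [3], [5], [6], [7]], [[1, 4, 0], [2], [7], [3], [5], [6]]], [(9, 25604731),
   (9, 26504731)]⟩, ⟨[23047, 70321, 32174], [[[1, 7, 0], [5], [6], [2], [3], [4]], [[1, 4, 0],
   [5], [6], [2], [3], [7]]], [(9, 15603742), (9, 16503742)]⟩, ⟨[73041, 23047, 40327, 41235,
   50321, 70321, 41237], [[[5, 0], [3], [4], [2, 1], [6], [7]], [[0], [2, 1], [5, 3], [4], [6],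
   [7]], [[5, 3, 0], [2], [4], [1], [6], [7]], [[3, 0], [1], [5, 2], [4], [6], [7]]], [(5,
   64103752), (5, 63204751), (9, 64375210), (5, 62314570), (9, 46523710), (5, 61423570), (9,
   36514720), (5, 60432571), (9, 26504731), (5, 60432751), (9, 26704531), (9, 16503742), (9,
   16703542)]⟩, ⟨[73041, 23047, 40327, 60412, 60321, 70321, 41237], [[[5, 0], [2, 1], [7], [3],
   [4], [6]], [[5, 0], [2, 1], [6], [3], [4], [7]], [[5, 3, 0], [1], [7], [2], [4], [6]], [[5, 3,
   0], [1], [6], [2], [4], [7]]], [(5, 54103762), (5, 53204761), (9, 54376210), (5, 52314670), (9,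
   45623710), (5, 51423670), (9, 35614720), (5, 50432671), (9, 25604731), (5, 50432761), (9,
   25704631), (9, 15603742), (9, 15703642)]⟩])]

/-- The graphs on eight vertices, with certificates. -/
def levelEight : List (ℕ × List VertexCert) :=
  [(628282339651289481405942897151574184, [⟨[12358, 26780, 24758, 80564, 3561], [[[0], [6], [8],
   [4, 3, 2, 1], [5], [7]]], []⟩, ⟨[12470, 7681, 3248, 82470, 81653], [[[5, 2, 3, 0], [4], [6],
   [1], [7], [8]]], []⟩, ⟨[5682, 82650, 21475, 82470, 3861], [[[5, 2, 3, 0], [4], [6], [1], [7],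
   [8]], [[7, 5, 3, 0], [1], [2], [4], [6], [8]]], []⟩, ⟨[30561, 83564, 30761, 83761, 42850],
   [[[0], [6], [8], [4, 3, 2, 1], [5], [7]], [[0], [6, 4, 2, 1], [3], [5], [7], [8]]], []⟩,
   ⟨[41653, 84650, 41235, 3248, 12870], [[[5, 2, 3, 0], [4], [6], [1], [7], [8]], [[5, 2, 3, 0],
   [6], [8], [1], [4], [7]]], []⟩, ⟨[50742, 24758, 50321, 12358, 3861], [[[0], [6], [8], [4, 3, 2,
   1], [5], [7]], [[0], [5], [6], [4, 3, 2, 1], [7], [8]]], []⟩, ⟨[3286, 3268, 12870, 42850,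
   41653, 14850, 82470, 61473], [[[2, 3, 0], [4], [6], [1], [7, 5], [8]], [[5, 2, 3, 0], [4], [8],
   [1], [6], [7]]], []⟩, ⟨[70321, 12378, 3861, 50742, 53841, 14850, 80564, 70561], [[[0], [6, 4],
   [8], [3, 2, 1], [5], [7]], [[0], [6], [7], [4, 3, 2, 1], [5], [8]]], []⟩]),
   (202501716823378046704719447215309040, [⟨[80432, 80612, 21640, 80723, 31780, 36875, 52360],
   [[[1, 6, 0], [3, 2], [8], [4], [5], [7]]], []⟩, ⟨[81250, 60528, 12546, 81340, 4381, 70438,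
   75461], [[[1, 6, 0], [4, 3], [7], [2], [5], [8]]], []⟩, ⟨[82164, 82360, 4382, 70438, 40782,
   63875, 64582], [[[1, 6, 0], [3, 2], [5], [4], [7], [8]]], []⟩, ⟨[83175, 40718, 31754, 83250,
   31250, 60528, 50683], [[[1, 7, 0], [3, 2], [4], [5], [6], [8]]], []⟩, ⟨[84072, 80723, 40723,
   83175, 43175, 80612, 63457], [[[2, 1, 7, 0], [4], [8], [3], [5], [6]]], []⟩, ⟨[85063, 61258,
   61285, 31758, 50713, 43178, 13485], [[[3, 1, 6, 0], [5], [8], [2], [4], [7]]], []⟩, ⟨[25068,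
   80723, 52386, 83175, 50631, 40812, 75486], [[[1, 7, 0], [3, 2], [4], [5], [6], [8]]], []⟩,
   ⟨[34078, 80432, 63287, 34578, 72546, 43178, 75461], [[[1, 6, 0], [3, 2], [5], [4], [7], [8]]],
   []⟩]), (649051527105981047362348119049109644, [⟨[65380, 2741, 80261, 80351, 83741], [[[0], [5],
   [8], [2, 6, 4, 1], [3], [7]]], []⟩, ⟨[3541, 7681, 81473, 81570, 81623], [[[5, 3, 2, 0], [4],
   [6], [1], [7], [8]]], []⟩, ⟨[14782, 82751, 45382, 82351, 3861], [[[0], [5], [8], [2, 6, 4, 1],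
   [3], [7]], [[0], [2], [6], [3, 5, 4, 1], [7], [8]]], []⟩, ⟨[14783, 83741, 16283, 83261, 2851],
   [[[0], [5], [8], [2, 6, 4, 1], [3], [7]], [[0], [3], [5], [2, 6, 4, 1], [7], [8]]], []⟩,
   ⟨[41623, 2648, 23584, 3548, 14870], [[[5, 3, 2, 0], [4], [6], [1], [7], [8]], [[5, 3, 2, 0],
   [6], [8], [1], [4], [7]]], []⟩, ⟨[2685, 2658, 3861, 41530, 41832, 15870, 81473, 51472], [[[7,
   3, 2, 0], [1], [8], [4], [5], [6]], [[1, 6, 2, 0], [5], [7], [3], [4], [8]], [[6, 3, 2, 0],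
   [4], [8], [1], [5], [7]]], []⟩, ⟨[3586, 3568, 2851, 41623, 41823, 16870, 81473, 61473], [[[7,
   3, 2, 0], [1], [8], [4], [5], [6]], [[1, 6, 2, 0], [5], [7], [3], [4], [8]], [[5, 3, 2, 0],
   [4], [8], [1], [6], [7]]], []⟩, ⟨[3861, 20751, 30761, 32841, 20851, 15870, 16873, 23841, 20745,
   80351, 30741, 14870, 2851, 3568, 2658, 30864, 3841, 80261, 73261, 72354], [[[0], [6, 5, 4, 1],
   [8], [2], [3], [7]], [[0], [4], [8], [2, 6, 1], [5, 3], [7]], [[0], [5], [7], [2, 6, 4, 1],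
   [3], [8]]], []⟩]), (524435372524148846028525835755716832, [⟨[34578, 32750, 80723, 13658,
   23650], [[[0], [4, 3, 2, 1], [8], [5], [6], [7]]], []⟩, ⟨[6381, 75481, 83270, 82365, 81456],
   [[[2, 7, 0], [3], [5, 4], [1], [6], [8]]], []⟩, ⟨[21456, 82456, 14870, 6382, 82365], [[[2, 7,
   0], [3], [5, 4], [1], [6], [8]], [[3, 6, 0], [5, 4], [8], [1], [2], [7]]], []⟩, ⟨[31450, 83450,
   14867, 34270, 83270], [[[2, 7, 0], [3], [5, 4], [1], [6], [8]], [[2, 7, 0], [5, 4], [8], [1],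
   [3], [6]]], []⟩, ⟨[6384, 84360, 13850, 7284, 83270], [[[2, 7, 0], [3], [5, 4], [1], [6], [8]],
   [[2, 7, 0], [6, 3], [8], [1], [4], [5]]], []⟩, ⟨[50631, 23658, 12785, 12768, 24860], [[[0], [4,
   3, 2, 1], [8], [5], [6], [7]], [[0], [4, 3, 2, 1], [5], [6], [7], [8]]], []⟩, ⟨[60541, 24568,
   60724, 12768, 13850], [[[0], [4, 3, 2, 1], [8], [5], [6], [7]], [[0], [4, 3, 2, 1], [6], [5],
   [7], [8]]], []⟩, ⟨[70634, 13678, 14567, 34578, 32850], [[[0], [4, 3, 2, 1], [8], [5], [6],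
   [7]], [[0], [4, 3, 2, 1], [7], [5], [6], [8]]], []⟩]), (628282339656125332261731806326554792,
   [⟨[3561, 3762, 14358, 12538, 83761], [[[0], [6], [8], [3, 4, 2, 1], [5], [7]]], []⟩, ⟨[3481,
   7681, 84250, 82470, 81653], [[[2, 5, 3, 0], [4], [6], [1], [7], [8]]], []⟩, ⟨[7682, 82673,
   3462, 82470, 14850], [[[2, 5, 3, 0], [4], [6], [1], [7], [8]], [[7, 4, 3, 0], [6], [8], [1],
   [2], [5]]], []⟩, ⟨[26783, 83761, 30561, 12538, 14850], [[[0], [6], [8], [3, 4, 2, 1], [5],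
   [7]], [[0], [6, 4, 2, 1], [3], [5], [7], [8]]], []⟩, ⟨[5684, 84650, 3861, 41250, 84250, 12870],
   [[[2, 5, 0], [4], [6], [1], [7, 3], [8]], [[2, 5, 3, 0], [6], [8], [1], [4], [7]]], []⟩,
   ⟨[14785, 14758, 14385, 14358, 3861, 62830], [[[0], [6, 4, 2, 1], [8], [3], [5], [7]], [[0],
   [5], [6], [3, 4, 2, 1], [7], [8]]], []⟩, ⟨[3486, 3468, 14850, 21673, 21870, 16870, 84250,
   12870, 61250], [[[4, 3, 0], [2], [6], [1], [7, 5], [8]], [[7, 4, 3, 0], [2], [8], [1], [5],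
   [6]]], []⟩, ⟨[70521, 12578, 14850, 30761, 30862, 26870, 14358, 3861, 70346], [[[0], [6, 4, 2,
   1], [8], [3], [5], [7]], [[0], [6, 4, 2, 1], [7], [3], [5], [8]]], []⟩]),
   (628282339646453851909394164365394092, [⟨[80214, 80564, 46580, 82643, 31650, 80741, 16780],
   [[[1, 2, 0], [4, 3], [5], [6], [7], [8]]], []⟩, ⟨[81257, 7681, 81650, 81375, 30561, 81475,
   12074], [[[5, 1, 2, 0], [3], [6], [4], [7], [8]]], []⟩, ⟨[82074, 20346, 82673, 82574, 47582,
   14758, 13752], [[[4, 1, 3, 0], [5], [6], [2], [7], [8]]], []⟩, ⟨[62038, 80564, 30264, 83752,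
   34752, 50841, 56183], [[[5, 1, 2, 0], [4], [7], [3], [6], [8]]], []⟩, ⟨[2148, 84650, 41650,
   30268, 30264, 83752, 41257], [[[3, 1, 2, 0], [6], [7], [4], [5], [8]]], []⟩, ⟨[13058, 13785,
   14758, 31258, 31285, 82643, 50316], [[[3, 1, 2, 0], [6], [7], [4], [5], [8]]], []⟩, ⟨[3168,
   30268, 30286, 82034, 62034, 50348, 50316], [[[3, 1, 2, 0], [4], [5], [6], [7], [8]]], []⟩,
   ⟨[12078, 80214, 21487, 50841, 12587, 31258, 34752], [[[3, 1, 2, 0], [4], [5], [6], [7], [8]]],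
   []⟩]), (649052160930072309461299070319722664, [⟨[80362, 12730, 3541, 80542, 83741], [[[0], [4],
   [8], [3, 6, 2, 1], [5], [7]]], []⟩, ⟨[81270, 7681, 82650, 81453, 7481], [[[2, 7, 3, 0], [4],
   [6], [1], [5], [8]]], []⟩, ⟨[5682, 82650, 35482, 82453, 12870], [[[2, 7, 3, 0], [4], [6], [1],
   [5], [8]], [[4, 5, 3, 0], [6], [8], [1], [2], [7]]], []⟩, ⟨[30721, 12738, 14583, 83542, 3861],
   [[[0], [4], [8], [3, 6, 2, 1], [5], [7]], [[0], [3], [6], [5, 4, 2, 1], [7], [8]]], []⟩,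
   ⟨[3684, 3648, 21453, 14850, 21853, 14870, 12853, 12758, 81275, 41275], [[[2, 7, 3, 0], [4],
   [6], [1], [5], [8]], [[2, 7, 3, 0], [6], [8], [1], [4], [5]]], []⟩, ⟨[12785, 12758, 30542,
   14850, 30841, 5861, 3841, 3648, 80362, 50361], [[[0], [4], [8], [3, 6, 2, 1], [5], [7]], [[0],
   [4], [5], [3, 6, 2, 1], [7], [8]]], []⟩, ⟨[41630, 12830, 3842, 41830, 3642, 16870, 5862, 21650,
   12853, 21853, 81453, 61453, 12758, 3861, 81473, 61473, 83542, 82450, 81275, 61273], [[[7, 3,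
   0], [1], [8], [2], [5, 4], [6]], [[1, 4, 5, 0], [6], [7], [2], [3], [8]], [[2, 7, 0], [4], [8],
   [1], [5, 3], [6]]], []⟩, ⟨[50721, 12830, 12853, 50821, 30721, 16870, 14873, 30741, 3841, 30841,
   80542, 70542, 3648, 12870, 80562, 70561, 83542, 82450, 80362, 70364], [[[0], [6, 2, 1], [8],
   [3], [5, 4], [7]], [[1, 4, 5, 0], [6], [7], [2], [3], [8]], [[0], [6], [7], [5, 4, 2, 1], [3],
   [8]]], []⟩]), (654244220108955297575275156695154792, [⟨[3541, 24680, 80371, 80571, 83642],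
   [[[0], [4], [8], [3, 2, 7, 1], [5], [6]]], []⟩, ⟨[81453, 5781, 81750, 81652, 25681], [[[2, 5,
   3, 0], [1], [8], [4], [6], [7]]], []⟩, ⟨[16582, 3782, 82460, 82561, 82760], [[[1, 6, 3, 0],
   [2], [8], [4], [5], [7]]], []⟩, ⟨[24683, 83642, 14583, 83541, 3871], [[[0], [4], [8], [3, 2, 7,
   1], [5], [6]], [[0], [3], [7], [5, 2, 4, 1], [6], [8]]], []⟩, ⟨[3784, 3748, 24160, 14253,
   36482, 35281, 41652, 14850, 82561, 81652, 36182], [[[2, 5, 3, 0], [1], [8], [4], [6], [7]],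
   [[1, 6, 3, 0], [2], [8], [4], [5], [7]], [[2, 5, 3, 0], [1], [4], [6], [7], [8]]], []⟩, ⟨[5271,
   30541, 14250, 16582, 25361, 3841, 17280, 14283, 30841, 82730, 50672, 14280, 83642, 5871, 50642,
   3748, 14850, 82460, 80642, 80371, 80672, 50374, 16382], [[[0], [4], [8], [3, 2, 7, 1], [5],
   [6]], [[0], [4], [5], [3, 2, 7, 1], [6], [8]], [[1, 6, 3, 0], [2], [8], [4], [5], [7]]], []⟩,
   ⟨[6172, 30642, 24160, 25681, 25361, 3842, 27180, 24183, 30842, 81730, 6872, 24180, 60541,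
   83541, 3748, 24860, 81453, 80541, 80371, 80571, 60372, 60571, 25081], [[[0], [4], [8], [3, 2,
   7, 1], [5], [6]], [[0], [4], [6], [3, 2, 7, 1], [5], [8]], [[2, 5, 3, 0], [1], [8], [4], [6],
   [7]]], []⟩, ⟨[6172, 41730, 3742, 3871, 5271, 41830, 3842, 6182, 5281, 14283, 3841, 83541,
   83642, 82460, 82561, 81453, 81652, 71453, 71652], [[[5, 3, 0], [1], [8], [4, 2], [6], [7]],
   [[4, 1, 6, 0], [5], [7], [2], [3], [8]], [[2, 5, 3, 0], [1], [7], [4], [6], [8]]], []⟩]),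
   (565974698140050225404380552367964384, [⟨[80542, 13780, 80731, 80621, 12680], [[[0], [4, 3, 2,
   1], [8], [5], [6], [7]]], []⟩, ⟨[83260, 82350, 83460, 12350, 76481], [[[2, 7, 0], [5, 3], [4],
   [1], [6], [8]]], []⟩, ⟨[21450, 82450, 14870, 21350, 82350, 13860], [[[7, 2, 6, 0], [3], [4],
   [1], [5], [8]], [[7, 2, 6, 0], [3], [4], [1], [5], [8]], [[3, 5, 0], [4], [8], [1], [2], [7,
   6]]], []⟩, ⟨[6483, 83460, 14870, 6283, 83260, 12850], [[[2, 6, 0], [3], [4], [1], [7, 5], [8]],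
   [[2, 6, 0], [5, 4], [8], [1], [3], [7]]], []⟩, ⟨[7384, 84370, 13860, 7284, 84270, 12850], [[[2,
   7, 0], [3], [4], [1], [6, 5], [8]], [[2, 7, 0], [5, 3], [8], [1], [4], [6]]], []⟩, ⟨[12785,
   12758, 12685, 12658, 14870, 13860], [[[0], [4, 3, 2, 1], [8], [5], [6], [7]], [[0], [4, 3, 2,
   1], [5], [6], [7], [8]]], []⟩, ⟨[13586, 13568, 60731, 13768, 14870, 12850], [[[0], [4, 3, 2,
   1], [8], [5], [6], [7]], [[0], [4, 3, 2, 1], [6], [5], [7], [8]]], []⟩, ⟨[70641, 14678, 70541,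
   14578, 13860, 12850], [[[0], [4, 3, 2, 1], [8], [5], [6], [7]], [[0], [4, 3, 2, 1], [7], [5],
   [6], [8]]], []⟩]), (534818856984080339564120446587896040, [⟨[80341, 12538, 12530, 80612, 24680,
   80724, 41780], [[[2, 1, 7, 0], [4], [8], [3], [5], [6]]], []⟩, ⟨[81250, 30721, 81753, 60528,
   53681, 43078, 3481], [[[1, 6, 3, 0], [4], [7], [2], [5], [8]]], []⟩, ⟨[82163, 60528, 63582,
   30718, 30712, 43078, 43072], [[[1, 6, 3, 0], [2], [5], [4], [7], [8]]], []⟩, ⟨[83072, 12538,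
   12583, 80612, 61253, 80724, 71483], [[[2, 1, 7, 0], [3], [4], [5], [6], [8]]], []⟩, ⟨[84170,
   70348, 70384, 21830, 7284, 60528, 50614], [[[1, 6, 0], [2], [5, 3], [4], [7], [8]]], []⟩,
   ⟨[85061, 80612, 61285, 30821, 16385, 71438, 50714], [[[1, 7, 0], [4, 2], [3], [5], [6], [8]]],
   []⟩, ⟨[25068, 52168, 60521, 30812, 61253, 80724, 72436], [[[2, 7, 0], [4, 1], [3], [5], [6],
   [8]]], []⟩, ⟨[43078, 34178, 34187, 30812, 34287, 82536, 72536], [[[6, 3, 0], [4, 1], [2], [5],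
   [7], [8]]], []⟩]), (617898142099211651717707599698723040, [⟨[80541, 80642, 80743, 24680,
   34780], [[[0], [3, 2, 4, 1], [8], [5], [6], [7]]], []⟩, ⟨[25681, 35781, 81450, 81652, 81753],
   [[[3, 2, 5, 0], [1], [8], [4], [6], [7]]], []⟩, ⟨[16582, 36782, 82460, 82561, 82763], [[[3, 1,
   6, 0], [2], [8], [4], [5], [7]]], []⟩, ⟨[17583, 27683, 83470, 83571, 83672], [[[2, 1, 7, 0],
   [3], [8], [4], [5], [6]]], []⟩, ⟨[24160, 34170, 6382, 14350, 7283, 5381, 14253, 35281, 7483,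
   6482, 14850, 83672, 82763, 83571, 82561, 81652, 81753, 7183, 41652, 41753, 36182], [[[2, 7, 0],
   [6, 3], [4], [1], [5], [8]], [[7, 1, 6, 0], [4], [5], [2], [3], [8]], [[3, 2, 5, 0], [1], [4],
   [6], [7], [8]]], []⟩, ⟨[35071, 25061, 16382, 14350, 17283, 14380, 34250, 14280, 17583, 16582,
   14850, 83672, 82763, 83470, 82460, 80642, 80743, 17083, 50642, 50743, 16082], [[[0], [4], [8],
   [2, 7, 1], [6, 3], [5]], [[7, 1, 6, 0], [4], [5], [2], [3], [8]], [[0], [3, 2, 4, 1], [5], [6],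
   [7], [8]]], []⟩, ⟨[36072, 25061, 27183, 24160, 25381, 24380, 14360, 34180, 27683, 25681, 24860,
   83571, 81753, 83470, 81450, 80541, 80743, 17083, 60541, 60743, 25081], [[[0], [4], [8], [2, 7,
   1], [5, 3], [6]], [[7, 2, 5, 0], [4], [6], [1], [3], [8]], [[0], [3, 2, 4, 1], [6], [5], [7],
   [8]]], []⟩, ⟨[36072, 35071, 36182, 34170, 35281, 34280, 34270, 34180, 36782, 35781, 34870,
   82561, 81652, 82460, 81450, 80541, 80642, 16082, 70541, 70642, 25081], [[[0], [4], [8], [3, 6,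
   1], [5, 2], [7]], [[6, 3, 5, 0], [4], [7], [1], [2], [8]], [[0], [3, 2, 4, 1], [7], [5], [6],
   [8]]], []⟩])]

theorem checkLevel_four : checkLevel 4 levelFour (levelFive.map Prod.fst) = true := by
  decide +kernel

theorem checkLevel_five : checkLevel 5 levelFive (levelSix.map Prod.fst) = true := by
  decide +kernel

theorem checkLevel_six : checkLevel 6 levelSix (levelSeven.map Prod.fst) = true := by
  decide +kernel

theorem checkLevel_seven : checkLevel 7 levelSeven (levelEight.map Prod.fst) = true := by
  decide +kernel

theorem checkLevel_eight : checkLevel 8 levelEight [] = true := by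
  decide +kernel

theorem testBit_of_beq_land_shiftRight (m i : ℕ) :
    Nat.beq (Nat.land (Nat.shiftRight m i) 1) 1 = m.testBit i := by
  rw [Bool.eq_iff_iff, Nat.beq_eq, Nat.testBit_eq_decide_div_mod_eq, decide_eq_true_iff,
    ← Nat.shiftRight_eq_div_pow, ← Nat.and_one_is_mod]
  rfl

theorem adjBit_eq_testBit (r i j : ℕ) : adjBit r i j = r.testBit (16 * i + j) :=
  testBit_of_beq_land_shiftRight _ _

theorem adjBit_lor (r s i j : ℕ) :
    adjBit (Nat.lor r s) i j = true ↔ adjBit r i j = true ∨ adjBit s i j = true := by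
  simp only [adjBit_eq_testBit]
  change (r ||| s).testBit _ = true ↔ _
  simp [Nat.testBit_or]

theorem adjBit_edgeCode {i j u v : ℕ} (hi : i < 16) (hj : j < 16) (hv : v < 16) :
    adjBit (edgeCode i j) u v = true ↔ u = i ∧ v = j ∨ u = j ∧ v = i := by
  rw [edgeCode, adjBit_lor, adjBit_eq_testBit, adjBit_eq_testBit]
  change (2 ^ (16 * i + j)).testBit _ = true ∨ (2 ^ (16 * j + i)).testBit _ = true ↔ _
  simp only [Nat.testBit_two_pow, decide_eq_true_eq]
  omega

/-- `r` is the code of `G` when the vertices of `G` are numbered `g 0, …, g (n - 1)`. -/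
structure IsCode {V : Type*} (G : SimpleGraph V) (n r : ℕ) (g : ℕ → V) : Prop where
  inj : ∀ i < n, ∀ j < n, g i = g j → i = j
  surj : ∀ v, ∃ i < n, g i = v
  adj : ∀ i < n, ∀ j < n, (G.Adj (g i) (g j) ↔ adjBit r i j = true)

/-- A numbering by as many numbers as there are vertices is injective if it is surjective. -/
theorem injOn_of_surj_of_card {V : Type*} [Fintype V] {n : ℕ} {g : ℕ → V}
    (hV : Fintype.card V = n) (hg : ∀ v, ∃ i < n, g i = v) :
    ∀ i < n, ∀ j < n, g i = g j → i = j := by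
  have hbij : Function.Bijective fun i : Fin n => g i := by
    rw [Fintype.bijective_iff_surjective_and_card]
    refine ⟨fun v => ?_, by simp [hV]⟩
    obtain ⟨i, hi, h⟩ := hg v
    exact ⟨⟨i, hi⟩, h⟩
  intro i hi j hj hij
  exact Fin.mk.inj_iff.1 (hbij.1 (a₁ := ⟨i, hi⟩) (a₂ := ⟨j, hj⟩) hij)

namespace IsCode

variable {V : Type*} {G : SimpleGraph V} {n r : ℕ} {g : ℕ → V}

theorem hasInducedP5 (h : IsCode G n r g) {p : ℕ} (hp : checkPath n r p = true) :
    HasInducedP5 G := by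
  simp only [checkPath, Bool.and_eq_true, Bool.not_eq_true', Bool.or_eq_false_iff,
    Bool.not_eq_false', Nat.blt_eq] at hp
  obtain ⟨ab, bc, cd, de, ac, ad, ae, bd, be, ce, ha, hb, hc, hd, he⟩ := hp
  refine ⟨g (digit p 0), g (digit p 1), g (digit p 2), g (digit p 3), g (digit p 4), ?_⟩
  rw [h.adj _ ha _ hb, h.adj _ hb _ hc, h.adj _ hc _ hd, h.adj _ hd _ he, h.adj _ ha _ hc,
    h.adj _ ha _ hd, h.adj _ ha _ he, h.adj _ hb _ hd, h.adj _ hb _ he, h.adj _ hc _ he]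
  simp [*]

theorem connectedOn (h : IsCode G n r g) {l : List ℕ} (hl : linked r l = true)
    (hn : ∀ i ∈ l, i < n) : ConnectedOn G {v | ∃ i ∈ l, g i = v} := by
  induction l with
  | nil => simp [linked] at hl
  | cons a l ih =>
    refine ⟨⟨g a, a, by simp, rfl⟩, ?_⟩
    cases l with
    | nil =>
      rintro C hC ⟨c, hc⟩ -
      have := hC hc
      simp only [List.mem_singleton, exists_eq_left, Set.mem_ofPred_eq] at this ⊢
      rintro v rfl
      exact this ▸ hc
    | cons b l =>
      simp only [linked, Bool.and_eq_true, List.any_eq_true] at hl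
      obtain ⟨⟨d, hd, had⟩, hl⟩ := hl
      obtain ⟨-, ih⟩ := ih hl fun i hi => hn i (List.mem_cons_of_mem _ hi)
      have hadj : G.Adj (g a) (g d) :=
        (h.adj a (hn a (by simp)) d (hn d (List.mem_cons_of_mem _ hd))).2 had
      intro C hC hne hcl
      have hsub : ∀ i ∈ b :: l, g i ∈ {v | ∃ i ∈ a :: b :: l, g i = v} :=
        fun i hi => ⟨i, List.mem_cons_of_mem _ hi, rfl⟩
      have hmem : (C ∩ {v | ∃ i ∈ b :: l, g i = v}).Nonempty := by
        obtain ⟨c, hc⟩ := hne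
        obtain ⟨i, hi, rfl⟩ := hC hc
        rcases List.mem_cons.1 hi with rfl | hi
        · exact ⟨g d, hcl _ hc _ (hsub d hd) hadj, d, hd, rfl⟩
        · exact ⟨g i, hc, i, hi, rfl⟩
      have hall := ih (C ∩ {v | ∃ i ∈ b :: l, g i = v}) Set.inter_subset_right hmem (by
        rintro u ⟨hu, -⟩ _ ⟨i, hi, rfl⟩ huv
        exact ⟨hcl u hu _ (hsub i hi) huv, i, hi, rfl⟩)
      rintro _ ⟨i, hi, rfl⟩
      rcases List.mem_cons.1 hi with rfl | hi
      · exact hcl _ (hall ⟨d, hd, rfl⟩).1 _ ⟨i, by simp, rfl⟩ hadj.symm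
      · exact (hall ⟨i, hi, rfl⟩).1

end IsCode

theorem nodup_of_distinct {l : List ℕ} (hl : distinct l = true) : l.Nodup := by
  induction l with
  | nil => exact List.nodup_nil
  | cons a l ih =>
    simp only [distinct, Bool.and_eq_true, Bool.not_eq_true', List.any_eq_false, Nat.beq_eq] at hl
    exact List.nodup_cons.2 ⟨fun h => hl.1 a h rfl, ih hl.2⟩

theorem touching_eq_true {r : ℕ} {s t : List ℕ} (h : touching r s t = true) :
    ∃ a ∈ s, ∃ b ∈ t, adjBit r a b = true := by
  simpa [touching] using h

theorem IsCode.hasK33Minor {V : Type*} {G : SimpleGraph V} {n r : ℕ} {g : ℕ → V}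
    (h : IsCode G n r g) {P : List (List ℕ)} (hP : checkMinor n r P = true) : HasK33Minor G := by
  simp only [checkMinor, Bool.and_eq_true, List.all_eq_true, List.mem_range, Nat.blt_eq] at hP
  obtain ⟨⟨⟨htouch, hlink⟩, hlt⟩, hdist⟩ := hP
  replace htouch := fun i hi j hj => touching_eq_true (htouch i hi j hj)
  let idx : Fin 3 ⊕ Fin 3 → ℕ := Sum.elim (fun i => i) (fun j => 3 + j)
  have hne : ∀ k, ∃ a, a ∈ P.getD (idx k) [] := by
    rintro (i | j)
    · obtain ⟨a, ha, -⟩ := htouch i i.2 0 (by simp)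
      exact ⟨a, ha⟩
    · obtain ⟨-, -, b, hb, -⟩ := htouch 0 (by simp) j j.2
      exact ⟨b, hb⟩
  have hidx : ∀ k, idx k < P.length := by
    intro k
    by_contra! hk
    obtain ⟨a, ha⟩ := hne k
    rw [List.getD_eq_default _ _ hk] at ha
    simp at ha
  have hmem : ∀ k, P.getD (idx k) [] ∈ P := by
    intro k
    rw [List.getD_eq_getElem _ _ (hidx k)]
    exact List.getElem_mem _
  have hltn : ∀ k, ∀ i ∈ P.getD (idx k) [], i < n :=
    fun k i hi => hlt i (List.mem_flatten.2 ⟨_, hmem k, hi⟩)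
  have hinj : Function.Injective idx := by
    rintro (i | i) (j | j) hij <;> simp only [idx, Sum.elim_inl, Sum.elim_inr] at hij
    · rw [Fin.ext hij]
    · omega
    · omega
    · rw [Fin.ext (Nat.add_left_cancel hij)]
  have hpair := (List.nodup_flatten.1 (nodup_of_distinct hdist)).2
  rw [List.pairwise_iff_getElem] at hpair
  have hdisj : ∀ k l, k ≠ l → (P.getD (idx k) []).Disjoint (P.getD (idx l) []) := by
    intro k l hkl
    rw [List.getD_eq_getElem _ _ (hidx k), List.getD_eq_getElem _ _ (hidx l)]
    rcases lt_or_gt_of_ne (hinj.ne hkl) with hlt | hlt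
    · exact hpair _ _ _ _ hlt
    · exact (hpair _ _ _ _ hlt).symm
  refine ⟨fun k => {v | ∃ i ∈ P.getD (idx k) [], g i = v},
    fun k => h.connectedOn (hlink _ (hmem k)) (hltn k), ?_, ?_⟩
  · intro k l hkl
    refine Set.disjoint_left.2 ?_
    rintro _ ⟨i, hi, rfl⟩ ⟨j, hj, hij⟩
    obtain rfl := h.inj _ (hltn _ _ hj) _ (hltn _ _ hi) hij
    exact hdisj k l hkl hi hj
  · intro i j
    obtain ⟨a, ha, b, hb, hab⟩ := htouch i i.2 j j.2
    exact ⟨_, ⟨a, ha, rfl⟩, _, ⟨b, hb, rfl⟩,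
      (h.adj a (hltn (.inl i) a ha) b (hltn (.inr j) b hb)).2 hab⟩

theorem IsCode.of_checkIso {V : Type*} [Fintype V] {G : SimpleGraph V} {n r h p : ℕ} {g : ℕ → V}
    (hr : IsCode G n r g) (hV : Fintype.card V = n) (hp : checkIso n r h p = true) :
    IsCode G n h fun i => g (digit p i) := by
  simp only [checkIso, Bool.and_eq_true, List.all_eq_true, List.any_eq_true, List.mem_range,
    Nat.blt_eq, Nat.beq_eq] at hp
  obtain ⟨⟨hadj, hlt⟩, hsurj⟩ := hp
  have hs : ∀ v, ∃ i < n, g (digit p i) = v := by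
    intro v
    obtain ⟨i, hi, rfl⟩ := hr.surj v
    obtain ⟨j, hj, rfl⟩ := hsurj i hi
    exact ⟨j, hj, rfl⟩
  refine ⟨injOn_of_surj_of_card hV hs, hs, fun i hi j hj => ?_⟩
  rw [hr.adj _ (hlt i hi) _ (hlt j hj)]
  have := hadj i hi j hj
  cases h1 : adjBit h i j <;> simpa [h1] using this

theorem VertexCert.exists_isCode {V : Type*} [Fintype V] {G : SimpleGraph V} {n r : ℕ}
    {g : ℕ → V} (hr : IsCode G n r g) (hV : Fintype.card V = n) (hP : ¬ HasInducedP5 G)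
    (hK : ¬ HasK33Minor G) {c : VertexCert} {L : List ℕ} (hc : c.check n L r = true) :
    ∃ h ∈ L, ∃ g', IsCode G n h g' := by
  simp only [VertexCert.check, Bool.or_eq_true, List.any_eq_true] at hc
  rcases hc with ⟨p, -, hp⟩ | ⟨P, -, hm⟩ | ⟨t, -, ht⟩
  · exact absurd (hr.hasInducedP5 hp) hP
  · exact absurd (hr.hasK33Minor hm) hK
  · split at ht
    · simp at ht
    · next h hh => exact ⟨h, List.mem_of_getElem? hh, _, hr.of_checkIso hV ht⟩

theorem lt_two_pow_log2_of_testBit {A i j : ℕ} (hi : A.testBit i = true) (hj : A.testBit j = true)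
    (hij : i ≠ j) : Nat.pow 2 (Nat.log2 A) < A := by
  by_contra! h
  have hA : A ≠ 0 := by
    rintro rfl
    simp at hi
  obtain he | hlt := h.eq_or_lt
  · change A = 2 ^ _ at he
    rw [he, Nat.testBit_two_pow, decide_eq_true_eq] at hi hj
    exact hij (hi.symm.trans hj)
  · exact absurd (Nat.log2_self_le hA) (not_le.2 hlt)

theorem testBit_lor_two_pow (A x i : ℕ) :
    (Nat.lor A (Nat.pow 2 x)).testBit i = true ↔ A.testBit i = true ∨ i = x := by
  change (A ||| 2 ^ x).testBit i = true ↔ _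
  rw [Nat.testBit_or, Nat.testBit_two_pow, Bool.or_eq_true, decide_eq_true_eq, eq_comm (a := i)]

theorem exists_of_forallSplits {n w : ℕ} {f : ℕ → Bool} (a b : ℕ → Prop) {l : List ℕ}
    (hab : ∀ x ∈ l, a x ∨ b x) {A B R : ℕ} (h : forallSplits n w f l A B R = true) :
    ∃ A' B' R', (A' ≤ Nat.pow 2 (Nat.log2 A') ∨ B' ≤ Nat.pow 2 (Nat.log2 B') ∨ f R' = true) ∧
      (∀ i, A'.testBit i = true ↔ A.testBit i = true ∨ i ∈ l ∧ a i) ∧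
      (∀ i, B'.testBit i = true ↔ B.testBit i = true ∨ i ∈ l ∧ b i) ∧
      ∀ i j, adjBit R' i j = true ↔ adjBit R i j = true ∨ ∃ x ∈ l,
        a x ∧ adjBit (edgeCode x w) i j = true ∨ b x ∧ adjBit (edgeCode x n) i j = true := by
  induction l generalizing A B R with
  | nil =>
    simp only [forallSplits, Bool.or_eq_true, Nat.ble_eq] at h
    exact ⟨A, B, R, h, by simp, by simp, by simp⟩
  | cons x l ih =>
    simp only [forallSplits, Bool.and_eq_true] at h
    have ih' := fun {A B R} => @ih (fun x hx => hab x (List.mem_cons_of_mem _ hx)) A B R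
    by_cases ha : a x
    · by_cases hb : b x
      · obtain ⟨A', B', R', hf, hA, hB, hR⟩ := ih' h.2.2
        refine ⟨A', B', R', hf, fun i => ?_, fun i => ?_, fun i j => ?_⟩
        · rw [hA, testBit_lor_two_pow]; grind
        · rw [hB, testBit_lor_two_pow]; grind
        · rw [hR, adjBit_lor, adjBit_lor]; grind
      · obtain ⟨A', B', R', hf, hA, hB, hR⟩ := ih' h.1
        refine ⟨A', B', R', hf, fun i => ?_, fun i => ?_, fun i j => ?_⟩
        · rw [hA, testBit_lor_two_pow]; grind
        · rw [hB]; grind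
        · rw [hR, adjBit_lor]; grind
    · have hb : b x := (hab x (by simp)).resolve_left ha
      obtain ⟨A', B', R', hf, hA, hB, hR⟩ := ih' h.2.1
      refine ⟨A', B', R', hf, fun i => ?_, fun i => ?_, fun i j => ?_⟩
      · rw [hA]; grind
      · rw [hB, testBit_lor_two_pow]; grind
      · rw [hR, adjBit_lor]; grind

/-- `g'` numbers the vertices of a graph whose edge `xy` is contracted by `φ`, with `x` and `y`
numbered `w` and `n`, and otherwise as prescribed by `g` for the contracted graph. -/
structure IsLift {V W : Type*} (φ : V → W) (x y : V) (n w : ℕ) (g : ℕ → W) (g' : ℕ → V) :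
    Prop where
  eq_right : g' n = y
  eq_left : g' w = x
  spec : ∀ i < n, i ≠ w → g' i ≠ x ∧ g' i ≠ y ∧ φ (g' i) = g i
  surj : ∀ v, v ≠ x → v ≠ y → ∃ i < n, i ≠ w ∧ g' i = v

theorem IsContraction.exists_isLift {V W : Type*} {G : SimpleGraph V} {H : SimpleGraph W}
    {φ : V → W} {x y : V} (hφ : IsContraction G H φ x y) {n h w : ℕ} {g : ℕ → W}
    (hc : IsCode H n h g) (hw : w < n) (hgw : g w = φ x) : ∃ g', IsLift φ x y n w g g' := by
  classical
  choose s hs using hφ.surj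
  set g' : ℕ → V := fun i => if i = n then y else if i = w then x else s (g i) with hg'
  have hspec : ∀ i < n, i ≠ w → g' i ≠ x ∧ g' i ≠ y ∧ φ (g' i) = g i := by
    intro i hi hiw
    have hne : g i ≠ φ x := fun hi' => hiw (hc.inj i hi w hw (hi'.trans hgw.symm))
    simp only [hg', hi.ne, hiw, if_false, hs, and_true]
    constructor <;> intro h' <;> apply hne
    · rw [← hs (g i), h']
    · rw [← hs (g i), h', hφ.map_eq]
  refine ⟨g', by simp [hg'], by simp [hg', hw.ne], hspec, fun v hvx hvy => ?_⟩
  obtain ⟨i, hi, hiv⟩ := hc.surj (φ v)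
  have hiw : i ≠ w := by
    rintro rfl
    have := hφ.eq_or _ _ (hgw.symm.trans hiv)
    grind
  have h1 := hspec i hi hiw
  have h2 := hφ.eq_or _ _ (h1.2.2.trans hiv)
  exact ⟨i, hi, hiw, by grind⟩

theorem adjBit_of_checkStart {n h w R : ℕ} (hR : checkStart n h w R = true) (hn : n < 16)
    (hw : w < n) {i j : ℕ} (hi : i < n + 1) (hj : j < n + 1) :
    adjBit R i j = true ↔ if i = w ∨ i = n ∨ j = w ∨ j = n then i = w ∧ j = n ∨ i = n ∧ j = w
      else adjBit h i j = true := by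
  simp only [checkStart, List.all_eq_true, List.mem_range] at hR
  have := hR i hi j hj
  rw [← adjBit_edgeCode (by omega) hn (by omega)]
  split_ifs with hcase
  all_goals
    rw [← or_assoc, ← or_assoc] at hcase
    simp only [← Nat.beq_eq, ← Bool.or_eq_true, Bool.not_eq_true] at hcase
    simpa [hcase] using this

theorem exists_adjBit_edgeCode {n k i j : ℕ} {m p : ℕ → Prop} (hm : ∀ z, m z → z < n) (hn : n < 16)
    (hk : k < 16) (hj : j < n + 1) :
    (∃ z, m z ∧ p z ∧ adjBit (edgeCode z k) i j = true) ↔ j = k ∧ m i ∧ p i ∨ i = k ∧ m j ∧ p j := by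
  constructor
  · rintro ⟨z, hz, h1, h2⟩
    rw [adjBit_edgeCode ((hm z hz).trans hn) hk (by omega)] at h2
    rcases h2 with ⟨rfl, rfl⟩ | ⟨rfl, rfl⟩
    exacts [.inl ⟨rfl, hz, h1⟩, .inr ⟨rfl, hz, h1⟩]
  · rintro (⟨h1, h2, h3⟩ | ⟨h1, h2, h3⟩)
    · exact ⟨i, h2, h3, (adjBit_edgeCode ((hm i h2).trans hn) hk (by omega)).2 (.inl ⟨rfl, h1⟩)⟩
    · exact ⟨j, h2, h3, (adjBit_edgeCode ((hm j h2).trans hn) hk (by omega)).2 (.inr ⟨h1, rfl⟩)⟩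

theorem IsLift.isCode {V W : Type*} [Fintype V] {G : SimpleGraph V}
    {H : SimpleGraph W} {φ : V → W} {x y : V} (hφ : IsContraction G H φ x y) {n h w : ℕ}
    {g : ℕ → W} (hc : IsCode H n h g) (hn : n < 16) (hV : Fintype.card V = n + 1) (hw : w < n)
    {g' : ℕ → V} (hg' : IsLift φ x y n w g g') {R R' : ℕ} (hR : checkStart n h w R = true)
    (hR' : ∀ i j, adjBit R' i j = true ↔ adjBit R i j = true ∨
      (∃ z, (z < n ∧ z ≠ w) ∧ G.Adj x (g' z) ∧ adjBit (edgeCode z w) i j = true) ∨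
      ∃ z, (z < n ∧ z ≠ w) ∧ G.Adj y (g' z) ∧ adjBit (edgeCode z n) i j = true) :
    IsCode G (n + 1) R' g' := by
  have hs : ∀ v, ∃ i < n + 1, g' i = v := by
    intro v
    by_cases hvx : v = x
    · exact ⟨w, by omega, hg'.eq_left.trans hvx.symm⟩
    by_cases hvy : v = y
    · exact ⟨n, by omega, hg'.eq_right.trans hvy.symm⟩
    · obtain ⟨i, hi, -, hiv⟩ := hg'.surj v hvx hvy
      exact ⟨i, by omega, hiv⟩
  refine ⟨injOn_of_surj_of_card hV hs, hs, fun i hi j hj => ?_⟩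
  have hm : ∀ z, z < n ∧ z ≠ w → z < n := fun z hz => hz.1
  rw [hR', adjBit_of_checkStart hR hn hw hi hj,
    exists_adjBit_edgeCode (p := fun z => G.Adj x (g' z)) hm hn (by omega) hj,
    exists_adjBit_edgeCode (p := fun z => G.Adj y (g' z)) hm hn hn hj]
  have hxy := hφ.adj
  have hnw : n ≠ w := hw.ne'
  by_cases hin : i = n
  · subst hin
    by_cases hjw : j = w
    · subst hjw
      simp [hg'.eq_right, hg'.eq_left, hxy.symm]
    by_cases hjn : j = i
    · simp [hjn, hg'.eq_right, hnw]
    · have : j < i := by omega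
      simp [hg'.eq_right, hjw, hjn, hnw, this]
  by_cases hiw : i = w
  · subst hiw
    by_cases hjn : j = n
    · subst hjn
      simp [hg'.eq_right, hg'.eq_left, hxy]
    by_cases hji : j = i
    · simp [hji, hg'.eq_left, hnw.symm]
    · have : j < n := by omega
      simp [hg'.eq_left, hji, hjn, hnw.symm, this]
  have hin' : i < n := by omega
  by_cases hjn : j = n
  · subst hjn
    simp [hg'.eq_right, hiw, hin, hnw, hin', G.adj_comm _ y]
  by_cases hjw : j = w
  · subst hjw
    simp [hg'.eq_left, hiw, hin, hnw.symm, hin', G.adj_comm _ x]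
  · have hjn' : j < n := by omega
    obtain ⟨h1, h2, h3⟩ := hg'.spec i hin' hiw
    obtain ⟨h4, h5, h6⟩ := hg'.spec j hjn' hjw
    rw [← hφ.adj_iff_of_ne h1 h2 h4 h5, h3, h6, hc.adj i hin' j hjn']
    simp [hin, hiw, hjn, hjw]

theorem exists_isCode_of_checkVertex_of_adj {V W : Type*} [Fintype V] {G : SimpleGraph V}
    {H : SimpleGraph W} {φ : V → W} {x y : V} (hφ : IsContraction G H φ x y) {n h w x₀ : ℕ}
    {l : List ℕ} {g : ℕ → W} (hc : IsCode H n h g) (hn : n < 16) (hV : Fintype.card V = n + 1)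
    (hP : ¬ HasInducedP5 G) (hK : ¬ HasK33Minor G)
    (hx : ∃ u v, u ≠ v ∧ u ≠ y ∧ v ≠ y ∧ G.Adj x u ∧ G.Adj x v)
    (hy : ∃ u v, u ≠ v ∧ u ≠ x ∧ v ≠ x ∧ G.Adj y u ∧ G.Adj y v)
    (hw : w < n) (hgw : g w = φ x) (hl : ∀ i, i ∈ x₀ :: l ↔ i < n ∧ adjBit h w i = true)
    (hx₀ : ∀ v, φ v = g x₀ → v ≠ x → v ≠ y → G.Adj x v)
    {R : ℕ} {c : VertexCert} {L : List ℕ} (hR : checkStart n h w R = true)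
    (h₁ : forallSplits n w (c.check (n + 1) L) l (Nat.pow 2 x₀) 0
      (Nat.lor R (edgeCode x₀ w)) = true)
    (h₂ : forallSplits n w (c.check (n + 1) L) l (Nat.pow 2 x₀) (Nat.pow 2 x₀)
      (Nat.lor R (Nat.lor (edgeCode x₀ w) (edgeCode x₀ n))) = true) :
    ∃ h' ∈ L, ∃ g', IsCode G (n + 1) h' g' := by
  obtain ⟨g', hg'⟩ := hφ.exists_isLift hc hw hgw
  have hl' : ∀ i, i ∈ x₀ :: l ↔ i < n ∧ i ≠ w ∧ (G.Adj x (g' i) ∨ G.Adj y (g' i)) := by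
    intro i
    rw [hl]
    refine and_congr_right fun hi => ?_
    rw [← hc.adj w hw i hi]
    by_cases hiw : i = w
    · simp [hiw]
    · obtain ⟨h1, h2, h3⟩ := hg'.spec i hi hiw
      rw [← hφ.adj_iff_of_mem h1 h2, h3, hgw]
      simp [hiw]
  have ha₀ : G.Adj x (g' x₀) := by
    obtain ⟨h1, h2, -⟩ := (hl' x₀).1 (by simp)
    obtain ⟨h3, h4, h5⟩ := hg'.spec x₀ h1 h2
    exact hx₀ _ h5 h3 h4
  have hab : ∀ i ∈ l, G.Adj x (g' i) ∨ G.Adj y (g' i) :=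
    fun i hi => ((hl' i).1 (List.mem_cons_of_mem _ hi)).2.2
  obtain ⟨A', B', R', hf, hA, hB, hR'⟩ : ∃ A' B' R',
      (A' ≤ Nat.pow 2 (Nat.log2 A') ∨ B' ≤ Nat.pow 2 (Nat.log2 B') ∨
        c.check (n + 1) L R' = true) ∧
      (∀ i, A'.testBit i = true ↔ i ∈ x₀ :: l ∧ G.Adj x (g' i)) ∧
      (∀ i, B'.testBit i = true ↔ i ∈ x₀ :: l ∧ G.Adj y (g' i)) ∧
      ∀ i j, adjBit R' i j = true ↔ adjBit R i j = true ∨ ∃ z ∈ x₀ :: l,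
        G.Adj x (g' z) ∧ adjBit (edgeCode z w) i j = true ∨
        G.Adj y (g' z) ∧ adjBit (edgeCode z n) i j = true := by
    have hpow : ∀ i, (Nat.pow 2 x₀).testBit i = true ↔ i = x₀ := by
      intro i
      change (2 ^ x₀).testBit i = true ↔ _
      simp [Nat.testBit_two_pow, eq_comm]
    by_cases hb₀ : G.Adj y (g' x₀)
    · obtain ⟨A', B', R', hf, hA, hB, hR'⟩ := exists_of_forallSplits _ _ hab h₂
      refine ⟨A', B', R', hf, fun i => ?_, fun i => ?_, fun i j => ?_⟩
      · rw [hA, hpow]; grind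
      · rw [hB, hpow]; grind
      · rw [hR', adjBit_lor, adjBit_lor]; grind
    · obtain ⟨A', B', R', hf, hA, hB, hR'⟩ := exists_of_forallSplits _ _ hab h₁
      refine ⟨A', B', R', hf, fun i => ?_, fun i => ?_, fun i j => ?_⟩
      · rw [hA, hpow]; grind
      · rw [hB, Nat.zero_testBit]; grind
      · rw [hR', adjBit_lor]; grind
  have hdeg : ∀ M z, (∃ u v, u ≠ v ∧ (u ≠ x ∧ u ≠ y) ∧ (v ≠ x ∧ v ≠ y) ∧ G.Adj z u ∧ G.Adj z v) →
      z = x ∨ z = y → (∀ i, M.testBit i = true ↔ i ∈ x₀ :: l ∧ G.Adj z (g' i)) →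
      ¬ M ≤ Nat.pow 2 (Nat.log2 M) := by
    rintro M z ⟨u, v, huv, hu, hv, hzu, hzv⟩ hz hM
    obtain ⟨i, hi, hiw, rfl⟩ := hg'.surj u hu.1 hu.2
    obtain ⟨j, hj, hjw, rfl⟩ := hg'.surj v hv.1 hv.2
    refine not_le.2 (lt_two_pow_log2_of_testBit (i := i) (j := j) ?_ ?_ fun h => huv (h ▸ rfl))
    · rw [hM, hl']
      rcases hz with rfl | rfl <;> tauto
    · rw [hM, hl']
      rcases hz with rfl | rfl <;> tauto
  have hcheck : c.check (n + 1) L R' = true := by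
    refine (hf.resolve_left (hdeg A' x ?_ (.inl rfl) hA)).resolve_left
      (hdeg B' y ?_ (.inr rfl) hB)
    · obtain ⟨u, v, huv, hu, hv, hxu, hxv⟩ := hx
      exact ⟨u, v, huv, ⟨hxu.ne', hu⟩, ⟨hxv.ne', hv⟩, hxu, hxv⟩
    · obtain ⟨u, v, huv, hu, hv, hyu, hyv⟩ := hy
      exact ⟨u, v, huv, ⟨hu, hyu.ne'⟩, ⟨hv, hyv.ne'⟩, hyu, hyv⟩
  refine VertexCert.exists_isCode (hg'.isCode hφ hc hn hV hw hR fun i j => ?_) hV hP hK hcheck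
  rw [hR']
  refine or_congr_right ?_
  simp only [hl']
  constructor
  · rintro ⟨z, ⟨h1, h2, -⟩, h | h⟩
    exacts [.inl ⟨z, ⟨h1, h2⟩, h⟩, .inr ⟨z, ⟨h1, h2⟩, h⟩]
  · rintro (⟨z, ⟨h1, h2⟩, h⟩ | ⟨z, ⟨h1, h2⟩, h⟩)
    exacts [⟨z, ⟨h1, h2, .inl h.1⟩, .inl h⟩, ⟨z, ⟨h1, h2, .inr h.1⟩, .inr h⟩]

/-- The vertex `x` has two neighbours other than `y`. -/
theorem NoTwoCut.exists_two_adj {V : Type*} [Fintype V] {G : SimpleGraph V} (hG : NoTwoCut G)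
    (hV : 4 ≤ Fintype.card V) {x y : V} (hxy : y ≠ x) :
    ∃ u v, u ≠ v ∧ u ≠ y ∧ v ≠ y ∧ G.Adj x u ∧ G.Adj x v := by
  obtain ⟨u, hu, huy, -⟩ := hG.exists_adj_ne hV hxy hxy
  obtain ⟨v, hv, hvy, hvu⟩ := hG.exists_adj_ne hV hxy hu.ne'
  exact ⟨u, v, hvu.symm, huy, hvy, hu, hv⟩

theorem exists_isCode_of_checkVertex {V W : Type*} [Fintype V] {G : SimpleGraph V}
    {H : SimpleGraph W} {φ : V → W} {x y : V} (hφ : IsContraction G H φ x y) {n h w : ℕ}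
    {g : ℕ → W} (hc : IsCode H n h g) (hn : n < 16) (hV : Fintype.card V = n + 1) (h3 : 3 ≤ n)
    (hG : NoTwoCut G) (hP : ¬ HasInducedP5 G) (hK : ¬ HasK33Minor G) (hw : w < n)
    (hgw : g w = φ x) {c : VertexCert} {L : List ℕ} (hcheck : checkVertex n L h w c = true) :
    ∃ h' ∈ L, ∃ g', IsCode G (n + 1) h' g' := by
  have hl : ∀ i, i ∈ (List.range n).filter (adjBit h w) ↔ i < n ∧ adjBit h w i = true := by simp
  rw [checkVertex] at hcheck
  split at hcheck
  · simp at hcheck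
  · next x₀ l heq =>
    rw [heq] at hl
    simp only [Bool.and_eq_true] at hcheck
    obtain ⟨hR, h₁, h₂⟩ := hcheck
    have hx := hG.exists_two_adj (by omega) hφ.adj.ne'
    have hy := hG.exists_two_adj (by omega) hφ.adj.ne
    obtain ⟨h0, hadj⟩ := (hl x₀).1 (by simp)
    rw [← hc.adj w hw x₀ h0, hgw] at hadj
    have huniq : ∀ u v, φ u = g x₀ → φ v = g x₀ → u ≠ x → u ≠ y → v = u := by
      intro u v hu hv hux huy
      have := hφ.eq_or _ _ (hv.trans hu.symm)
      tauto
    by_cases hx₀ : ∀ v, φ v = g x₀ → v ≠ x → v ≠ y → G.Adj x v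
    · exact exists_isCode_of_checkVertex_of_adj hφ hc hn hV hP hK hx hy hw hgw hl hx₀ hR h₁ h₂
    · push Not at hx₀
      obtain ⟨u, hu, hux, huy, hxu⟩ := hx₀
      rw [← hu, hφ.adj_iff_of_mem hux huy] at hadj
      refine exists_isCode_of_checkVertex_of_adj hφ.symm hc hn hV hP hK hy hx hw
        (hgw.trans hφ.map_eq) hl (fun v hv hvy hvx => ?_) hR h₁ h₂
      rw [huniq u v hu hv hux huy]
      exact hadj.resolve_left hxu

/-- The class of 3-connected graphs without induced `P₅` and without `K₃,₃` minor is closed under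
contracting a suitable edge. -/
theorem NoTwoCut.exists_contraction {V : Type*} [Fintype V] {G : SimpleGraph V} (hG : NoTwoCut G)
    (hV : 4 ≤ Fintype.card V) (hP : ¬ HasInducedP5 G) (hK : ¬ HasK33Minor G) :
    ∃ (x y : V) (H : SimpleGraph {v // v ≠ y}) (φ : V → {v // v ≠ y}), IsContraction G H φ x y ∧
      NoTwoCut H ∧ ¬ HasInducedP5 H ∧ ¬ HasK33Minor H := by
  obtain ⟨a, b, hab⟩ := Fintype.exists_pair_of_one_lt_card (show 1 < Fintype.card V by omega)
  obtain ⟨u, hu, -⟩ := hG.exists_adj_ne hV hab.symm hab.symm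
  obtain ⟨x, y, hxy, hside⟩ := hG.exists_adj_forall_not_isSide hu
  obtain ⟨H, φ, hφ⟩ := exists_isContraction G hxy
  exact ⟨x, y, H, φ, hφ, hφ.noTwoCut hG hside, fun h => hP (hφ.hasInducedP5 h),
    fun h => hK (hφ.hasK33Minor h)⟩

/-- Every 3-connected graph on `n` vertices without induced `P₅` and without `K₃,₃` minor has a code
in `L`. -/
def CodedBy.{u} (n : ℕ) (L : List ℕ) : Prop :=
  ∀ (V : Type u) [Fintype V] (G : SimpleGraph V), Fintype.card V = n → NoTwoCut G →
    ¬ HasInducedP5 G → ¬ HasK33Minor G → ∃ h ∈ L, ∃ g, IsCode G n h g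

theorem CodedBy.succ.{u} {n : ℕ} {D : List (ℕ × List VertexCert)} {L : List ℕ}
    (hD : CodedBy.{u} n (D.map Prod.fst)) (h3 : 3 ≤ n) (hn : n < 16)
    (hcheck : checkLevel n D L = true) : CodedBy.{u} (n + 1) L := by
  classical
  intro V _ G hV hG hP hK
  obtain ⟨x, y, H, φ, hφ, hH, hHP, hHK⟩ := hG.exists_contraction (by omega) hP hK
  have hcard : Fintype.card {v // v ≠ y} = n := by
    rw [Fintype.card_subtype_compl, hV, Fintype.card_subtype_eq, Nat.add_sub_cancel]
  obtain ⟨h, hh, g, hc⟩ := hD _ H hcard hH hHP hHK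
  obtain ⟨⟨h, cs⟩, ht, rfl⟩ := List.mem_map.1 hh
  obtain ⟨w, hw, hgw⟩ := hc.surj (φ x)
  simp only [checkLevel, List.all_eq_true, List.mem_range] at hcheck
  have hcs := hcheck _ ht w hw
  split at hcs
  · simp at hcs
  · exact exists_isCode_of_checkVertex hφ hc hn hV h3 hG hP hK hw hgw hcs

theorem CodedBy.of_le.{u} {n m : ℕ} (h : CodedBy.{u} n []) (h3 : 3 ≤ n) (hnm : n ≤ m) :
    CodedBy.{u} m [] := by
  classical
  induction m, hnm using Nat.le_induction with
  | base => exact h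
  | succ m hm ih =>
    intro V _ G hV hG hP hK
    obtain ⟨x, y, H, φ, -, hH, hHP, hHK⟩ := hG.exists_contraction (by omega) hP hK
    have hcard : Fintype.card {v // v ≠ y} = m := by
      rw [Fintype.card_subtype_compl, hV, Fintype.card_subtype_eq, Nat.add_sub_cancel]
    obtain ⟨h, hh, -⟩ := ih _ H hcard hH hHP hHK
    simp at hh

theorem codedBy_four.{u} : CodedBy.{u} 4 (levelFour.map Prod.fst) := by
  classical
  intro V _ G hV hG _ _
  have hadj : ∀ u v, u ≠ v → G.Adj u v := by
    intro u v huv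
    by_contra hno
    have hcard : ({u, v} : Finset V)ᶜ.card = 2 := by
      rw [Finset.card_compl, hV, Finset.card_pair huv]
    obtain ⟨s, t, -, hst⟩ := Finset.card_eq_two.1 hcard
    have hmem : ∀ z, z ≠ u → z ≠ v → z = s ∨ z = t := by
      intro z hzu hzv
      have : z ∈ ({u, v} : Finset V)ᶜ := by simp [hzu, hzv]
      simpa [hst] using this
    have hs : s ≠ u ∧ s ≠ v := by
      have : s ∈ ({u, v} : Finset V)ᶜ := by simp [hst]
      simpa using this
    have ht : t ≠ u ∧ t ≠ v := by
      have : t ∈ ({u, v} : Finset V)ᶜ := by simp [hst]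
      simpa using this
    obtain ⟨z, hz, hzs, hzt⟩ := hG.exists_adj_ne (by omega) hs.1 ht.1
    have := hmem z hz.ne'
    grind
  let e : V ≃ Fin 4 := Fintype.equivFinOfCardEq hV
  let g : ℕ → V := fun i => e.symm (Fin.ofNat 4 i)
  have hsurj : ∀ v, ∃ i < 4, g i = v := fun v => ⟨e v, (e v).2, by simp [g]⟩
  have hinj := injOn_of_surj_of_card hV hsurj
  refine ⟨_, List.mem_cons_self, g, hinj, hsurj, fun i hi j hj => ?_⟩
  have hiff : G.Adj (g i) (g j) ↔ i ≠ j :=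
    ⟨fun h hij => h.ne (hij ▸ rfl), fun hij => hadj _ _ fun h => hij (hinj i hi j hj h)⟩
  rw [hiff]
  clear hiff hinj hsurj
  revert i j
  decide

theorem codedBy_nine.{u} : CodedBy.{u} 9 [] :=
  ((((codedBy_four.succ (by simp) (by simp) checkLevel_four).succ (by simp) (by simp)
    checkLevel_five).succ (by simp) (by simp) checkLevel_six).succ (by simp) (by simp)
    checkLevel_seven).succ (by simp) (by simp) checkLevel_eight

theorem stmt_16 {V : Type*} [Fintype V] (G : SimpleGraph V)
    (hP : IsPlanar G) (h3 : ThreeConnected G) (hn : 13 ≤ Fintype.card V) :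
    ContainsInduced (pathGraph 5) G := by
  by_contra hG
  obtain ⟨h, hh, -⟩ := codedBy_nine.of_le (by simp) (by omega) V G rfl h3.noTwoCut
    (fun h => hG h.containsInduced) fun h => hP.2 h.containsSubdivision
  simp at hh
end

section
/- For every n with 3 ≤ n ≤ 8, the maximum number of edges of a planar graph on n vertices that contains no induced copy of P_5 equals 3n − 6. -/
open SimpleGraph

/-- `H` is a minor of `G`, witnessed by disjoint connected branch sets. -/
def HasMinor {W V : Type*} (H : SimpleGraph W) (G : SimpleGraph V) : Prop :=
  ∃ B : W → Set V, (∀ a, (G.induce (B a)).Connected) ∧ (∀ a b, a ≠ b → Disjoint (B a) (B b)) ∧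
    ∀ a b, H.Adj a b → ∃ x ∈ B a, ∃ y ∈ B b, G.Adj x y

section Connectivity

variable {V : Type*} {G : SimpleGraph V}

lemma exists_walk_of_connected_induce {B : Set V} (hB : (G.induce B).Connected) {x y : V}
    (hx : x ∈ B) (hy : y ∈ B) : ∃ p : G.Walk x y, ∀ z ∈ p.support, z ∈ B := by
  obtain ⟨p⟩ := hB.preconnected ⟨x, hx⟩ ⟨y, hy⟩
  refine ⟨p.map (Embedding.induce B).toHom, fun z hz => ?_⟩
  have hz' : z ∈ (p.map (Embedding.induce B).toHom).support := hz
  rw [Walk.support_map, List.mem_map] at hz'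
  obtain ⟨w, -, rfl⟩ := hz'
  exact w.2

lemma connected_induce_of_exists_walk {B : Set V} (hne : B.Nonempty)
    (h : ∀ x ∈ B, ∀ y ∈ B, ∃ p : G.Walk x y, ∀ z ∈ p.support, z ∈ B) :
    (G.induce B).Connected := by
  obtain ⟨u, hu⟩ := hne
  refine induce_connected_of_patches u hu fun {v} hv => ?_
  obtain ⟨p, hp⟩ := h u hu v hv
  exact ⟨_, hp, p.start_mem_support, p.end_mem_support,
    p.connected_induce_support.preconnected _ _⟩

/-- A walk that ends in `T` can be cut to a path at its first vertex in `T`. -/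
lemma exists_path_first_hit {T : Set V} {x y : V} (p : G.Walk x y) (hy : y ∈ T) :
    ∃ d ∈ T, ∃ q : G.Walk x d, q.IsPath ∧ (∀ z ∈ q.support, z ∈ p.support) ∧
      ∀ z ∈ q.support, z ∈ T → z = d := by
  classical
  suffices h : ∃ d ∈ T, ∃ q : G.Walk x d, (∀ z ∈ q.support, z ∈ p.support) ∧
      ∀ z ∈ q.support, z ∈ T → z = d by
    obtain ⟨d, hd, q, hq, hT⟩ := h
    exact ⟨d, hd, q.bypass, q.bypass_isPath,
      fun z hz => hq z (q.support_bypass_subset_support hz),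
      fun z hz => hT z (q.support_bypass_subset_support hz)⟩
  induction p with
  | nil => exact ⟨_, hy, Walk.nil, by simp, by simp⟩
  | @cons x w y h p ih =>
    by_cases hx : x ∈ T
    · exact ⟨x, hx, Walk.nil, by simp, by simp⟩
    · obtain ⟨d, hd, q, hq, hT⟩ := ih hy
      refine ⟨d, hd, Walk.cons h q, ?_, ?_⟩ <;> simp only [Walk.support_cons, List.mem_cons] <;>
        grind

/-- Three vertices of a connected set are joined to a common centre by paths that are disjoint
apart from the centre. -/
lemma exists_tripod {B : Set V} (hB : (G.induce B).Connected) {x y z : V}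
    (hx : x ∈ B) (hy : y ∈ B) (hz : z ∈ B) :
    ∃ (c : V) (p : G.Walk c x) (q : G.Walk c y) (r : G.Walk c z),
      (p.IsPath ∧ q.IsPath ∧ r.IsPath) ∧
      ((∀ t ∈ p.support, t ∈ B) ∧ (∀ t ∈ q.support, t ∈ B) ∧ ∀ t ∈ r.support, t ∈ B) ∧
      (∀ t ∈ p.support, t ∈ q.support → t = c) ∧ (∀ t ∈ p.support, t ∈ r.support → t = c) ∧
      ∀ t ∈ q.support, t ∈ r.support → t = c := by
  classical
  obtain ⟨s, hs⟩ := exists_walk_of_connected_induce hB hx hy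
  obtain ⟨s, hsp, hs⟩ : ∃ s : G.Walk x y, s.IsPath ∧ ∀ t ∈ s.support, t ∈ B :=
    ⟨s.bypass, s.bypass_isPath, fun t ht => hs t (s.support_bypass_subset_support ht)⟩
  obtain ⟨r, hr⟩ := exists_walk_of_connected_induce hB hz hx
  obtain ⟨d, hd, r, hrp, hrr, hrd⟩ :=
    exists_path_first_hit (T := {t | t ∈ s.support}) r s.start_mem_support
  obtain ⟨q₁, q₂, h₁, h₂, rfl⟩ := (hsp.mem_support_iff_exists_append).1 hd
  have hsupp : ∀ t, t ∈ (q₁.append q₂).support ↔ t ∈ q₁.support ∨ t ∈ q₂.support :=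
    fun t => Walk.mem_support_append_iff _ _
  refine ⟨d, q₁.reverse, q₂, r.reverse, ⟨h₁.reverse, h₂, hrp.reverse⟩, ⟨?_, ?_, ?_⟩, ?_, ?_, ?_⟩
  all_goals simp only [Walk.support_reverse, List.mem_reverse, Set.mem_ofPred_eq] at *
  · grind
  · grind
  · grind
  · intro t ht ht'
    by_contra htd
    exact hsp.ne_of_mem_support_of_append htd ht ht' rfl
  · grind
  · grind

/-- A path can be cut just before one of its inner vertices. -/
lemma exists_cut_path {c x d : V} (p : G.Walk c x) (hp : p.IsPath) (hd : d ∈ p.support)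
    (hdc : d ≠ c) : ∃ (e : V) (p₁ : G.Walk c e) (p₂ : G.Walk d x), G.Adj e d ∧
      (∀ t ∈ p₁.support, t ∉ p₂.support) ∧
      (∀ t ∈ p₁.support, t ∈ p.support) ∧ ∀ t ∈ p₂.support, t ∈ p.support := by
  induction p with
  | nil => simp_all
  | @cons c w x h p ih =>
    rw [Walk.cons_isPath_iff] at hp
    by_cases hdw : d = w
    · subst hdw
      exact ⟨c, Walk.nil, p, h, by simpa using hp.2, by simp, by simp +contextual⟩
    · obtain ⟨e, p₁, p₂, he, hdj, h₁, h₂⟩ := ih hp.1 (by simpa [hdc] using hd) hdw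
      refine ⟨e, Walk.cons h p₁, p₂, he, ?_, ?_, ?_⟩ <;>
        simp only [Walk.support_cons, List.mem_cons] <;> grind

/-- `B` contains two disjoint adjacent connected sets, one containing `x` and `w`, the other one
containing `y` and `z`. -/
def Splits (G : SimpleGraph V) (B : Set V) (x w y z : V) : Prop :=
  ∃ A A' : Set V, (G.induce A).Connected ∧ (G.induce A').Connected ∧ A ⊆ B ∧ A' ⊆ B ∧
    Disjoint A A' ∧ (∃ a ∈ A, ∃ a' ∈ A', G.Adj a a') ∧ x ∈ A ∧ w ∈ A ∧ y ∈ A' ∧ z ∈ A'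

lemma splits_of_leg {B : Set V} {c x y z w d : V} (p : G.Walk c x) (q : G.Walk c y)
    (r : G.Walk c z) (s : G.Walk w d) (hp : p.IsPath) (hpB : ∀ t ∈ p.support, t ∈ B)
    (hqB : ∀ t ∈ q.support, t ∈ B) (hrB : ∀ t ∈ r.support, t ∈ B) (hsB : ∀ t ∈ s.support, t ∈ B)
    (hpq : ∀ t ∈ p.support, t ∈ q.support → t = c) (hpr : ∀ t ∈ p.support, t ∈ r.support → t = c)
    (hs : ∀ t ∈ s.support, t ∈ p.support ∨ t ∈ q.support ∨ t ∈ r.support → t = d)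
    (hd : d ∈ p.support) (hdc : d ≠ c) : Splits G B x w y z := by
  obtain ⟨e, p₁, p₂, hed, hdj, h₁, h₂⟩ := exists_cut_path p hp hd hdc
  have hc := p₁.start_mem_support
  refine ⟨{t | t ∈ p₂.support} ∪ {t | t ∈ s.support},
    {t | t ∈ p₁.support} ∪ ({t | t ∈ q.support} ∪ {t | t ∈ r.support}), ?_, ?_, ?_, ?_, ?_, ?_,
    ?_, ?_, ?_, ?_⟩
  · exact induce_union_connected p₂.connected_induce_support.preconnected
      s.connected_induce_support.preconnected ⟨d, p₂.start_mem_support, s.end_mem_support⟩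
  · exact induce_union_connected p₁.connected_induce_support.preconnected
      (induce_union_connected q.connected_induce_support.preconnected
        r.connected_induce_support.preconnected
        ⟨c, q.start_mem_support, r.start_mem_support⟩).preconnected
      ⟨c, p₁.start_mem_support, Or.inl q.start_mem_support⟩
  · rintro t (ht | ht)
    exacts [hpB t (h₂ t ht), hsB t ht]
  · rintro t (ht | ht | ht)
    exacts [hpB t (h₁ t ht), hqB t ht, hrB t ht]
  · rw [Set.disjoint_left]
    have := p₂.start_mem_support
    simp only [Set.mem_union, Set.mem_ofPred_eq]
    grind
  · exact ⟨d, Or.inl p₂.start_mem_support, e, Or.inl p₁.end_mem_support, hed.symm⟩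
  · exact Or.inl p₂.end_mem_support
  · exact Or.inr s.start_mem_support
  · exact Or.inr (Or.inl q.end_mem_support)
  · exact Or.inr (Or.inr r.end_mem_support)

/-- The vertices `x i` with `i ∈ N` are joined to a common centre in `B` by paths in `B` that are
disjoint apart from the centre. -/
def HasSpider {ι : Type*} (G : SimpleGraph V) (B : Set V) (N : Set ι) (x : ι → V) : Prop :=
  ∃ c ∈ B, ∃ T : ι → Set V,
    (∀ i ∈ N, T i ⊆ B ∧ ∃ p : G.Walk c (x i), p.IsPath ∧ ∀ z ∈ p.support, z ∈ T i) ∧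
    ∀ i ∈ N, ∀ j ∈ N, i ≠ j → T i ∩ T j ⊆ {c}

lemma hasSpider_three {ι : Type*} {B : Set V} (hB : (G.induce B).Connected) (x : ι → V)
    {i j k : ι} (hij : i ≠ j) (hik : i ≠ k) (hjk : j ≠ k)
    (hx : ∀ l ∈ ({i, j, k} : Set ι), x l ∈ B) : HasSpider G B {i, j, k} x := by
  classical
  obtain ⟨c, p, q, r, ⟨hp, hq, hr⟩, ⟨hpB, hqB, hrB⟩, hpq, hpr, hqr⟩ :=
    exists_tripod hB (hx i (by simp)) (hx j (by simp)) (hx k (by simp))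
  refine ⟨c, hpB c p.start_mem_support, fun l => if l = i then {t | t ∈ p.support} else
    if l = j then {t | t ∈ q.support} else {t | t ∈ r.support}, ?_, ?_⟩
  · rintro l (rfl | rfl | rfl)
    · simpa using ⟨hpB, p, hp, fun _ h => h⟩
    · simpa [hij.symm] using ⟨hqB, q, hq, fun _ h => h⟩
    · simpa [hik.symm, hjk.symm] using ⟨hrB, r, hr, fun _ h => h⟩
  · rintro l (rfl | rfl | rfl) m (rfl | rfl | rfl) hlm t ⟨ht, ht'⟩ <;> grind

lemma hasSpider_four_or_splits {ι : Type*} {B : Set V} (hB : (G.induce B).Connected) (x : ι → V)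
    {i j k l : ι} (hij : i ≠ j) (hik : i ≠ k) (hjk : j ≠ k) (hil : i ≠ l) (hjl : j ≠ l)
    (hkl : k ≠ l) (hx : ∀ m ∈ ({i, j, k, l} : Set ι), x m ∈ B) :
    HasSpider G B {i, j, k, l} x ∨ Splits G B (x i) (x l) (x j) (x k) ∨
      Splits G B (x j) (x l) (x i) (x k) ∨ Splits G B (x k) (x l) (x i) (x j) := by
  classical
  obtain ⟨c, p, q, r, ⟨hp, hq, hr⟩, ⟨hpB, hqB, hrB⟩, hpq, hpr, hqr⟩ :=
    exists_tripod hB (hx i (by simp)) (hx j (by simp)) (hx k (by simp))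
  obtain ⟨s₀, hs₀⟩ := exists_walk_of_connected_induce hB (hx l (by simp))
    (hpB c p.start_mem_support)
  obtain ⟨d, hd, s, hsp, hss, hsd⟩ := exists_path_first_hit
    (T := {t | t ∈ p.support ∨ t ∈ q.support ∨ t ∈ r.support}) s₀ (Or.inl p.start_mem_support)
  have hsB : ∀ t ∈ s.support, t ∈ B := fun t ht => hs₀ t (hss t ht)
  simp only [Set.mem_ofPred_eq] at hsd
  simp only [Set.mem_ofPred_eq] at hd
  clear hs₀ hss
  by_cases hdc : d = c
  · subst hdc
    left
    refine ⟨d, hpB d p.start_mem_support, fun m => if m = i then {t | t ∈ p.support} else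
      if m = j then {t | t ∈ q.support} else if m = k then {t | t ∈ r.support} else
      {t | t ∈ s.support}, ?_, ?_⟩
    · rintro m (rfl | rfl | rfl | rfl)
      · simpa using ⟨hpB, p, hp, fun _ h => h⟩
      · simpa [hij.symm] using ⟨hqB, q, hq, fun _ h => h⟩
      · simpa [hik.symm, hjk.symm] using ⟨hrB, r, hr, fun _ h => h⟩
      · simpa [hil.symm, hjl.symm, hkl.symm] using ⟨hsB, s.reverse, hsp.reverse, by simp⟩
    · rintro m (rfl | rfl | rfl | rfl) n (rfl | rfl | rfl | rfl) hlm t ⟨ht, ht'⟩ <;> grind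
  · right
    rcases hd with hd | hd | hd
    · exact Or.inl (splits_of_leg p q r s hp hpB hqB hrB hsB hpq hpr hsd hd hdc)
    · exact Or.inr (Or.inl (splits_of_leg q p r s hq hqB hpB hrB hsB (by grind) hqr
        (by grind) hd hdc))
    · exact Or.inr (Or.inr (splits_of_leg r p q s hr hrB hpB hqB hsB (by grind) (by grind)
        (by grind) hd hdc))

end Connectivity

section Subdivision

variable {V W : Type*} {G : SimpleGraph V}

lemma exists_attachments [Nonempty V] {H : SimpleGraph W} {B : W → Set V}
    (h : ∀ a b, H.Adj a b → ∃ x ∈ B a, ∃ y ∈ B b, G.Adj x y) :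
    ∃ X : W → W → V, ∀ a b, H.Adj a b → X a b ∈ B a ∧ G.Adj (X a b) (X b a) := by
  classical
  let _ : LinearOrder W := linearOrderOfSTO WellOrderingRel
  choose! x hx y hy hxy using h
  refine ⟨fun a b => if a < b then x a b else y b a, fun a b hab => ?_⟩
  rcases lt_trichotomy a b with hlt | rfl | hlt
  · simpa [hlt, hlt.not_gt] using ⟨hx a b hab, hxy a b hab⟩
  · exact (H.irrefl hab).elim
  · simpa [hlt, hlt.not_gt] using ⟨hy b a hab.symm, (hxy b a hab.symm).symm⟩

/-- Branch sets whose attachment vertices are joined by spiders form a subdivision. -/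
lemma containsSubdivision_of_hasSpider {H : SimpleGraph W} {B : W → Set V}
    (hB : ∀ a b, a ≠ b → Disjoint (B a) (B b)) {X : W → W → V}
    (hX : ∀ a b, H.Adj a b → G.Adj (X a b) (X b a))
    (hS : ∀ a, HasSpider G (B a) (H.neighborSet a) (X a)) : ContainsSubdivision H G := by
  choose c hc T hT hTT using hS
  have hTB : ∀ a b, H.Adj a b → T a b ⊆ B a := fun a b hab => (hT a b hab).1
  choose p hp hpT using fun a b (hab : H.Adj a b) => (hT a b hab).2
  have hBB : ∀ a b x, x ∈ B a → x ∈ B b → a = b := fun a b x ha hb => by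
    by_contra hab
    exact Set.disjoint_left.1 (hB a b hab) ha hb
  let P : ∀ ⦃a b : W⦄, H.Adj a b → G.Walk (c a) (c b) := fun a b h =>
    (p a b h).append (Walk.cons (hX a b h) (p b a h.symm).reverse)
  have hP : ∀ ⦃a b : W⦄ (h : H.Adj a b) x, x ∈ (P h).support →
      x ∈ (p a b h).support ∨ x ∈ (p b a h.symm).support := by
    intro a b h x hx
    simp only [P, Walk.mem_support_append_iff, Walk.support_cons, List.mem_cons,
      Walk.support_reverse, List.mem_reverse] at hx
    rcases hx with hx | rfl | hx
    exacts [Or.inl hx, Or.inl (p a b h).end_mem_support, Or.inr hx]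
  have hPT : ∀ ⦃a b : W⦄ (h : H.Adj a b) x, x ∈ (P h).support → x ∈ T a b ∨ x ∈ T b a :=
    fun a b h x hx => (hP h x hx).imp (hpT a b h x) (hpT b a h.symm x)
  refine ⟨⟨c, fun a b hab => hBB a b _ (hc a) (hab ▸ hc b)⟩, P, ?_, ?_, ?_⟩
  · intro a b h
    rw [Walk.isPath_def]
    simp only [P, Walk.support_append, Walk.support_cons, List.tail_cons, Walk.support_reverse]
    refine List.Nodup.append (hp a b h).support_nodup
      (List.nodup_reverse.2 (hp b a h.symm).support_nodup) ?_
    intro x hx hx'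
    rw [List.mem_reverse] at hx'
    exact h.ne (hBB a b x (hTB a b h (hpT a b h x hx))
      (hTB b a h.symm (hpT b a h.symm x hx')))
  · intro a b h w hw
    rcases hPT h _ hw with hw | hw
    · exact Or.inl (hBB _ _ _ (hc w) (hTB a b h hw))
    · exact Or.inr (hBB _ _ _ (hc w) (hTB b a h.symm hw))
  · have key : ∀ ⦃a b d : W⦄, H.Adj a b → H.Adj a d → b ≠ d → ∀ x, x ∈ T a b → x ∈ T a d →
        x = c a := fun a b d h h' hbd x hx hx' => hTT a b h d h' hbd ⟨hx, hx'⟩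
    intro a b a' b' h h' hne x hx hx'
    rcases hPT h x hx with hx | hx <;> rcases hPT h' x hx' with hx' | hx'
    · obtain rfl := hBB _ _ _ (hTB _ _ h hx) (hTB _ _ h' hx')
      have := key h h' (by rintro rfl; exact hne rfl) x hx hx'
      exact ⟨Or.inl this, Or.inl this⟩
    · obtain rfl := hBB _ _ _ (hTB _ _ h hx) (hTB _ _ h'.symm hx')
      have := key h h'.symm (by rintro rfl; exact hne Sym2.eq_swap) x hx hx'
      exact ⟨Or.inl this, Or.inr this⟩
    · obtain rfl := hBB _ _ _ (hTB _ _ h.symm hx) (hTB _ _ h' hx')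
      have := key h.symm h' (by rintro rfl; exact hne Sym2.eq_swap) x hx hx'
      exact ⟨Or.inr this, Or.inl this⟩
    · obtain rfl := hBB _ _ _ (hTB _ _ h.symm hx) (hTB _ _ h'.symm hx')
      have := key h.symm h'.symm (by rintro rfl; exact hne rfl) x hx hx'
      exact ⟨Or.inr this, Or.inr this⟩

lemma containsSubdivision_of_hasMinor_K33
    (h : HasMinor (completeBipartiteGraph (Fin 3) (Fin 3)) G) :
    ContainsSubdivision (completeBipartiteGraph (Fin 3) (Fin 3)) G := by
  obtain ⟨B, hconn, hdisj, hadj⟩ := h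
  have : Nonempty V := ⟨(hconn (Sum.inl 0)).nonempty.some⟩
  obtain ⟨X, hX⟩ := exists_attachments hadj
  refine containsSubdivision_of_hasSpider hdisj (fun a b h => (hX a b h).2) fun a => ?_
  obtain ⟨i, j, k, hij, hik, hjk, hN⟩ : ∃ i j k, i ≠ j ∧ i ≠ k ∧ j ≠ k ∧
      (completeBipartiteGraph (Fin 3) (Fin 3)).neighborSet a = {i, j, k} := by
    rcases a with a | a
    · refine ⟨Sum.inr 0, Sum.inr 1, Sum.inr 2, by decide, by decide, by decide, ?_⟩
      ext (b | b) <;> fin_cases b <;> simp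
    · refine ⟨Sum.inl 0, Sum.inl 1, Sum.inl 2, by decide, by decide, by decide, ?_⟩
      ext (b | b) <;> fin_cases b <;> simp
  rw [hN]
  refine hasSpider_three (hconn a) (X a) hij hik hjk fun l hl => ?_
  rw [← hN] at hl
  exact (hX a l hl).1

lemma hasMinor_K33_of_splits {B : Fin 5 → Set V} (hconn : ∀ a, (G.induce (B a)).Connected)
    (hdisj : ∀ a b, a ≠ b → Disjoint (B a) (B b)) {X : Fin 5 → Fin 5 → V}
    (hX : ∀ a b, a ≠ b → X a b ∈ B a ∧ G.Adj (X a b) (X b a)) {a i j k l : Fin 5}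
    (h : [a, i, j, k, l].Nodup) (hs : Splits G (B a) (X a i) (X a l) (X a j) (X a k)) :
    HasMinor (completeBipartiteGraph (Fin 3) (Fin 3)) G := by
  obtain ⟨A, A', hA, hA', hAB, hAB', hAA', ⟨u, hu, u', hu', huu'⟩, hi, hl, hj, hk⟩ := hs
  have hd : ∀ b, a ≠ b → Disjoint A (B b) := fun b hb => (hdisj a b hb).mono_left hAB
  have hd' : ∀ b, a ≠ b → Disjoint A' (B b) := fun b hb => (hdisj a b hb).mono_left hAB'
  simp only [List.nodup_cons, List.mem_cons, List.not_mem_nil, not_or, ← ne_eq] at h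
  obtain ⟨⟨hai, haj, hak, hal, -⟩, ⟨hij, hik, hil, -⟩, ⟨hjk, hjl, -⟩, ⟨hkl, -⟩, -⟩ := h
  have hlr : ∀ s t : Fin 3, ∃ x ∈ (![A, B j, B k] : Fin 3 → Set V) s,
      ∃ y ∈ (![A', B i, B l] : Fin 3 → Set V) t, G.Adj x y := by
    intro s t
    fin_cases s <;> fin_cases t
    · exact ⟨u, hu, u', hu', huu'⟩
    · exact ⟨_, hi, _, (hX i a hai.symm).1, (hX a i hai).2⟩
    · exact ⟨_, hl, _, (hX l a hal.symm).1, (hX a l hal).2⟩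
    · exact ⟨_, (hX j a haj.symm).1, _, hj, (hX j a haj.symm).2⟩
    · exact ⟨_, (hX j i hij.symm).1, _, (hX i j hij).1, (hX j i hij.symm).2⟩
    · exact ⟨_, (hX j l hjl).1, _, (hX l j (Ne.symm hjl)).1, (hX j l hjl).2⟩
    · exact ⟨_, (hX k a hak.symm).1, _, hk, (hX k a hak.symm).2⟩
    · exact ⟨_, (hX k i hik.symm).1, _, (hX i k hik).1, (hX k i hik.symm).2⟩
    · exact ⟨_, (hX k l hkl).1, _, (hX l k (Ne.symm hkl)).1, (hX k l hkl).2⟩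
  have hlrd : ∀ s t : Fin 3, Disjoint ((![A, B j, B k] : Fin 3 → Set V) s)
      ((![A', B i, B l] : Fin 3 → Set V) t) := by
    intro s t
    fin_cases s <;> fin_cases t
    exacts [hAA', hd i hai, hd l hal, (hd' j haj).symm, hdisj _ _ (Ne.symm hij), hdisj _ _ hjl,
      (hd' k hak).symm, hdisj _ _ (Ne.symm hik), hdisj _ _ hkl]
  refine ⟨Sum.elim ![A, B j, B k] ![A', B i, B l], ?_, ?_, ?_⟩
  · rintro (s | s) <;> fin_cases s
    exacts [hA, hconn j, hconn k, hA', hconn i, hconn l]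
  · rintro (s | s) (t | t) hst
    · fin_cases s <;> fin_cases t <;> first | exact absurd rfl hst | skip
      exacts [hd j haj, hd k hak, (hd j haj).symm, hdisj _ _ hjk, (hd k hak).symm,
        hdisj _ _ (Ne.symm hjk)]
    · exact hlrd s t
    · exact (hlrd t s).symm
    · fin_cases s <;> fin_cases t <;> first | exact absurd rfl hst | skip
      exacts [hd' i hai, hd' l hal, (hd' i hai).symm, hdisj _ _ hil, (hd' l hal).symm,
        hdisj _ _ (Ne.symm hil)]
  · rintro (s | s) (t | t) hst
    · simp at hst
    · exact hlr s t
    · obtain ⟨x, hx, y, hy, hxy⟩ := hlr t s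
      exact ⟨y, hy, x, hx, hxy.symm⟩
    · simp at hst

/-- A graph with a `K₅` minor contains a subdivision of `K₅` or of `K₃,₃`. -/
lemma containsSubdivision_of_hasMinor_K5 (h : HasMinor (completeGraph (Fin 5)) G) :
    ContainsSubdivision (completeGraph (Fin 5)) G ∨
      ContainsSubdivision (completeBipartiteGraph (Fin 3) (Fin 3)) G := by
  obtain ⟨B, hconn, hdisj, hadj⟩ := h
  have : Nonempty V := ⟨(hconn 0).nonempty.some⟩
  obtain ⟨X, hX⟩ := exists_attachments hadj
  replace hX : ∀ a b, a ≠ b → X a b ∈ B a ∧ G.Adj (X a b) (X b a) := hX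
  by_cases hall : ∀ a, HasSpider G (B a) ((completeGraph (Fin 5)).neighborSet a) (X a)
  · exact Or.inl (containsSubdivision_of_hasSpider hdisj (fun a b h => (hX a b h).2) hall)
  right
  push Not at hall
  obtain ⟨a, ha⟩ := hall
  obtain ⟨i, j, k, l, hnd, hall⟩ : ∃ i j k l : Fin 5, [a, i, j, k, l].Nodup ∧
      ∀ b, a ≠ b ↔ b = i ∨ b = j ∨ b = k ∨ b = l := by
    clear ha
    revert a
    decide
  have hN : (completeGraph (Fin 5)).neighborSet a = {i, j, k, l} := Set.ext hall
  have hnd' := hnd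
  simp only [List.nodup_cons, List.mem_cons, List.not_mem_nil, not_or] at hnd'
  obtain ⟨-, ⟨hij, hik, hil, -⟩, ⟨hjk, hjl, -⟩, ⟨hkl, -⟩, -⟩ := hnd'
  rw [hN] at ha
  refine containsSubdivision_of_hasMinor_K33 ?_
  rcases hasSpider_four_or_splits (hconn a) (X a) hij hik hjk hil hjl hkl
    (fun m hm => (hX a m ((hall m).2 hm)).1) with h | h | h | h
  · exact absurd h ha
  · exact hasMinor_K33_of_splits hconn hdisj hX hnd h
  · exact hasMinor_K33_of_splits hconn hdisj hX (i := j) (j := i) (k := k) (l := l)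
      (by simp_all; grind) h
  · exact hasMinor_K33_of_splits hconn hdisj hX (i := k) (j := i) (k := j) (l := l)
      (by simp_all; grind) h

end Subdivision

section Minor

variable {V W : Type*} {G : SimpleGraph V}

lemma HasMinor.mono {H : SimpleGraph W} {G' : SimpleGraph V} (hle : G' ≤ G)
    (h : HasMinor H G') : HasMinor H G := by
  obtain ⟨B, hconn, hdisj, hadj⟩ := h
  refine ⟨B, fun a => (hconn a).mono (comap_monotone _ hle), hdisj, fun a b hab => ?_⟩
  obtain ⟨x, hx, y, hy, hxy⟩ := hadj a b hab
  exact ⟨x, hx, y, hy, hle hxy⟩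

/-- If `G'` arises from `G` by contracting the edge `uv` to `u` and deleting edges, then the minors
of `G'` are minors of `G`. -/
lemma HasMinor.of_contract {H : SimpleGraph W} {G' : SimpleGraph V}
    (hH : ∀ a, ∃ b, H.Adj a b) {u v : V} (huv : G.Adj u v)
    (hG' : ∀ x y, G'.Adj x y →
      x ≠ v ∧ y ≠ v ∧ (G.Adj x y ∨ (x = u ∧ G.Adj v y) ∨ (y = u ∧ G.Adj v x)))
    (h : HasMinor H G') : HasMinor H G := by
  obtain ⟨B, hconn, hdisj, hadj⟩ := h
  let B' : W → Set V := fun a => {x | (x ≠ v ∧ x ∈ B a) ∨ (x = v ∧ u ∈ B a)}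
  have hB' : ∀ {a x}, x ≠ v → x ∈ B a → x ∈ B' a := fun hx hxa => Or.inl ⟨hx, hxa⟩
  have lift : ∀ a x y (p : G'.Walk x y), (∀ z ∈ p.support, z ∈ B a) → x ≠ v →
      ∃ q : G.Walk x y, ∀ z ∈ q.support, z ∈ B' a := by
    intro a x y p
    induction p with
    | nil => exact fun hp hx => ⟨Walk.nil, by simpa using hB' hx (hp _ (by simp))⟩
    | @cons x w y hxw p ih =>
      intro hp hx
      obtain ⟨-, hw, hcase⟩ := hG' x w hxw
      obtain ⟨q, hq⟩ := ih (fun z hz => hp z (by simp [hz])) hw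
      have hxB := hp x (by simp)
      have hwB := hp w (by simp)
      rcases hcase with hadj | ⟨rfl, hvw⟩ | ⟨rfl, hvx⟩
      · refine ⟨Walk.cons hadj q, ?_⟩
        simpa using ⟨hB' hx hxB, hq⟩
      · refine ⟨Walk.cons huv (Walk.cons hvw q), ?_⟩
        simpa using ⟨hB' hx hxB, Or.inr ⟨rfl, hxB⟩, hq⟩
      · refine ⟨Walk.cons hvx.symm (Walk.cons huv.symm q), ?_⟩
        simpa using ⟨hB' hx hxB, Or.inr ⟨rfl, hwB⟩, hq⟩
  have anchor : ∀ a, ∀ x ∈ B' a, ∃ y ∈ B a, y ≠ v ∧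
      ∃ q : G.Walk x y, ∀ z ∈ q.support, z ∈ B' a := by
    rintro a x (⟨hxv, hx⟩ | ⟨rfl, hu⟩)
    · exact ⟨x, hx, hxv, Walk.nil, by simpa using hB' hxv hx⟩
    · exact ⟨u, hu, huv.ne, Walk.cons huv.symm Walk.nil,
        by simpa using ⟨Or.inr ⟨rfl, hu⟩, hB' huv.ne hu⟩⟩
  refine ⟨B', fun a => connected_induce_of_exists_walk ?_ ?_, fun a b hab => ?_, fun a b hab => ?_⟩
  · obtain ⟨b, hab⟩ := hH a
    obtain ⟨x, hx, y, -, hxy⟩ := hadj a b hab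
    exact ⟨x, hB' (hG' x y hxy).1 hx⟩
  · intro x hx y hy
    obtain ⟨x', hx', hxv, q, hq⟩ := anchor a x hx
    obtain ⟨y', hy', -, r, hr⟩ := anchor a y hy
    obtain ⟨p, hp⟩ := exists_walk_of_connected_induce (hconn a) hx' hy'
    obtain ⟨p', hp'⟩ := lift a x' y' p hp hxv
    refine ⟨(q.append p').append r.reverse, fun z hz => ?_⟩
    simp only [Walk.mem_support_append_iff, Walk.support_reverse, List.mem_reverse] at hz
    rcases hz with (hz | hz) | hz
    exacts [hq z hz, hp' z hz, hr z hz]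
  · have := Set.disjoint_left.1 (hdisj a b hab)
    rw [Set.disjoint_left]
    rintro x (⟨hxv, hx⟩ | ⟨rfl, hu⟩) (⟨hxv', hx'⟩ | ⟨hxv', hu'⟩)
    exacts [this hx hx', hxv hxv', hxv' rfl, this hu hu']
  · obtain ⟨x, hx, y, hy, hxy⟩ := hadj a b hab
    obtain ⟨hxv, hyv, hcase⟩ := hG' x y hxy
    rcases hcase with h | ⟨rfl, h⟩ | ⟨rfl, h⟩
    · exact ⟨x, hB' hxv hx, y, hB' hyv hy, h⟩
    · exact ⟨v, Or.inr ⟨rfl, hx⟩, y, hB' hyv hy, h⟩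
    · exact ⟨x, hB' hxv hx, v, Or.inr ⟨rfl, hy⟩, h.symm⟩

lemma hasMinor_of_injective {H : SimpleGraph W} (f : W → V) (hf : f.Injective)
    (h : ∀ a b, H.Adj a b → G.Adj (f a) (f b)) : HasMinor H G := by
  refine ⟨fun a => {f a}, fun a => ?_, fun a b hab => ?_, fun a b hab =>
    ⟨f a, rfl, f b, rfl, h a b hab⟩⟩
  · exact connected_induce_of_exists_walk (Set.singleton_nonempty _)
      (by rintro x rfl y rfl; exact ⟨Walk.nil, by simp⟩)
  · simpa using fun h => hab (hf h)

/-- `G` has a `K₅` minor or a `K₃,₃` minor. -/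
def HasKuratowskiMinor (G : SimpleGraph V) : Prop :=
  HasMinor (completeGraph (Fin 5)) G ∨ HasMinor (completeBipartiteGraph (Fin 3) (Fin 3)) G

lemma HasKuratowskiMinor.mono {G' : SimpleGraph V} (hle : G' ≤ G) (h : HasKuratowskiMinor G') :
    HasKuratowskiMinor G :=
  h.imp (HasMinor.mono hle) (HasMinor.mono hle)

lemma HasKuratowskiMinor.of_contract {G' : SimpleGraph V} {u v : V} (huv : G.Adj u v)
    (hG' : ∀ x y, G'.Adj x y →
      x ≠ v ∧ y ≠ v ∧ (G.Adj x y ∨ (x = u ∧ G.Adj v y) ∨ (y = u ∧ G.Adj v x)))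
    (h : HasKuratowskiMinor G') : HasKuratowskiMinor G := by
  refine h.imp (HasMinor.of_contract (fun a => ?_) huv hG')
    (HasMinor.of_contract (fun a => ?_) huv hG')
  · exact ⟨a + 1, by revert a; decide⟩
  · rcases a with a | a
    exacts [⟨Sum.inr 0, by simp⟩, ⟨Sum.inl 0, by simp⟩]

lemma ncard_edgeSet_eq_card_edgeFinset [Fintype V] [DecidableRel G.Adj] :
    G.edgeSet.ncard = G.edgeFinset.card := by
  rw [Set.ncard_eq_toFinset_card', edgeFinset]

variable [Fintype V] [DecidableEq V]

lemma hasMinor_K5_of_degree_eq_four [DecidableRel G.Adj] {v : V} (hv : G.degree v = 4)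
    (h : ∀ u ∈ G.neighborFinset v, ∀ w ∈ G.neighborFinset v, u ≠ w → G.Adj u w) :
    HasMinor (completeGraph (Fin 5)) G := by
  have hcard : (insert v (G.neighborFinset v)).card = 5 := by
    rw [Finset.card_insert_of_notMem (by simp), card_neighborFinset_eq_degree, hv]
  let e := (insert v (G.neighborFinset v)).equivFinOfCardEq hcard
  refine hasMinor_of_injective (fun a => (e.symm a : V))
    (Subtype.val_injective.comp e.symm.injective) fun a b hab => ?_
  have hne : (e.symm a : V) ≠ e.symm b := fun h => hab (e.symm.injective (Subtype.ext h))
  have ha := (e.symm a).2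
  have hb := (e.symm b).2
  rw [Finset.mem_insert] at ha hb
  rcases ha with ha | ha <;> rcases hb with hb | hb
  · exact absurd (ha.trans hb.symm) hne
  · rw [ha]
    simpa using hb
  · rw [hb]
    exact ((mem_neighborFinset _ _ _).1 ha).symm
  · exact h _ ha _ hb hne

lemma hasMinor_K33_of_degree_eq_five [DecidableRel G.Adj] {v : V} (hv : G.degree v = 5)
    (h : ∀ u ∈ G.neighborFinset v, ∀ w ∈ G.neighborFinset v, ∀ w' ∈ G.neighborFinset v,
      u ≠ w → u ≠ w' → w ≠ w' → G.Adj u w ∨ G.Adj u w') :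
    HasMinor (completeBipartiteGraph (Fin 3) (Fin 3)) G := by
  rw [← card_neighborFinset_eq_degree] at hv
  obtain ⟨b, hb, b', hb', hbb', hadj⟩ : ∃ b ∈ G.neighborFinset v, ∃ b' ∈ G.neighborFinset v,
      b ≠ b' ∧ ∀ x ∈ G.neighborFinset v, x ≠ b → x ≠ b' → G.Adj b x ∧ G.Adj b' x := by
    by_cases hall : ∀ b ∈ G.neighborFinset v, ∀ b' ∈ G.neighborFinset v, b ≠ b' → G.Adj b b'
    · obtain ⟨b, hb, b', hb', hne⟩ := Finset.one_lt_card.1 (by omega : 1 < (G.neighborFinset v).card)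
      exact ⟨b, hb, b', hb', hne, fun x hx h₁ h₂ =>
        ⟨hall b hb x hx h₁.symm, hall b' hb' x hx h₂.symm⟩⟩
    · push Not at hall
      obtain ⟨b, hb, b', hb', hne, hnadj⟩ := hall
      refine ⟨b, hb, b', hb', hne, fun x hx h₁ h₂ => ⟨?_, ?_⟩⟩
      · exact (h b hb b' hb' x hx hne h₁.symm h₂.symm).resolve_left hnadj
      · exact (h b' hb' b hb x hx hne.symm h₂.symm h₁.symm).resolve_left
          (fun h => hnadj h.symm)
  have hcard : (((G.neighborFinset v).erase b).erase b').card = 3 := by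
    rw [Finset.card_erase_of_mem (by simp_all [hbb'.symm]), Finset.card_erase_of_mem hb, hv]
  let e := (((G.neighborFinset v).erase b).erase b').equivFinOfCardEq hcard
  have he : ∀ i, (e.symm i : V) ≠ b' ∧ (e.symm i : V) ≠ b ∧ G.Adj v (e.symm i) := fun i => by
    have := (e.symm i).2
    rwa [Finset.mem_erase, Finset.mem_erase, mem_neighborFinset] at this
  have hlr : ∀ i j, G.Adj ((![v, b, b'] : Fin 3 → V) i) (e.symm j) := by
    intro i j
    obtain ⟨h₁, h₂, h₃⟩ := he j
    obtain ⟨h₄, h₅⟩ := hadj _ ((mem_neighborFinset _ _ _).2 h₃) h₂ h₁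
    fin_cases i
    exacts [h₃, h₄, h₅]
  rw [mem_neighborFinset] at hb hb'
  refine hasMinor_of_injective (Sum.elim ![v, b, b'] fun j => (e.symm j : V)) ?_ ?_
  · refine Function.Injective.sumElim ?_ (Subtype.val_injective.comp e.symm.injective)
      fun i j => (hlr i j).ne
    intro i j hij
    have := hb.ne
    have := hb'.ne
    fin_cases i <;> fin_cases j <;> simp_all
  · rintro (i | i) (j | j) hij
    · simp at hij
    · exact hlr i j
    · exact (hlr j i).symm
    · simp at hij

lemma ncard_edgeSet_deleteIncidenceSet [DecidableRel G.Adj] (v : V) :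
    (G.deleteIncidenceSet v).edgeSet.ncard = G.edgeSet.ncard - G.degree v := by
  rw [ncard_edgeSet_eq_card_edgeFinset, ncard_edgeSet_eq_card_edgeFinset,
    card_edgeFinset_deleteIncidenceSet]

lemma ncard_edgeSet_sup_edge {s t : V} (hn : ¬ G.Adj s t) (h : s ≠ t) :
    (G ⊔ edge s t).edgeSet.ncard = G.edgeSet.ncard + 1 := by
  classical
  rw [Set.ncard_eq_toFinset_card', Set.ncard_eq_toFinset_card']
  exact G.card_edgeFinset_sup_edge hn h

/-- Graphs with more than `3n - 6` edges have a Kuratowski minor. -/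
theorem hasKuratowskiMinor_of_ncard_edgeSet (S : Finset V) (hS : 3 ≤ S.card)
    (G : SimpleGraph V) (hGS : ∀ x y, G.Adj x y → x ∈ S)
    (hcard : 3 * S.card ≤ G.edgeSet.ncard + 5) : HasKuratowskiMinor G := by
  classical
  induction hk : S.card using Nat.strong_induction_on generalizing S G with
  | _ k ih =>
  subst hk
  wlog heq : G.edgeSet.ncard + 5 = 3 * S.card generalizing G
  · obtain ⟨E, hE, hEcard⟩ := Set.exists_subset_card_eq
      (by omega : 3 * S.card - 5 ≤ G.edgeSet.ncard)
    have hle : fromEdgeSet E ≤ G := fun x y hxy => hE ((fromEdgeSet_adj _).1 hxy).1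
    have hE' : (fromEdgeSet E).edgeSet = E := by
      rw [edgeSet_fromEdgeSet, sdiff_eq_left, Set.disjoint_left]
      exact fun e he => G.not_isDiag_of_mem_edgeSet (hE he)
    have hEcard' : (fromEdgeSet E).edgeSet.ncard + 5 = 3 * S.card := by
      rw [hE']
      omega
    exact (this _ (fun x y h => hGS x y (hle h)) hEcard'.ge hEcard').mono hle
  have hdegS : ∀ x, G.degree x < S.card ∨ x ∉ S := by
    intro x
    by_cases hx : x ∈ S
    · left
      rw [← card_neighborFinset_eq_degree]
      exact Finset.card_lt_card ⟨fun y hy => hGS y x ((mem_neighborFinset _ _ _).1 hy).symm,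
        fun h => by simpa using h hx⟩
    · exact Or.inr hx
  have hsum : ∑ x ∈ S, G.degree x = 2 * G.edgeSet.ncard := by
    rw [ncard_edgeSet_eq_card_edgeFinset, ← G.sum_degrees_eq_twice_card_edges]
    refine Finset.sum_subset (Finset.subset_univ S) fun x _ hx => ?_
    rw [← card_neighborFinset_eq_degree, Finset.card_eq_zero, Finset.eq_empty_iff_forall_notMem]
    exact fun y hy => hx (hGS x y ((mem_neighborFinset _ _ _).1 hy))
  have hS4 : 4 ≤ S.card := by
    by_contra hlt
    have h3 : S.card = 3 := by omega
    have : ∑ x ∈ S, G.degree x ≤ ∑ x ∈ S, 2 := Finset.sum_le_sum fun x hx => by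
      have := (hdegS x).resolve_right (not_not.2 hx)
      omega
    rw [Finset.sum_const, smul_eq_mul] at this
    omega
  obtain ⟨v, hvS, hv⟩ : ∃ v ∈ S, G.degree v ≤ 5 := by
    by_contra! hall
    have : ∑ x ∈ S, 6 ≤ ∑ x ∈ S, G.degree x := Finset.sum_le_sum fun x hx => hall x hx
    rw [Finset.sum_const, smul_eq_mul] at this
    omega
  have hScard : (S.erase v).card + 1 = S.card := Finset.card_erase_add_one hvS
  have hdel := ncard_edgeSet_deleteIncidenceSet (G := G) v
  have step : ∀ G' : SimpleGraph V, (∀ x y, G'.Adj x y → x ≠ v ∧ x ∈ S) →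
      3 * (S.erase v).card ≤ G'.edgeSet.ncard + 5 → HasKuratowskiMinor G' :=
    fun G' h₁ h₂ => ih _ (by omega) (S.erase v) (by omega) G'
      (fun x y h => Finset.mem_erase.2 (h₁ x y h)) h₂ rfl
  by_cases hv3 : G.degree v ≤ 3
  · refine (step (G.deleteIncidenceSet v) (fun x y h => ?_) (by omega)).mono
      (G.deleteIncidenceSet_le v)
    rw [deleteIncidenceSet_adj] at h
    exact ⟨h.2.1, hGS x y h.1⟩
  have hnbr : ∀ x, x ∈ G.neighborFinset v → G.Adj v x ∧ x ≠ v ∧ x ∈ S := fun x hx => by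
    rw [mem_neighborFinset] at hx
    exact ⟨hx, hx.ne', hGS x v hx.symm⟩
  by_cases hv4 : G.degree v = 4
  · by_cases hall : ∀ u ∈ G.neighborFinset v, ∀ w ∈ G.neighborFinset v, u ≠ w → G.Adj u w
    · exact Or.inl (hasMinor_K5_of_degree_eq_four hv4 hall)
    · push Not at hall
      obtain ⟨u, hu, w, hw, huw, hnadj⟩ := hall
      obtain ⟨hvu, huv, huS⟩ := hnbr u hu
      obtain ⟨hvw, hwv, hwS⟩ := hnbr w hw
      refine (step (G.deleteIncidenceSet v ⊔ edge u w) (fun x y h => ?_) ?_).of_contract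
        hvu.symm fun x y h => ?_
      · rw [sup_adj, deleteIncidenceSet_adj, edge_adj] at h
        grind
      · rw [ncard_edgeSet_sup_edge (fun h => hnadj (deleteIncidenceSet_le _ _ h)) huw]
        omega
      · rw [sup_adj, deleteIncidenceSet_adj, edge_adj] at h
        grind
  · have hv5 : G.degree v = 5 := by omega
    by_cases hall : ∀ u ∈ G.neighborFinset v, ∀ w ∈ G.neighborFinset v,
        ∀ w' ∈ G.neighborFinset v, u ≠ w → u ≠ w' → w ≠ w' → G.Adj u w ∨ G.Adj u w'
    · exact Or.inr (hasMinor_K33_of_degree_eq_five hv5 hall)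
    · push Not at hall
      obtain ⟨u, hu, w, hw, w', hw', huw, huw', hww', hnadj, hnadj'⟩ := hall
      obtain ⟨hvu, huv, huS⟩ := hnbr u hu
      obtain ⟨hvw, hwv, hwS⟩ := hnbr w hw
      obtain ⟨hvw', hwv', hwS'⟩ := hnbr w' hw'
      refine (step (G.deleteIncidenceSet v ⊔ edge u w ⊔ edge u w') (fun x y h => ?_)
        ?_).of_contract hvu.symm fun x y h => ?_
      · rw [sup_adj, sup_adj, deleteIncidenceSet_adj, edge_adj, edge_adj] at h
        grind
      · rw [ncard_edgeSet_sup_edge (fun h => ?_) huw',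
          ncard_edgeSet_sup_edge (fun h => hnadj (deleteIncidenceSet_le _ _ h)) huw]
        · omega
        · rw [sup_adj, edge_adj] at h
          have := fun h => hnadj' (G.deleteIncidenceSet_le v h)
          grind
      · rw [sup_adj, sup_adj, deleteIncidenceSet_adj, edge_adj, edge_adj] at h
        grind

lemma ncard_edgeSet_le_of_isPlanar (hG : IsPlanar G)
    (hV : 3 ≤ Fintype.card V) : G.edgeSet.ncard ≤ 3 * Fintype.card V - 6 := by
  by_contra hlt
  rcases hasKuratowskiMinor_of_ncard_edgeSet Finset.univ hV G (fun _ _ _ => Finset.mem_univ _)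
    (by rw [Finset.card_univ]; omega) with h | h
  · exact (containsSubdivision_of_hasMinor_K5 h).elim hG.1 hG.2
  · exact hG.2 (containsSubdivision_of_hasMinor_K33 h)

end Minor

/-- The complete graph on `{0, 1, 2, 3}`, together with vertices `k + 4` for `k < 4` joined to all
vertices of `{0, 1, 2, 3}` but `k`, restricted to the first `n` vertices. -/
def stackedTetrahedron (n : ℕ) : SimpleGraph (Fin n) where
  Adj a b := a ≠ b ∧ (a.1 < 4 ∨ b.1 < 4) ∧ a.1 + 4 ≠ b.1 ∧ b.1 + 4 ≠ a.1
  symm := ⟨fun _ _ h => ⟨h.1.symm, h.2.1.symm, h.2.2.2, h.2.2.1⟩⟩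
  loopless := ⟨fun _ h => h.1 rfl⟩

namespace stackedTetrahedron

variable {n : ℕ}

instance : DecidableRel (stackedTetrahedron n).Adj := fun a b =>
  inferInstanceAs (Decidable (a ≠ b ∧ (a.1 < 4 ∨ b.1 < 4) ∧ a.1 + 4 ≠ b.1 ∧ b.1 + 4 ≠ a.1))

lemma adj_iff {a b : Fin n} : (stackedTetrahedron n).Adj a b ↔
    a ≠ b ∧ (a.1 < 4 ∨ b.1 < 4) ∧ a.1 + 4 ≠ b.1 ∧ b.1 + 4 ≠ a.1 := Iff.rfl

lemma ncard_edgeSet (hn : 3 ≤ n) (hn' : n ≤ 8) :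
    (stackedTetrahedron n).edgeSet.ncard = 3 * n - 6 := by
  rw [ncard_edgeSet_eq_card_edgeFinset]
  interval_cases n <;> decide

lemma not_containsInduced_pathGraph :
    ¬ ContainsInduced (pathGraph 5) (stackedTetrahedron n) := by
  rintro ⟨s, ⟨e⟩⟩
  have hadj : ∀ i j, (pathGraph 5).Adj i j ↔
      (stackedTetrahedron n).Adj (e i : Fin n) (e j : Fin n) := fun i j => e.map_adj_iff.symm
  have hlow : ∀ i j, ¬ (pathGraph 5).Adj i j → i ≠ j →
      (e i : Fin n).1 < 4 → ¬ (e j : Fin n).1 < 4 := by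
    intro i j hij hne hi hj
    rw [hadj, adj_iff] at hij
    exact hij ⟨fun h => hne (e.injective (Subtype.ext h)), Or.inl hi, by omega, by omega⟩
  have h01 := ((hadj 0 1).1 (by simp [pathGraph_adj])).2.1
  have h34 := ((hadj 3 4).1 (by simp [pathGraph_adj])).2.1
  rcases h01 with h | h <;> rcases h34 with h' | h' <;>
    exact hlow _ _ (by simp [pathGraph_adj]) (by decide) h h'

lemma eq_of_lt_four {a b c d e : ℕ} (ha : a < 4) (hb : b < 4) (hc : c < 4) (hd : d < 4)
    (he : e < 4) (hab : a ≠ b) (hac : a ≠ c) (had : a ≠ d) (hbc : b ≠ c) (hbd : b ≠ d)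
    (hcd : c ≠ d) (hae : a ≠ e) (hbe : b ≠ e) (hce : c ≠ e) : d = e := by
  omega

lemma not_containsSubdivision_K5 (hn : n ≤ 8) :
    ¬ ContainsSubdivision (completeGraph (Fin 5)) (stackedTetrahedron n) := by
  rintro ⟨f, p, -, -, hdisj⟩
  have hlt : ∀ a, (f a).1 < 4 := by
    intro a
    by_contra hge
    let g : Fin 5 → ℕ := fun b => if h : (completeGraph (Fin 5)).Adj a b then (p h).snd else f a - 4
    have hadj : ∀ b (h : (completeGraph (Fin 5)).Adj a b),
        (stackedTetrahedron n).Adj (f a) (p h).snd := fun b h =>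
      (p h).adj_snd (Walk.not_nil_of_ne (f.injective.ne h))
    have hg : ∀ b, g b < 4 := fun b => by
      by_cases h : (completeGraph (Fin 5)).Adj a b
      · have := adj_iff.1 (hadj b h)
        simp only [g, dif_pos h]
        omega
      · simp only [g, dif_neg h]
        omega
    have hinj : g.Injective := fun b c hbc => by
      by_cases hb : (completeGraph (Fin 5)).Adj a b <;>
        by_cases hc : (completeGraph (Fin 5)).Adj a c
      · simp only [g, dif_pos hb, dif_pos hc] at hbc
        by_contra hne
        have hx := hdisj hb hc (by simpa using ⟨hne, fun h => absurd h hc⟩) (p hb).snd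
          ((p hb).getVert_mem_support 1) (by rw [Fin.ext hbc]; exact (p hc).getVert_mem_support 1)
        have := (hadj b hb).ne'
        exact hne (f.injective ((hx.1.resolve_left this).symm.trans (hx.2.resolve_left this)))
      · have := adj_iff.1 (hadj b hb)
        simp only [g, dif_pos hb, dif_neg hc] at hbc
        omega
      · have := adj_iff.1 (hadj c hc)
        simp only [g, dif_neg hb, dif_pos hc] at hbc
        omega
      · simp only [top_adj, not_not] at hb hc
        exact hb.symm.trans hc
    have := Fintype.card_le_of_injective (fun b => (⟨g b, hg b⟩ : Fin 4))
      fun b c h => hinj (Fin.mk.inj h)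
    simp at this
  have := Fintype.card_le_of_injective (fun b => (⟨f b, hlt b⟩ : Fin 4))
    fun b c h => f.injective (Fin.ext (Fin.mk.inj h))
  simp at this

/-- The sets `L i` and the vertices `r j` stand for the two sides of a `K₃,₃` subdivision, the inner
vertices of the paths being added to the sets `L i`. -/
lemma not_exists_K33_parts (hn : n ≤ 8) (L : Fin 3 → Set (Fin n)) (l r : Fin 3 → Fin n)
    (hl : ∀ i, l i ∈ L i) (hL : ∀ i i' x, x ∈ L i → x ∈ L i' → i = i') (hr : ∀ i j, r j ∉ L i)
    (hinj : r.Injective) (hrL : ∀ i j, ∃ x ∈ L i, (stackedTetrahedron n).Adj (r j) x)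
    (hlL : ∀ i j, ∃ x, (stackedTetrahedron n).Adj (l i) x ∧ (x ∈ L i ∨ x = r j)) : False := by
  have hLne : ∀ i i' x y, i ≠ i' → x ∈ L i → y ∈ L i' → x.1 ≠ y.1 := by
    rintro i i' x y hne hx hy hxy
    exact hne (hL i i' x hx (Fin.ext hxy ▸ hy))
  have hLr : ∀ i j x, x ∈ L i → x.1 ≠ (r j).1 := by
    rintro i j x hx hxr
    exact hr i j (Fin.ext hxr ▸ hx)
  have hrne : ∀ j j', j ≠ j' → (r j).1 ≠ (r j').1 := fun j j' hne h => hne (hinj (Fin.ext h))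
  have hlne : ∀ i i', i ≠ i' → (l i).1 ≠ (l i').1 := fun i i' h => hLne i i' _ _ h (hl i) (hl i')
  have h01 : (0 : Fin 3) ≠ 1 := by decide
  have h02 : (0 : Fin 3) ≠ 2 := by decide
  have h12 : (1 : Fin 3) ≠ 2 := by decide
  have hthree : ∀ i : Fin 3, ∃ i₁ i₂ : Fin 3, i₁ ≠ i ∧ i₂ ≠ i ∧ i₁ ≠ i₂ := by decide
  have hhigh : ∀ i, (∀ x ∈ L i, ¬ x.1 < 4) →
      4 ≤ (l i).1 ∧ ∀ j, (r j).1 < 4 ∧ (r j).1 ≠ (l i).1 - 4 := by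
    intro i hi
    have := hi _ (hl i)
    refine ⟨by omega, fun j => ?_⟩
    obtain ⟨x, hx, hx' | rfl⟩ := hlL i j
    · have := hi x hx'
      rw [adj_iff] at hx
      omega
    · rw [adj_iff] at hx
      omega
  by_cases hcase : ∃ i, ∀ x ∈ L i, ¬ x.1 < 4
  · obtain ⟨i, hi⟩ := hcase
    obtain ⟨hli, hri⟩ := hhigh i hi
    have hpig : ∀ c d : ℕ, c < 4 → d < 4 → (∀ j, (r j).1 ≠ c) → (∀ j, (r j).1 ≠ d) → c = d :=
      fun c d hc hd hrc hrd => eq_of_lt_four (hri 0).1 (hri 1).1 (hri 2).1 hc hd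
        (hrne 0 1 h01) (hrne 0 2 h02) (hrc 0) (hrne 1 2 h12) (hrc 1) (hrc 2)
        (hrd 0) (hrd 1) (hrd 2)
    have hlow : ∀ i', i' ≠ i → ∃ x ∈ L i', x.1 < 4 := by
      intro i' hne
      by_contra! hi'
      obtain ⟨hli', hri'⟩ := hhigh i' (fun x hx => not_lt.2 (hi' x hx))
      have := hpig _ _ (by omega) (by omega) (fun j => (hri j).2) (fun j => (hri' j).2)
      have := hlne i' i hne
      omega
    obtain ⟨i₁, i₂, h₁, h₂, hne⟩ := hthree i
    obtain ⟨x, hx, hx4⟩ := hlow i₁ h₁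
    obtain ⟨y, hy, hy4⟩ := hlow i₂ h₂
    exact hLne _ _ x y hne hx hy (hpig _ _ hx4 hy4 (fun j => (hLr _ j x hx).symm)
      (fun j => (hLr _ j y hy).symm))
  push Not at hcase
  choose k hk hk4 using hcase
  choose x hx hxadj using hrL
  have hxr : ∀ i j, 4 ≤ (r j).1 → (x i j).1 < 4 ∧ (x i j).1 ≠ (r j).1 - 4 := by
    intro i j hj
    have := adj_iff.1 (hxadj i j)
    omega
  have hkpig : ∀ k : Fin 3 → Fin n, (∀ i, k i ∈ L i) → (∀ i, (k i).1 < 4) → ∀ c d : ℕ,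
      c < 4 → d < 4 → (∀ i, (k i).1 ≠ c) → (∀ i, (k i).1 ≠ d) → c = d :=
    fun k hk hk4 c d hc hd hkc hkd => eq_of_lt_four (hk4 0) (hk4 1) (hk4 2) hc hd
      (hLne _ _ _ _ h01 (hk 0) (hk 1)) (hLne _ _ _ _ h02 (hk 0) (hk 2)) (hkc 0)
      (hLne _ _ _ _ h12 (hk 1) (hk 2)) (hkc 1) (hkc 2) (hkd 0) (hkd 1) (hkd 2)
  by_cases hrlow : ∃ j, (r j).1 < 4
  · obtain ⟨j, hj⟩ := hrlow
    have hother : ∀ j', j' ≠ j → 4 ≤ (r j').1 ∧ (r j').1 - 4 = (r j).1 := by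
      intro j' hne
      have hj' : 4 ≤ (r j').1 := by
        by_contra! hlt
        exact hrne _ _ hne (hkpig k hk hk4 _ _ hlt hj (fun i => hLr i _ _ (hk i))
          (fun i => hLr i _ _ (hk i)))
      exact ⟨hj', hkpig (fun i => x i j') (fun i => hx i j') (fun i => (hxr i j' hj').1) _ _
        (by omega) hj (fun i => (hxr i j' hj').2) (fun i => hLr i _ _ (hx i j'))⟩
    obtain ⟨j₁, j₂, h₁, h₂, hne⟩ := hthree j
    have := hother j₁ h₁
    have := hother j₂ h₂
    have := hrne _ _ hne
    omega
  push Not at hrlow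
  have hy : ∀ j, ∃ i, ∃ y ∈ L i, y.1 = (r j).1 - 4 := by
    intro j
    by_contra! hno
    obtain ⟨j', -, hj', -⟩ := hthree j
    have h₁ := hrlow j
    have h₂ := hrlow j'
    have := hkpig (fun i => x i j') (fun i => hx i j') (fun i => (hxr i j' h₂).1)
      ((r j').1 - 4) ((r j).1 - 4) (by omega) (by omega) (fun i => (hxr i j' h₂).2)
      (fun i => hno i _ (hx i j'))
    have := hrne _ _ hj'
    omega
  choose a y hya hy using hy
  have hyne : ∀ j j', j ≠ j' → (y j).1 ≠ (y j').1 := fun j j' hne h => by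
    have := hrne _ _ hne
    have := hrlow j
    have := hrlow j'
    have := hy j
    have := hy j'
    omega
  have hy4 : ∀ j, (y j).1 < 4 := fun j => by
    have := hy j
    omega
  have haa : ∀ j j', a j = a j' := by
    intro j j'
    by_contra hne
    obtain ⟨i, hi, hi'⟩ : ∃ i, i ≠ a j ∧ i ≠ a j' := by
      generalize a j = b, a j' = b'
      revert b b'
      decide
    have hj := hxr (a j) j (hrlow j)
    have hj' := hxr (a j') j' (hrlow j')
    rw [← hy] at hj hj'
    exact hj'.2 (eq_of_lt_four (hk4 i) (hy4 j) hj.1 hj'.1 (hy4 j') (hLne _ _ _ _ hi (hk i) (hya j))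
      (hLne _ _ _ _ hi (hk i) (hx _ _)) (hLne _ _ _ _ hi' (hk i) (hx _ _)) hj.2.symm
      (hLne _ _ _ _ hne (hya j) (hx _ _)) (hLne _ _ _ _ hne (hx _ _) (hx _ _))
      (hLne _ _ _ _ hi' (hk i) (hya j')) (hLne _ _ _ _ hne (hya j) (hya j'))
      (hLne _ _ _ _ hne (hx _ _) (hya j')))
  obtain ⟨i₁, i₂, h₁, h₂, hne⟩ := hthree (a 0)
  have hyk : ∀ j i, i ≠ a 0 → (y j).1 ≠ (k i).1 := fun j i hi =>
    hLne _ _ _ _ (haa 0 j ▸ hi).symm (hya j) (hk i)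
  exact hLne _ _ _ _ hne (hk i₁) (hk i₂) (eq_of_lt_four (hy4 0) (hy4 1) (hy4 2) (hk4 _) (hk4 _)
    (hyne _ _ h01) (hyne _ _ h02) (hyk _ _ h₁) (hyne _ _ h12) (hyk _ _ h₁) (hyk _ _ h₁)
    (hyk _ _ h₂) (hyk _ _ h₂) (hyk _ _ h₂))

lemma not_containsSubdivision_K33 (hn : n ≤ 8) :
    ¬ ContainsSubdivision (completeBipartiteGraph (Fin 3) (Fin 3)) (stackedTetrahedron n) := by
  rintro ⟨f, p, -, hbranch, hdisj⟩
  have hlr : ∀ i j, (completeBipartiteGraph (Fin 3) (Fin 3)).Adj (Sum.inl i) (Sum.inr j) := by simp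
  have hnil : ∀ i j, ¬ (p (hlr i j)).Nil := fun i j =>
    Walk.not_nil_of_ne (f.injective.ne Sum.inl_ne_inr)
  have hend : ∀ i j j', f (Sum.inr j') ∈ (p (hlr i j)).support → j' = j := fun i j j' h => by
    simpa using hbranch (hlr i j) _ h
  refine not_exists_K33_parts hn
    (fun i => {x | (∀ j, x ≠ f (Sum.inr j)) ∧ ∃ j, x ∈ (p (hlr i j)).support})
    (fun i => f (Sum.inl i)) (fun j => f (Sum.inr j)) (fun i => ⟨fun j => ?_, 0, by simp⟩)
    ?_ (fun i j h => h.1 j rfl) (fun j j' h => Sum.inr_injective (f.injective h))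
    (fun i j => ?_) (fun i j => ?_)
  · exact f.injective.ne Sum.inl_ne_inr
  · rintro i i' x ⟨hx, j, hj⟩ ⟨-, j', hj'⟩
    by_contra hne
    obtain ⟨h, h'⟩ := hdisj (hlr i j) (hlr i' j') (by simp [hne]) x hj hj'
    exact hne (Sum.inl_injective (f.injective
      ((h.resolve_right (hx j)).symm.trans (h'.resolve_right (hx j')))))
  · have hadj := (p (hlr i j)).adj_penultimate (hnil i j)
    have hmem := (p (hlr i j)).getVert_mem_support ((p (hlr i j)).length - 1)
    refine ⟨_, ⟨fun j' hj' => ?_, j, hmem⟩, hadj.symm⟩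
    have hj := hend i j j' (hj' ▸ hmem)
    exact hadj.ne (hj'.trans (congrArg _ (congrArg _ hj)))
  · have hadj := (p (hlr i j)).adj_snd (hnil i j)
    have hmem := (p (hlr i j)).getVert_mem_support 1
    refine ⟨_, hadj, ?_⟩
    by_cases hj' : ∃ j', (p (hlr i j)).snd = f (Sum.inr j')
    · obtain ⟨j', hj'⟩ := hj'
      obtain rfl := hend i j j' (hj' ▸ hmem)
      exact Or.inr hj'
    · push Not at hj'
      exact Or.inl ⟨hj', j, hmem⟩

lemma isPlanar (hn : n ≤ 8) : IsPlanar (stackedTetrahedron n) :=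
  ⟨not_containsSubdivision_K5 hn, not_containsSubdivision_K33 hn⟩

end stackedTetrahedron

theorem stmt_17 (n : ℕ) (hn : 3 ≤ n) (hn' : n ≤ 8) :
    IsGreatest {m : ℕ | ∃ G : SimpleGraph (Fin n), IsPlanar G ∧
        ¬ ContainsInduced (pathGraph 5) G ∧ G.edgeSet.ncard = m} (3 * n - 6) := by
  refine ⟨⟨stackedTetrahedron n, stackedTetrahedron.isPlanar hn',
    stackedTetrahedron.not_containsInduced_pathGraph,
    stackedTetrahedron.ncard_edgeSet hn hn'⟩, ?_⟩
  rintro _ ⟨G, hG, -, rfl⟩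
  simpa using ncard_edgeSet_le_of_isPlanar hG (by simpa using hn)
end
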